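/- arXiv:2007.12513 — 3 statements merged into one kernel-verified Lean document; each statement's English description precedes it below -/
import Mathlib

section
/- A graph G is 2-connected if and only if it has an ear-decomposition, i.e., a nested sequence of subgraphs G_0 ⊆ G_1 ⊆ ... ⊆ G_s = G such that G_0 is a cycle and each G_{i+1} is obtained from G_i by adding a G_i-ear (a path whose endpoints lie in G_i but whose inner vertices do not). -/
/-- `w` is an `H`-ear: a path in `G` whose endpoints lie in `H`, whose inner vertices do
not lie in `H`, and whose edges are not edges of `H`. -/
def IsEar {V : Type*} {G : SimpleGraph V} (H : G.Subgraph) {x y : V}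
    (w : G.Walk x y) : Prop :=
  w.IsPath ∧ x ∈ H.verts ∧ y ∈ H.verts ∧
    (∀ v ∈ w.support, v ≠ x → v ≠ y → v ∉ H.verts) ∧
    ∀ e ∈ w.edges, e ∉ H.edgeSet

/-- `G` has an ear-decomposition: a nested sequence of subgraphs starting from a cycle,
each obtained from the previous one by adding an ear, and ending with all of `G`. -/
def HasEarDecomposition {V : Type*} (G : SimpleGraph V) : Prop :=
  ∃ (s : ℕ) (Gs : Fin (s + 1) → G.Subgraph),
    (∃ (u : V) (w : G.Walk u u), w.IsCycle ∧ Gs 0 = w.toSubgraph) ∧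
    Gs (Fin.last s) = ⊤ ∧
    ∀ i : Fin s, ∃ (x y : V) (w : G.Walk x y),
      IsEar (Gs i.castSucc) w ∧ Gs i.succ = Gs i.castSucc ⊔ w.toSubgraph

namespace SimpleGraph

variable {V : Type*} {G : SimpleGraph V}

namespace Subgraph

/-- `a` and `b` are joined by a walk in `H` that does not visit `v`. -/
def ReachableAvoiding (H : G.Subgraph) (v a b : V) : Prop :=
  ∃ w : G.Walk a b, v ∉ w.support ∧ w.toSubgraph ≤ H

theorem ReachableAvoiding.symm {H : G.Subgraph} {v a b : V} (h : H.ReachableAvoiding v a b) :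
    H.ReachableAvoiding v b a := by
  obtain ⟨w, hv, hw⟩ := h
  exact ⟨w.reverse, by simpa using hv, by simpa using hw⟩

theorem ReachableAvoiding.trans {H : G.Subgraph} {v a b c : V}
    (h : H.ReachableAvoiding v a b) (h' : H.ReachableAvoiding v b c) :
    H.ReachableAvoiding v a c := by
  obtain ⟨w, hv, hw⟩ := h
  obtain ⟨w', hv', hw'⟩ := h'
  exact ⟨w.append w', by simp [Walk.mem_support_append_iff, hv, hv'],
    by simpa [Walk.toSubgraph_append] using ⟨hw, hw'⟩⟩

theorem ReachableAvoiding.mono {H K : G.Subgraph} {v a b : V} (hHK : H ≤ K)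
    (h : H.ReachableAvoiding v a b) : K.ReachableAvoiding v a b := by
  obtain ⟨w, hv, hw⟩ := h
  exact ⟨w, hv, hw.trans hHK⟩

/-- Deleting any single vertex from `H` leaves a preconnected graph. -/
def PreconnectedAvoiding (H : G.Subgraph) : Prop :=
  ∀ v, ∀ a ∈ H.verts, ∀ b ∈ H.verts, a ≠ v → b ≠ v → H.ReachableAvoiding v a b

/-- The subgraphs of `G` obtained from a cycle by successively adding ears. -/
inductive EarConstructible : G.Subgraph → Prop
  | cycle {u : V} (w : G.Walk u u) (hw : w.IsCycle) : EarConstructible w.toSubgraph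
  | ear {H : G.Subgraph} (hH : EarConstructible H) {x y : V} (w : G.Walk x y) (hw : IsEar H w) :
      EarConstructible (H ⊔ w.toSubgraph)

theorem EarConstructible.exists_sequence {H : G.Subgraph} (hH : H.EarConstructible) :
    ∃ (s : ℕ) (Gs : Fin (s + 1) → G.Subgraph),
      (∃ (u : V) (w : G.Walk u u), w.IsCycle ∧ Gs 0 = w.toSubgraph) ∧
      Gs (Fin.last s) = H ∧
      ∀ i : Fin s, ∃ (x y : V) (w : G.Walk x y),
        IsEar (Gs i.castSucc) w ∧ Gs i.succ = Gs i.castSucc ⊔ w.toSubgraph := by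
  induction hH with
  | cycle w hw => exact ⟨0, fun _ => w.toSubgraph, ⟨_, w, hw, rfl⟩, rfl, fun i => i.elim0⟩
  | @ear H hH x y w hw ih =>
    obtain ⟨s, Gs, ⟨u, c, hc, h0⟩, hlast, hstep⟩ := ih
    refine ⟨s + 1, Fin.snoc Gs (H ⊔ w.toSubgraph), ⟨u, c, hc, ?_⟩, by simp, fun i => ?_⟩
    · rw [← Fin.castSucc_zero, Fin.snoc_castSucc, h0]
    · induction i using Fin.lastCases with
      | last => exact ⟨x, y, w, by rwa [Fin.snoc_castSucc, hlast],
          by rw [Fin.succ_last, Fin.snoc_last, Fin.snoc_castSucc, hlast]⟩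
      | cast i =>
        rw [Fin.succ_castSucc, Fin.snoc_castSucc, Fin.snoc_castSucc]
        exact hstep i

end Subgraph

theorem hasEarDecomposition_iff_earConstructible_top :
    HasEarDecomposition G ↔ (⊤ : G.Subgraph).EarConstructible := by
  refine ⟨?_, fun h => h.exists_sequence⟩
  rintro ⟨s, Gs, ⟨u, c, hc, h0⟩, hlast, hstep⟩
  have h : ∀ i, (Gs i).EarConstructible := by
    intro i
    induction i using Fin.induction with
    | zero => exact h0 ▸ .cycle c hc
    | succ i ih =>
      obtain ⟨x, y, w, hw, h⟩ := hstep i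
      exact h ▸ .ear ih w hw
  exact hlast ▸ h _

theorem Walk.IsPath.reachableAvoiding_start_or_end {x y a v : V} {p : G.Walk x y}
    (hp : p.IsPath) (ha : a ∈ p.support) (hav : a ≠ v) :
    (x ≠ v ∧ p.toSubgraph.ReachableAvoiding v a x) ∨
      (y ≠ v ∧ p.toSubgraph.ReachableAvoiding v a y) := by
  obtain ⟨q, r, rfl⟩ := Walk.mem_support_iff_exists_append.mp ha
  by_cases hq : v ∈ q.support
  · have hr : v ∉ r.support := fun hr =>
      hp.ne_of_mem_support_of_append hav.symm hq hr rfl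
    refine .inr ⟨fun h => hr (h ▸ r.end_mem_support), r, hr, ?_⟩
    simp [Walk.toSubgraph_append]
  · refine .inl ⟨fun h => hq (h ▸ q.start_mem_support), .symm ⟨q, hq, ?_⟩⟩
    simp [Walk.toSubgraph_append]

theorem Walk.IsCycle.preconnectedAvoiding_toSubgraph {u : V} {c : G.Walk u u} (hc : c.IsCycle) :
    c.toSubgraph.PreconnectedAvoiding := by
  classical
  intro v
  suffices h : ∃ z, ∀ a ∈ c.toSubgraph.verts, a ≠ v → c.toSubgraph.ReachableAvoiding v a z by
    obtain ⟨z, hz⟩ := h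
    exact fun a ha b hb hav hbv => (hz a ha hav).trans (hz b hb hbv).symm
  by_cases hv : v ∈ c.support
  · have hc' := hc.rotate hv
    rw [← c.toSubgraph_rotate hv]
    generalize c.rotate v hv = d at hc'
    cases d with
    | nil => exact absurd hc' Walk.not_isCycle_nil
    | @cons _ z _ h p =>
      have hp := ((Walk.cons_isCycle_iff p h).mp hc').1
      refine ⟨z, fun a ha hav => ?_⟩
      have ha' : a ∈ p.support := by
        rw [Walk.mem_verts_toSubgraph, Walk.support_cons, List.mem_cons] at ha
        exact ha.resolve_left hav
      rcases hp.reachableAvoiding_start_or_end ha' hav with h | h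
      · exact h.2.mono (by simp [Walk.toSubgraph])
      · exact absurd rfl h.1
  · refine ⟨u, fun a ha _ => ?_⟩
    obtain ⟨q, r, rfl⟩ := Walk.mem_support_iff_exists_append.mp (c.mem_verts_toSubgraph.mp ha)
    refine .symm ⟨q, fun h => hv (by simp [Walk.mem_support_append_iff, h]), ?_⟩
    simp [Walk.toSubgraph_append]

namespace Subgraph

theorem PreconnectedAvoiding.sup_ear {H : G.Subgraph} (hH : H.PreconnectedAvoiding) {x y : V}
    {w : G.Walk x y} (hw : IsEar H w) : (H ⊔ w.toSubgraph).PreconnectedAvoiding := by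
  obtain ⟨hp, hx, hy, -, -⟩ := hw
  intro v
  have key : ∀ a ∈ (H ⊔ w.toSubgraph).verts, a ≠ v →
      ∃ z ∈ H.verts, z ≠ v ∧ (H ⊔ w.toSubgraph).ReachableAvoiding v a z := by
    rintro a (ha | ha) hav
    · exact ⟨a, ha, hav, (hH v a ha a ha hav hav).mono le_sup_left⟩
    · rcases hp.reachableAvoiding_start_or_end (w.mem_verts_toSubgraph.mp ha) hav with h | h
      · exact ⟨x, hx, h.1, h.2.mono le_sup_right⟩
      · exact ⟨y, hy, h.1, h.2.mono le_sup_right⟩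
  intro a ha b hb hav hbv
  obtain ⟨a', ha', hav', haa'⟩ := key a ha hav
  obtain ⟨b', hb', hbv', hbb'⟩ := key b hb hbv
  exact haa'.trans (((hH v a' ha' b' hb' hav' hbv').mono le_sup_left).trans hbb'.symm)

theorem EarConstructible.preconnectedAvoiding {H : G.Subgraph} (hH : H.EarConstructible) :
    H.PreconnectedAvoiding := by
  induction hH with
  | cycle w hw => exact hw.preconnectedAvoiding_toSubgraph
  | ear _ w hw ih => exact ih.sup_ear hw

theorem EarConstructible.exists_ne {H : G.Subgraph} (hH : H.EarConstructible) (x : V) :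
    ∃ y ∈ H.verts, y ≠ x := by
  induction hH with
  | @cycle u w hw =>
    have h := w.toSubgraph_adj_snd hw.not_nil
    by_cases hu : u = x
    · exact ⟨_, h.snd_mem, fun h' => h.ne (hu.trans h'.symm)⟩
    · exact ⟨u, h.fst_mem, hu⟩
  | ear _ w hw ih =>
    obtain ⟨y, hy, hyx⟩ := ih
    exact ⟨y, .inl hy, hyx⟩

theorem preconnectedAvoiding_top_iff :
    (⊤ : G.Subgraph).PreconnectedAvoiding ↔
      ∀ v : V, ((⊤ : G.Subgraph).deleteVerts {v}).coe.Preconnected := by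
  constructor
  · rintro h v ⟨a, ha⟩ ⟨b, hb⟩
    obtain ⟨w, hv, -⟩ := h v a trivial b trivial ha.2 hb.2
    induction w with
    | nil => rfl
    | @cons a c b hac p ih =>
      simp only [Walk.support_cons, List.mem_cons, not_or] at hv
      have hc : c ≠ v := fun h => hv.2 (h ▸ p.start_mem_support)
      refine Reachable.trans (Adj.reachable ?_) (ih ⟨trivial, hc⟩ hb hv.2)
      exact Subgraph.deleteVerts_adj.mpr ⟨trivial, ha.2, trivial, hc, hac⟩
  · intro h v a _ b _ hav hbv
    have hmem : ∀ {c}, c ≠ v → c ∈ ((⊤ : G.Subgraph).deleteVerts {v}).verts := by simp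
    obtain ⟨w⟩ := h v ⟨a, hmem hav⟩ ⟨b, hmem hbv⟩
    refine ⟨w.map (Subgraph.hom _), ?_, le_top⟩
    intro hv
    obtain ⟨z, -, hz⟩ := List.mem_map.mp (Walk.support_map _ w ▸ hv)
    exact z.2.2 hz

end Subgraph

/-- Every walk ending in `S` can be shortened to a path that stops at its first vertex in `S`. -/
theorem Walk.exists_isPath_forall_mem_imp_eq {S : Set V} {z b : V} (w : G.Walk z b) (hb : b ∈ S) :
    ∃ y ∈ S, ∃ p : G.Walk z y, p.IsPath ∧ p.support ⊆ w.support ∧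
      ∀ v ∈ p.support, v ∈ S → v = y := by
  classical
  induction w with
  | nil => exact ⟨_, hb, .nil, by simp⟩
  | @cons z c b h w ih =>
    by_cases hz : z ∈ S
    · exact ⟨z, hz, .nil, by simp⟩
    obtain ⟨y, hy, p, -, hsub, hS⟩ := ih hb
    have hbp := (Walk.cons h p).support_bypass_subset_support
    refine ⟨y, hy, (Walk.cons h p).bypass, Walk.bypass_isPath _, fun v hv => ?_, fun v hv hvS => ?_⟩
    · have := hbp hv
      rw [Walk.support_cons, List.mem_cons] at this ⊢
      exact this.imp_right (@hsub v)
    · have := hbp hv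
      rw [Walk.support_cons, List.mem_cons] at this
      rcases this with rfl | h'
      · exact absurd hvS hz
      · exact hS v h' hvS

theorem exists_isCycle_of_preconnectedAvoiding [Nontrivial V] (hG : G.Connected)
    (h : (⊤ : G.Subgraph).PreconnectedAvoiding) (h3 : ∀ a b : V, ∃ c, c ≠ a ∧ c ≠ b) :
    ∃ (u : V) (c : G.Walk u u), c.IsCycle := by
  classical
  obtain ⟨v⟩ := hG.nonempty
  obtain ⟨a, hva⟩ := hG.preconnected.exists_adj_of_nontrivial v
  obtain ⟨c, hcv, hca⟩ := h3 v a
  obtain ⟨w, hw, -⟩ := h a v trivial c trivial hva.ne hca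
  cases w with
  | nil => exact absurd rfl hcv
  | @cons _ b _ hvb q =>
    have hab : b ≠ a := fun h => hw (by simp [← h])
    obtain ⟨p, hp, -⟩ := h v a trivial b trivial hva.ne' hvb.ne'
    have hvp : v ∉ p.bypass.support := fun h' => hp (p.support_bypass_subset_support h')
    refine ⟨v, .cons hva (p.bypass.concat hvb.symm), ?_⟩
    rw [Walk.cons_isCycle_iff, Walk.concat_isPath_iff]
    refine ⟨⟨p.bypass_isPath, hvp⟩, ?_⟩
    rw [Walk.edges_concat, List.concat_eq_append, List.mem_append, not_or]
    refine ⟨fun h' => hvp (Walk.fst_mem_support_of_mem_edges _ h'), ?_⟩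
    simp [hab.symm, hva.ne']

theorem Subgraph.exists_adj_not_adj_of_ne_top (hG : G.Connected) {H : G.Subgraph}
    (hne : H.verts.Nonempty) (hH : H ≠ ⊤) : ∃ x ∈ H.verts, ∃ z, G.Adj x z ∧ ¬ H.Adj x z := by
  by_contra! hcon
  obtain ⟨x, hx⟩ := hne
  have hverts : ∀ v, v ∈ H.verts := by
    intro v
    by_contra hv
    obtain ⟨w⟩ := hG.preconnected x v
    obtain ⟨d, -, hd, hd'⟩ := w.exists_boundary_dart H.verts hx hv
    exact hd' (hcon _ hd _ d.adj).snd_mem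
  exact hH (top_le_iff.mp ⟨fun v _ => hverts v, fun a b hab => hcon a (hverts a) b hab⟩)

theorem Subgraph.exists_isEar_lt_sup (hG : G.Connected)
    (h : (⊤ : G.Subgraph).PreconnectedAvoiding) {H : G.Subgraph}
    (hne : ∀ x, ∃ y ∈ H.verts, y ≠ x) (hH : H ≠ ⊤) :
    ∃ (x y : V) (w : G.Walk x y), IsEar H w ∧ H < H ⊔ w.toSubgraph := by
  obtain ⟨v⟩ := hG.nonempty
  obtain ⟨x, hx, z, hxz, hnadj⟩ :=
    exists_adj_not_adj_of_ne_top hG ((hne v).imp fun _ => And.left) hH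
  obtain ⟨b, hb, hbx⟩ := hne x
  obtain ⟨w, hw, -⟩ := h x z trivial b trivial hxz.ne' hbx
  obtain ⟨y, hy, p, hp, hsub, hS⟩ := w.exists_isPath_forall_mem_imp_eq hb
  have hxp : x ∉ p.support := fun h' => hw (hsub h')
  refine ⟨x, y, .cons hxz p, ⟨hp.cons hxp, hx, hy, ?_, ?_⟩, lt_of_le_not_ge le_sup_left ?_⟩
  · intro u hu hux huy huH
    rw [Walk.support_cons, List.mem_cons] at hu
    exact huy (hS u (hu.resolve_left hux) huH)
  · intro e he heH
    rw [Walk.edges_cons, List.mem_cons] at he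
    rcases he with rfl | he
    · exact hnadj heH
    · induction e with
      | _ a b =>
        have hab : H.Adj a b := heH
        exact hab.ne ((hS a (p.fst_mem_support_of_mem_edges he) hab.fst_mem).trans
          (hS b (p.snd_mem_support_of_mem_edges he) hab.snd_mem).symm)
  · intro hle
    exact hnadj (hle.2 (.inr (by simp [Walk.toSubgraph])))

theorem Subgraph.earConstructible_top [Finite V] [Nontrivial V] (hG : G.Connected)
    (h : (⊤ : G.Subgraph).PreconnectedAvoiding) (h3 : ∀ a b : V, ∃ c, c ≠ a ∧ c ≠ b) :
    (⊤ : G.Subgraph).EarConstructible := by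
  obtain ⟨u, c, hc⟩ := exists_isCycle_of_preconnectedAvoiding hG h h3
  obtain ⟨H, -, hH⟩ := (Set.toFinite {H : G.Subgraph | H.EarConstructible}).exists_le_maximal
    (EarConstructible.cycle c hc)
  by_contra htop
  have hne : H ≠ ⊤ := fun h' => htop (h' ▸ hH.prop)
  obtain ⟨x, y, w, hw, hlt⟩ :=
    exists_isEar_lt_sup hG h (EarConstructible.exists_ne hH.prop) hne
  exact hH.not_prop_of_gt hlt (.ear hH.prop w hw)

end SimpleGraph

/-- A graph on at least 3 vertices is 2-connected (connected and with no cut vertex,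
i.e. deleting any single vertex leaves it connected) iff it has an ear-decomposition. -/
theorem stmt4 {V : Type*} [Fintype V] (G : SimpleGraph V)
    (h3 : 3 ≤ Fintype.card V) :
    (G.Connected ∧ ∀ v : V, ((⊤ : G.Subgraph).deleteVerts {v}).coe.Connected)
      ↔ HasEarDecomposition G := by
  classical
  have h3' : ∀ a b : V, ∃ c, c ≠ a ∧ c ≠ b := by
    intro a b
    obtain ⟨c, hc⟩ := Finset.exists_mem_notMem_of_card_lt_card
      (s := {a, b}) (t := Finset.univ) (Finset.card_le_two.trans_lt h3)
    exact ⟨c, by simpa using hc⟩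
  have : Nontrivial V := Fintype.one_lt_card_iff_nontrivial.mp (by omega)
  rw [SimpleGraph.hasEarDecomposition_iff_earConstructible_top]
  constructor
  · rintro ⟨hG, h⟩
    exact SimpleGraph.Subgraph.earConstructible_top hG
      (SimpleGraph.Subgraph.preconnectedAvoiding_top_iff.mpr fun v => (h v).preconnected) h3'
  · intro h
    have hpre := h.preconnectedAvoiding
    refine ⟨⟨fun a b => ?_⟩, fun v => ?_⟩
    · obtain ⟨c, hca, hcb⟩ := h3' a b
      obtain ⟨w, -⟩ := hpre c a trivial b trivial hca.symm hcb.symm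
      exact ⟨w⟩
    · obtain ⟨c, hcv, -⟩ := h3' v v
      have : Nonempty ((⊤ : G.Subgraph).deleteVerts {v}).verts := ⟨⟨c, trivial, hcv⟩⟩
      exact ⟨SimpleGraph.Subgraph.preconnectedAvoiding_top_iff.mp hpre v⟩
end

section
/- If a 2-connected n-vertex graph has no two cycles of the same length, then it has at most n + sqrt(n) + o(sqrt(n)) edges; more precisely, for every ε > 0 there exists n_0 such that for all n ≥ n_0, every n-vertex 2-connected graph with no two cycles of the same length has at most n + (1 + ε) sqrt(n) edges. -/
/-- A finset of edges forms a cycle of the graph `G` if it is the edge set of some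
cycle walk in `G`. -/
def IsCycleSet {V : Type*} [DecidableEq V] (G : SimpleGraph V) (s : Finset (Sym2 V)) : Prop :=
  ∃ (u : V) (w : G.Walk u u), w.IsCycle ∧ w.edges.toFinset = s

open scoped symmDiff

namespace CycleSpace

variable {E : Type*} [Fintype E] [DecidableEq E]

/-- A family of finite sets that contains `∅` and is closed under symmetric difference,
i.e. a binary vector space of subsets of `E`. -/
structure SymmClosed (W : Set (Finset E)) : Prop where
  empty_mem : ∅ ∈ W
  symmDiff_mem : ∀ {a b}, a ∈ W → b ∈ W → a ∆ b ∈ W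

/-- The members of `W` that avoid `X`. -/
def del (W : Set (Finset E)) (X : Finset E) : Set (Finset E) := {w | w ∈ W ∧ Disjoint w X}

/-- `S` is a separator of `W` if `W` is the direct sum of its parts inside and outside `S`. -/
def Sep (W : Set (Finset E)) (S : Finset E) : Prop := ∀ w ∈ W, w ∩ S ∈ W

/-- Two elements are related if no separator distinguishes them. -/
def Rel (W : Set (Finset E)) (u v : E) : Prop := ∀ S, Sep W S → (u ∈ S ↔ v ∈ S)

open Classical in
/-- The connected component of `u`. -/
noncomputable def cls (W : Set (Finset E)) (u : E) : Finset E := Finset.univ.filter (Rel W u)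

variable {W : Set (Finset E)} {X S T : Finset E} {u v w e : E}

omit [Fintype E] in
lemma SymmClosed.del (hW : SymmClosed W) (X : Finset E) : SymmClosed (del W X) := by
  refine ⟨⟨hW.empty_mem, by simp⟩, ?_⟩
  rintro a b ⟨ha, ha'⟩ ⟨hb, hb'⟩
  refine ⟨hW.symmDiff_mem ha hb, ?_⟩
  rw [Finset.disjoint_left] at *
  intro x hx
  rw [Finset.mem_symmDiff] at hx
  grind

omit [Fintype E] in
lemma del_del (W : Set (Finset E)) (X Y : Finset E) : del (del W X) Y = del W (X ∪ Y) := by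
  ext w; simp [del, Finset.disjoint_union_right, and_assoc]

omit [Fintype E] [DecidableEq E] in
lemma del_empty (W : Set (Finset E)) : del W ∅ = W := by
  ext w; simp [del]

omit [Fintype E] in
lemma Sep.inter (hS : Sep W S) (hT : Sep W T) : Sep W (S ∩ T) := by
  intro w hw
  rw [← Finset.inter_assoc]
  exact hT _ (hS _ hw)

lemma Sep.compl (hW : SymmClosed W) (hS : Sep W S) : Sep W Sᶜ := by
  intro w hw
  have : w ∩ Sᶜ = w ∆ (w ∩ S) := by
    ext x; simp only [Finset.mem_inter, Finset.mem_compl, Finset.mem_symmDiff]; tauto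
  rw [this]
  exact hW.symmDiff_mem hw (hS w hw)

omit [Fintype E] in
lemma Sep.del (hS : Sep W S) (X : Finset E) : Sep (del W X) S :=
  fun w hw => ⟨hS w hw.1, hw.2.mono_left Finset.inter_subset_left⟩

omit [Fintype E] in
lemma Rel.refl (W : Set (Finset E)) (u : E) : Rel W u u := fun _ _ => Iff.rfl

omit [Fintype E] in
lemma Rel.symm (h : Rel W u v) : Rel W v u := fun S hS => (h S hS).symm

omit [Fintype E] in
lemma Rel.trans (h : Rel W u v) (h' : Rel W v w) : Rel W u w :=
  fun S hS => (h S hS).trans (h' S hS)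

omit [Fintype E] in
lemma Rel.of_del (h : Rel (CycleSpace.del W X) u v) : Rel W u v := fun S hS => h S (hS.del X)

lemma mem_cls : v ∈ cls W u ↔ Rel W u v := by simp [cls]

lemma self_mem_cls (W : Set (Finset E)) (u : E) : u ∈ cls W u := mem_cls.2 (Rel.refl W u)

lemma cls_eq (h : Rel W u v) : cls W u = cls W v := by
  ext x; rw [mem_cls, mem_cls]; exact ⟨h.symm.trans, h.trans⟩

lemma cls_del_subset : cls (del W X) u ⊆ cls W u := by
  intro x hx; rw [mem_cls] at *; exact hx.of_del

lemma sep_cls (hW : SymmClosed W) (u : E) : Sep W (cls W u) := by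
  classical
  have hne : (Finset.univ.filter fun S : Finset E => Sep W S ∧ u ∈ S).Nonempty :=
    ⟨Finset.univ, by
      simp only [Finset.mem_filter, Finset.mem_univ, true_and, and_true]
      intro w hw
      simpa using hw⟩
  obtain ⟨S, hS, hmin⟩ := Finset.exists_min_image _ Finset.card hne
  simp only [Finset.mem_filter, Finset.mem_univ, true_and] at hS hmin
  have key : ∀ T, Sep W T → u ∈ T → S ⊆ T := by
    intro T hT hu
    have h1 := hmin (S ∩ T) ⟨hS.1.inter hT, Finset.mem_inter.2 ⟨hS.2, hu⟩⟩
    have h2 := Finset.eq_of_subset_of_card_le (Finset.inter_subset_left (s₁ := S) (s₂ := T)) h1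
    exact Finset.inter_eq_left.1 h2
  have : cls W u = S := by
    ext x
    rw [mem_cls]
    constructor
    · intro h; exact (h S hS.1).1 hS.2
    · intro hx T hT
      constructor
      · intro hu; exact key T hT hu hx
      · intro hxT
        by_contra hu
        have := key _ (hT.compl hW) (Finset.mem_compl.2 hu) hx
        exact Finset.mem_compl.1 this hxT
  rw [this]; exact hS.1

/-- Deleting elements outside a component does not change that component. -/
lemma Rel.del_of_disjoint (hW : SymmClosed W) (h : Rel W u v) (hX : Disjoint (cls W u) X) :
    Rel (CycleSpace.del W X) u v := by
  intro S hS
  have hsep : Sep W (cls W u ∩ S) := by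
    intro w hw
    have h1 : w ∩ cls W u ∈ CycleSpace.del W X :=
      ⟨sep_cls hW u w hw, hX.mono_left Finset.inter_subset_right⟩
    have h2 := (hS _ h1).1
    rwa [Finset.inter_assoc] at h2
  have := h _ hsep
  simpa [self_mem_cls, mem_cls.2 h] using this

lemma cls_del_eq (hW : SymmClosed W) (hX : Disjoint (cls W u) X) :
    cls (del W X) u = cls W u := by
  refine Finset.Subset.antisymm cls_del_subset fun x hx => ?_
  rw [mem_cls] at *
  exact hx.del_of_disjoint hW hX

omit [Fintype E] in
/-- A separator of a single-element deletion that is split off by a member through the deleted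
element is a separator of the whole space. -/
lemma sep_of_witness (hW : SymmClosed W) (hS : Sep (del W {e}) S) {c : Finset E} (hc : c ∈ W)
    (hec : e ∈ c) (hcS : c ∩ S ∈ W) : Sep W S := by
  intro w hw
  by_cases he : e ∈ w
  · have h1 : w ∆ c ∈ del W {e} :=
      ⟨hW.symmDiff_mem hw hc, by simp [Finset.mem_symmDiff, he, hec]⟩
    have h2 := hW.symmDiff_mem (hS _ h1).1 hcS
    have h3 : ((w ∆ c) ∩ S) ∆ (c ∩ S) = w ∩ S := by
      ext x; simp only [Finset.mem_inter, Finset.mem_symmDiff]; tauto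
    rwa [h3] at h2
  · exact (hS w ⟨hw, by simpa using he⟩).1

/-- An element related to another one lies in some member inside its component. -/
lemma exists_mem_of_rel (hW : SymmClosed W) (h : Rel W u e) (hne : u ≠ e) :
    ∃ c ∈ W, e ∈ c ∧ c ⊆ cls W e := by
  by_cases hex : ∃ c ∈ W, e ∈ c
  · obtain ⟨c, hc, hec⟩ := hex
    exact ⟨c ∩ cls W e, sep_cls hW e c hc, Finset.mem_inter.2 ⟨hec, self_mem_cls W e⟩,
      Finset.inter_subset_right⟩
  · push Not at hex
    have : Sep W {e} := by
      intro w hw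
      rw [Finset.inter_singleton_of_notMem (hex w hw)]
      exact hW.empty_mem
    exact absurd (Finset.mem_singleton.1 ((h _ this).2 (Finset.mem_singleton_self e))) hne

end CycleSpace

namespace CycleSpace

variable {E : Type*} [Fintype E] [DecidableEq E] {W : Set (Finset E)} {X : Finset E} {u v e : E}

lemma not_rel_of_mem_deleted (hW : SymmClosed W) (he : e ∈ X) (hne : u ≠ e) :
    ¬ Rel (del W X) u e := by
  intro h
  obtain ⟨c, hc, hec, -⟩ := exists_mem_of_rel (hW.del X) h hne
  exact Finset.disjoint_left.1 hc.2 hec he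

lemma disjoint_cls (h : ¬ Rel W u v) : Disjoint (cls W u) (cls W v) := by
  rw [Finset.disjoint_left]
  intro x hx hx'
  rw [mem_cls] at hx hx'
  exact h (hx.trans hx'.symm)

section Leaf

variable {ι : Type*} [DecidableEq ι] {D : ι → E} {J : Finset ι} {Z : Finset E}

/-- Deleting one further element never splits a component so that three elements of `Z` become
pairwise unrelated. -/
def NoTriple (W : Set (Finset E)) (D : ι → E) (J : Finset ι) (Z : Finset E) : Prop :=
  ∀ I ⊆ J, ∀ i ∈ J, ∀ u ∈ Z, ∀ v ∈ Z, ∀ w ∈ Z,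
    Rel (del W (I.image D)) u v → Rel (del W (I.image D)) u w →
    ¬ Rel (del W ((insert i I).image D)) u v → ¬ Rel (del W ((insert i I).image D)) u w →
    Rel (del W ((insert i I).image D)) v w

omit [Fintype E] in
lemma NoTriple.mono (h : NoTriple W D J Z) {J' : Finset ι} (hJ : J' ⊆ J) : NoTriple W D J' Z :=
  fun I hI i hi => h I (hI.trans hJ) i (hJ hi)

omit [Fintype E] in
lemma NoTriple.del {i : ι} (h : NoTriple W D (insert i J) Z) :
    NoTriple (CycleSpace.del W {D i}) D J Z := by
  intro I hI j hj u hu v hv w hw h1 h2 h3 h4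
  have e1 : CycleSpace.del (CycleSpace.del W {D i}) (I.image D)
      = CycleSpace.del W ((insert i I).image D) := by
    rw [del_del, Finset.image_insert, Finset.insert_eq]
  have e2 : CycleSpace.del (CycleSpace.del W {D i}) ((insert j I).image D)
      = CycleSpace.del W ((insert j (insert i I)).image D) := by
    rw [del_del, ← Finset.insert_eq, ← Finset.image_insert, Finset.insert_comm]
  rw [e1] at h1 h2
  rw [e2] at h3 h4 ⊢
  exact h (insert i I) (Finset.insert_subset_insert i hI) j (Finset.mem_insert_of_mem hj)
    u hu v hv w hw h1 h2 h3 h4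

/-- If every deletion `D i` separates `Z`, then some `D i` splits off a component, meeting `Z`,
that contains none of the elements `D j`. -/
lemma exists_leaf (hW : SymmClosed W) (hrel : ∀ u ∈ Z, ∀ v ∈ Z, Rel W u v)
    (hDZ : ∀ i ∈ J, D i ∉ Z) (hT : NoTriple W D J Z) (hJ : J.Nonempty)
    (hsplit : ∀ i ∈ J, ∃ u ∈ Z, ∃ v ∈ Z, ¬ Rel (del W {D i}) u v) :
    ∃ i ∈ J, ∃ u ∈ Z, ∀ j ∈ J, D j ∉ cls (del W {D i}) u := by
  classical
  have hsplit' : ∀ i ∈ J, ∀ u ∈ Z, ∃ v ∈ Z, ¬ Rel (del W {D i}) u v := by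
    intro i hi u hu
    obtain ⟨a, ha, b, hb, hab⟩ := hsplit i hi
    by_cases h : Rel (del W {D i}) u a
    · exact ⟨b, hb, fun h' => hab (h.symm.trans h')⟩
    · exact ⟨a, ha, h⟩
  have hne : (J ×ˢ Z).Nonempty := by
    obtain ⟨i, hi⟩ := hJ
    obtain ⟨a, ha, -⟩ := hsplit i hi
    exact ⟨(i, a), Finset.mem_product.2 ⟨hi, ha⟩⟩
  obtain ⟨⟨i, u⟩, hiu, hmin⟩ := Finset.exists_min_image (J ×ˢ Z)
    (fun a => (cls (del W {D a.1}) a.2).card) hne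
  obtain ⟨hi, hu⟩ := Finset.mem_product.1 hiu
  refine ⟨i, hi, u, hu, fun j hj hf => ?_⟩
  simp only at hi hu
  have hue : u ≠ D i := fun h => hDZ i hi (h ▸ hu)
  obtain ⟨v0, hv0, huv0⟩ := hsplit' i hi u hu
  have hMR : Disjoint (cls (del W {D i}) v0) {D j} := by
    rw [Finset.disjoint_singleton_right]
    exact Finset.disjoint_left.1 (disjoint_cls huv0) hf
  have hMR' : cls (del W {D i}) v0 ⊆ cls (del W {D j}) v0 := by
    rw [← cls_del_eq (hW.del _) hMR, del_del, Finset.union_comm, ← del_del]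
    exact cls_del_subset
  obtain ⟨v1, hv1, hv01⟩ := hsplit' j hj v0 hv0
  by_cases heN : D i ∈ cls (del W {D j}) v1
  · rw [mem_cls] at heN
    obtain ⟨c, hc, hec, hcN⟩ := exists_mem_of_rel (hW.del _) heN (fun h => hDZ i hi (h ▸ hv1))
    rw [← cls_eq heN] at hcN
    have hdisj : c ∩ cls (del W {D i}) v0 = ∅ := by
      rw [← Finset.disjoint_iff_inter_eq_empty]
      exact ((disjoint_cls hv01).mono hMR' hcN).symm
    have hsep : Sep W (cls (del W {D i}) v0) :=
      sep_of_witness hW (sep_cls (hW.del _) v0) hc.1 hec (by rw [hdisj]; exact hW.empty_mem)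
    have h1 := (hrel v0 hv0 u hu _ hsep).1 (self_mem_cls _ _)
    exact huv0 (mem_cls.1 h1).symm
  · have hN : cls (del W {D j}) v1 ⊆ cls (del W {D i}) v1 := by
      rw [← cls_del_eq (hW.del {D j}) (Finset.disjoint_singleton_right.2 heN), del_del,
        Finset.union_comm, ← del_del]
      exact cls_del_subset
    have huv1 : Rel (del W {D i}) u v1 := by
      by_contra hcon
      have h3 := hT ∅ (by simp) i hi u hu v0 hv0 v1 hv1
      simp only [Finset.image_empty, insert_empty_eq, Finset.image_singleton, del_empty] at h3
      have h4 := h3 (hrel _ hu _ hv0) (hrel _ hu _ hv1) huv0 hcon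
      exact hv01 (mem_cls.1 (hMR' (mem_cls.2 h4)))
    rw [← cls_eq huv1] at hN
    have hfN : D j ∉ cls (del W {D j}) v1 := by
      rw [mem_cls]
      exact not_rel_of_mem_deleted hW (Finset.mem_singleton_self _) (fun h => hDZ j hj (h ▸ hv1))
    have hlt : (cls (del W {D j}) v1).card < (cls (del W {D i}) u).card :=
      Finset.card_lt_card ⟨hN, fun h => hfN (h hf)⟩
    have := hmin (j, v1) (Finset.mem_product.2 ⟨hj, hv1⟩)
    simp only at this
    omega

/-- Deleting the element that splits off a leaf component only cuts the related pairs across the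
boundary of that component. -/
lemma rel_insert_leaf_iff (hW : SymmClosed W) (hrel : ∀ u ∈ Z, ∀ v ∈ Z, Rel W u v)
    {i : ι} (hiZ : D i ∉ Z) (hT : NoTriple W D (insert i J) Z)
    {u : E} (hu : u ∈ Z) (hleaf : ∀ j ∈ J, D j ∉ cls (del W {D i}) u)
    {I : Finset ι} (hI : I ⊆ J) {v w : E} (hv : v ∈ Z) (hw : w ∈ Z) :
    Rel (del W ((insert i I).image D)) v w ↔ Rel (del W (I.image D)) v w ∧
      (v ∈ cls (del W {D i}) u ↔ w ∈ cls (del W {D i}) u) := by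
  have e1 : del W ((insert i I).image D) = del (del W (I.image D)) {D i} := by
    rw [del_del, Finset.image_insert, Finset.insert_eq, Finset.union_comm]
  have e2 : del W ((insert i I).image D) = del (del W {D i}) (I.image D) := by
    rw [del_del, Finset.image_insert, Finset.insert_eq]
  have hdM : Disjoint (cls (del W {D i}) u) (I.image D) := by
    rw [Finset.disjoint_right]
    intro x hx
    obtain ⟨j, hj, rfl⟩ := Finset.mem_image.1 hx
    exact hleaf j (hI hj)
  constructor
  · intro h
    refine ⟨(e1 ▸ h).of_del, ?_⟩
    have h' : Rel (del W {D i}) v w := (e2 ▸ h).of_del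
    rw [mem_cls, mem_cls]
    exact ⟨fun a => a.trans h', fun a => a.trans h'.symm⟩
  · rintro ⟨h, hM⟩
    by_cases hvM : v ∈ cls (del W {D i}) u
    · have hwM := hM.1 hvM
      rw [mem_cls] at hvM hwM
      rw [e2]
      refine (hvM.symm.trans hwM).del_of_disjoint (hW.del _) ?_
      rwa [← cls_eq hvM]
    · have hwM : w ∉ cls (del W {D i}) u := fun h => hvM (hM.2 h)
      have hvu : ¬ Rel (del W {D i}) u v := fun h => hvM (mem_cls.2 h)
      have hwu : ¬ Rel (del W {D i}) u w := fun h => hwM (mem_cls.2 h)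
      by_cases hX : Rel (del W (I.image D)) u v
      · refine hT I (hI.trans (Finset.subset_insert _ _)) i (Finset.mem_insert_self _ _) u hu v hv
          w hw hX (hX.trans h) ?_ ?_
        · intro h'; exact hvu (e2 ▸ h').of_del
        · intro h'; exact hwu (e2 ▸ h').of_del
      · rw [e1]
        refine h.del_of_disjoint (hW.del _) ?_
        rw [Finset.disjoint_singleton_right]
        intro he
        rw [mem_cls] at he
        obtain ⟨c, hc, hec, hcN⟩ := exists_mem_of_rel (hW.del _) he (fun h => hiZ (h ▸ hv))
        rw [← cls_eq he] at hcN
        have hMs : cls (del W {D i}) u ⊆ cls (del W (I.image D)) u := by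
          rw [← cls_del_eq (hW.del _) hdM, ← e2, e1]
          exact cls_del_subset
        have hdisj : c ∩ cls (del W {D i}) u = ∅ := by
          rw [← Finset.disjoint_iff_inter_eq_empty]
          exact ((disjoint_cls hX).mono hMs hcN).symm
        have hsep : Sep W (cls (del W {D i}) u) :=
          sep_of_witness hW (sep_cls (hW.del _) u) hc.1 hec (by rw [hdisj]; exact hW.empty_mem)
        exact hvM ((hrel u hu v hv _ hsep).1 (self_mem_cls _ _))

end Leaf

section Energy

variable {ι : Type*} [DecidableEq ι]

open Classical in
/-- The weighted number of ordered related pairs in `Z`. -/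
noncomputable def pairSum (W : Set (Finset E)) (Z : Finset E) (x : E → ℝ) : ℝ :=
  ∑ u ∈ Z, ∑ v ∈ Z, if Rel W u v then x u * x v else 0

/-- The expected value of `pairSum` after deleting `D i` independently with probability `p`. -/
noncomputable def energy (W : Set (Finset E)) (D : ι → E) (p : ℝ) (Z : Finset E) (x : E → ℝ)
    (J : Finset ι) : ℝ :=
  ∑ I ∈ J.powerset, p ^ I.card * (1 - p) ^ (J.card - I.card) * pairSum (del W (I.image D)) Z x

omit [Fintype E] in
lemma energy_insert (W : Set (Finset E)) (D : ι → E) (p : ℝ) (Z : Finset E) (x : E → ℝ)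
    {J : Finset ι} {i : ι} (hi : i ∉ J) :
    energy W D p Z x (insert i J) = ∑ I ∈ J.powerset, p ^ I.card * (1 - p) ^ (J.card - I.card) *
      ((1 - p) * pairSum (del W (I.image D)) Z x
        + p * pairSum (del W ((insert i I).image D)) Z x) := by
  rw [energy, Finset.sum_powerset_insert hi, ← Finset.sum_add_distrib]
  refine Finset.sum_congr rfl fun I hI => ?_
  rw [Finset.mem_powerset] at hI
  have hiI : i ∉ I := fun h => hi (hI h)
  have hc := Finset.card_le_card hI
  rw [Finset.card_insert_of_notMem hi, Finset.card_insert_of_notMem hiI,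
    show J.card + 1 - I.card = (J.card - I.card) + 1 by omega,
    show J.card + 1 - (I.card + 1) = J.card - I.card by omega]
  ring

omit [Fintype E] in
lemma pairSum_del_le (W : Set (Finset E)) (X Z : Finset E) {x : E → ℝ} (hx : ∀ u, 0 ≤ x u) :
    pairSum (del W X) Z x ≤ pairSum W Z x := by
  refine Finset.sum_le_sum fun u _ => Finset.sum_le_sum fun v _ => ?_
  have := mul_nonneg (hx u) (hx v)
  by_cases h : Rel (del W X) u v
  · rw [if_pos h, if_pos h.of_del]
  · rw [if_neg h]; split_ifs <;> simp [this]

/-- A lower bound for the expected number of related pairs after random deletions. -/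
theorem sq_sum_le_energy {D : ι → E} {p : ℝ} (hp0 : 0 < p) (hp1 : p < 1) {Z : Finset E}
    (J : Finset ι) (hW : SymmClosed W) (hrel : ∀ u ∈ Z, ∀ v ∈ Z, Rel W u v)
    (hDZ : ∀ i ∈ J, D i ∉ Z) (hT : NoTriple W D J Z) {x : E → ℝ} (hx : ∀ u, 0 ≤ x u) :
    (∑ u ∈ Z, x u) ^ 2 ≤ (1 + J.card * (p / (2 - p))) * energy W D p Z x J := by
  classical
  induction hk : J.card generalizing J W x with
  | zero =>
    rw [Finset.card_eq_zero] at hk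
    subst hk
    simp only [energy, Finset.powerset_empty, Finset.sum_singleton, Finset.card_empty, pow_zero,
      Nat.sub_zero, mul_one, one_mul, Finset.image_empty, del_empty, Nat.cast_zero, zero_mul,
      add_zero]
    rw [pow_two, Finset.sum_mul_sum, pairSum]
    refine le_of_eq (Finset.sum_congr rfl fun u hu => Finset.sum_congr rfl fun v hv => ?_)
    rw [if_pos (hrel u hu v hv)]
  | succ k ih =>
    have hc : 0 < p / (2 - p) := div_pos hp0 (by linarith)
    have hJ : J.Nonempty := Finset.card_pos.1 (by omega)
    by_cases hcase : ∃ i ∈ J, ∀ u ∈ Z, ∀ v ∈ Z, Rel (del W {D i}) u v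
    · obtain ⟨i, hi, hall⟩ := hcase
      obtain ⟨J, hiJ, rfl⟩ : ∃ J', i ∉ J' ∧ J = insert i J' :=
        ⟨J.erase i, Finset.notMem_erase _ _, (Finset.insert_erase hi).symm⟩
      rw [Finset.card_insert_of_notMem hiJ] at hk
      have h1 := ih J (hW.del _) hall (fun j hj => hDZ j (Finset.mem_insert_of_mem hj)) hT.del hx
        (by omega)
      have h2 : energy (del W {D i}) D p Z x J ≤ energy W D p Z x (insert i J) := by
        rw [energy_insert _ _ _ _ _ hiJ, energy]
        refine Finset.sum_le_sum fun I _ => mul_le_mul_of_nonneg_left ?_ ?_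
        · have e1 : del (del W {D i}) (I.image D) = del W ((insert i I).image D) := by
            rw [del_del, Finset.image_insert, Finset.insert_eq]
          have e2 : del W ((insert i I).image D) = del (del W (I.image D)) {D i} := by
            rw [del_del, Finset.image_insert, Finset.insert_eq, Finset.union_comm]
          have := pairSum_del_le (del W (I.image D)) {D i} Z hx
          rw [← e2] at this
          rw [e1]
          nlinarith
        · exact mul_nonneg (pow_nonneg hp0.le _) (pow_nonneg (by linarith) _)
      have h3 : 0 ≤ energy (del W {D i}) D p Z x J := by
        refine Finset.sum_nonneg fun I _ => mul_nonneg ?_ ?_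
        · exact mul_nonneg (pow_nonneg hp0.le _) (pow_nonneg (by linarith) _)
        · refine Finset.sum_nonneg fun u _ => Finset.sum_nonneg fun v _ => ?_
          split_ifs
          · exact mul_nonneg (hx u) (hx v)
          · exact le_rfl
      have hk' : (0 : ℝ) ≤ k := Nat.cast_nonneg k
      refine h1.trans (mul_le_mul ?_ h2 h3 (by positivity))
      push_cast
      nlinarith
    · push Not at hcase
      obtain ⟨i, hi, u, hu, hleaf⟩ := exists_leaf hW hrel hDZ hT hJ hcase
      obtain ⟨J, hiJ, rfl⟩ : ∃ J', i ∉ J' ∧ J = insert i J' :=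
        ⟨J.erase i, Finset.notMem_erase _ _, (Finset.insert_erase hi).symm⟩
      rw [Finset.card_insert_of_notMem hiJ] at hk
      set M := cls (del W {D i}) u with hM
      set x' : E → ℝ := fun v => if v ∈ M then (1 - p) * x v else x v with hx'
      set y : E → ℝ := fun v => if v ∈ M then x v else 0 with hy
      have hx'0 : ∀ v, 0 ≤ x' v := by
        intro v
        simp only [hx']
        split_ifs
        · exact mul_nonneg (by linarith) (hx v)
        · exact hx v
      have h1 := ih J hW hrel (fun j hj => hDZ j (Finset.mem_insert_of_mem hj))
        (hT.mono (Finset.subset_insert _ _)) hx'0 (by omega)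
      have hleaf' : ∀ j ∈ J, D j ∉ cls (del W {D i}) u :=
        fun j hj => hleaf j (Finset.mem_insert_of_mem hj)
      have hpair : ∀ I ∈ J.powerset, (1 - p) * pairSum (del W (I.image D)) Z x
          + p * pairSum (del W ((insert i I).image D)) Z x
          = pairSum (del W (I.image D)) Z x' + (1 - (1 - p) ^ 2) * (∑ v ∈ Z, y v) ^ 2 := by
        intro I hI
        rw [Finset.mem_powerset] at hI
        rw [pow_two (∑ v ∈ Z, y v), Finset.sum_mul_sum]
        simp only [pairSum, Finset.mul_sum]
        rw [← Finset.sum_add_distrib, ← Finset.sum_add_distrib]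
        refine Finset.sum_congr rfl fun v hv => ?_
        rw [← Finset.sum_add_distrib, ← Finset.sum_add_distrib]
        refine Finset.sum_congr rfl fun w hw => ?_
        have hiff := rel_insert_leaf_iff hW hrel (hDZ i hi) hT hu hleaf' hI hv hw
        rw [← hM] at hiff
        have hboth : v ∈ M → w ∈ M → Rel (del W (I.image D)) v w := by
          intro hvM hwM
          have e2 : del W ((insert i I).image D) = del (del W {D i}) (I.image D) := by
            rw [del_del, Finset.image_insert, Finset.insert_eq]
          have hdM : Disjoint M (I.image D) := by
            rw [Finset.disjoint_right]
            intro a ha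
            obtain ⟨j, hj, rfl⟩ := Finset.mem_image.1 ha
            exact hleaf' j (hI hj)
          rw [hM, mem_cls] at hvM hwM
          have h3 : Rel (del W ((insert i I).image D)) v w := by
            rw [e2]
            refine (hvM.symm.trans hwM).del_of_disjoint (hW.del _) ?_
            rwa [← cls_eq hvM]
          exact (hiff.1 h3).1
        by_cases hR : Rel (del W (I.image D)) v w
        · by_cases hvM : v ∈ M <;> by_cases hwM : w ∈ M <;>
            simp only [hx', hy, hR, hvM, hwM, hiff, if_true, if_false, and_true, and_false,
              true_iff, false_iff, not_true] <;> ring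
        · by_cases hvM : v ∈ M <;> by_cases hwM : w ∈ M
          · exact absurd (hboth hvM hwM) hR
          all_goals simp only [hy, hR, hvM, hwM, hiff, if_false, false_and]; ring
      have h2 : energy W D p Z x (insert i J)
          = energy W D p Z x' J + (1 - (1 - p) ^ 2) * (∑ v ∈ Z, y v) ^ 2 := by
        have h3 : ∑ I ∈ J.powerset, p ^ I.card * (1 - p) ^ (J.card - I.card) = 1 := by
          rw [Finset.sum_pow_mul_eq_add_pow]; simp
        rw [energy_insert _ _ _ _ _ hiJ, energy]
        rw [Finset.sum_congr rfl fun I hI => by rw [hpair I hI]]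
        simp only [mul_add]
        rw [Finset.sum_add_distrib, ← Finset.sum_mul, h3, one_mul]
      have h4 : ∑ v ∈ Z, x v = ∑ v ∈ Z, x' v + p * ∑ v ∈ Z, y v := by
        rw [Finset.mul_sum, ← Finset.sum_add_distrib]
        refine Finset.sum_congr rfl fun v _ => ?_
        simp only [hx', hy]
        split_ifs <;> ring
      rw [h4, h2]
      push_cast
      set a := ∑ v ∈ Z, x' v
      set b := ∑ v ∈ Z, y v
      set F := energy W D p Z x' J
      set A := 1 + (k : ℝ) * (p / (2 - p)) with hA
      have hA0 : 0 < A := by positivity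
      have hAc : 1 + ((k : ℝ) + 1) * (p / (2 - p)) = A + p / (2 - p) := by rw [hA]; ring
      rw [hAc]
      have hcp : p / (2 - p) * (1 - (1 - p) ^ 2) = p ^ 2 := by
        have : (2 - p) ≠ 0 := by linarith
        field_simp; ring
      set c := p / (2 - p)
      have hd : (1 - (1 - p) ^ 2) = p ^ 2 / c := by rw [← hcp]; field_simp
      have h5 : a ^ 2 / A ≤ F := by rw [div_le_iff₀ hA0]; linarith
      calc (a + p * b) ^ 2 ≤ (A + c) * (a ^ 2 / A + (1 - (1 - p) ^ 2) * b ^ 2) := by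
            rw [hd]
            have : (A + c) * (a ^ 2 / A + p ^ 2 / c * b ^ 2) - (a + p * b) ^ 2
                = (c * a - A * (p * b)) ^ 2 / (A * c) := by
              field_simp; ring
            have h6 : 0 ≤ (c * a - A * (p * b)) ^ 2 / (A * c) := by positivity
            linarith
        _ ≤ _ := by gcongr

end Energy

end CycleSpace

namespace CycleSpace

variable {E : Type*} [Fintype E] [DecidableEq E] {W U : Set (Finset E)} {X Z S a d : Finset E}
  {u v e : E}

/-- Every element of `Z` can be hit separately by a member of `W`. -/
def CoIndep (W : Set (Finset E)) (Z : Finset E) : Prop := ∀ z ∈ Z, ∃ w ∈ W, w ∩ Z = {z}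

/-- The circuits of `W`: its minimal nonempty members. -/
def IsCircuit (W : Set (Finset E)) (d : Finset E) : Prop :=
  Minimal (fun s => s ∈ W ∧ s.Nonempty) d

open Classical in
/-- The finset of circuits of `W`. -/
noncomputable def circuits (W : Set (Finset E)) : Finset (Finset E) :=
  Finset.univ.filter (IsCircuit W)

open Classical in
/-- The minimal elements of the coset of `a` modulo `U`. -/
noncomputable def minCoset (U : Set (Finset E)) (a : Finset E) : Finset (Finset E) :=
  Finset.univ.filter (Minimal fun s => s ∆ a ∈ U)

open Classical in
/-- The subsets of `Z` consisting of pairwise unrelated elements. -/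
noncomputable def transversals (W : Set (Finset E)) (Z : Finset E) : Finset (Finset E) :=
  Z.powerset.filter fun A => ∀ u ∈ A, ∀ v ∈ A, Rel W u v → u = v

omit [DecidableEq E] in
lemma mem_circuits : d ∈ circuits W ↔ IsCircuit W d := by simp [circuits]

lemma mem_minCoset {q : Finset E} : q ∈ minCoset U a ↔ Minimal (fun s => s ∆ a ∈ U) q := by
  simp [minCoset]

lemma mem_transversals {A : Finset E} : A ∈ transversals W Z ↔
    A ⊆ Z ∧ ∀ u ∈ A, ∀ v ∈ A, Rel W u v → u = v := by
  simp [transversals]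

omit [Fintype E] in
lemma CoIndep.mono (h : CoIndep W Z) {Z' : Finset E} (hZ : Z' ⊆ Z) : CoIndep W Z' := by
  intro z hz
  obtain ⟨w, hw, hwz⟩ := h z (hZ hz)
  refine ⟨w, hw, ?_⟩
  have h1 : z ∈ w ∩ Z := by rw [hwz]; exact Finset.mem_singleton_self z
  ext x
  rw [Finset.mem_inter, Finset.mem_singleton]
  constructor
  · rintro ⟨hx, hx'⟩
    have : x ∈ w ∩ Z := Finset.mem_inter.2 ⟨hx, hZ hx'⟩
    rwa [hwz, Finset.mem_singleton] at this
  · rintro rfl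
    exact ⟨(Finset.mem_inter.1 h1).1, hz⟩

/-- Passing to a subspace of index two costs at most one element of a coindependent set. -/
lemma CoIndep.exists_subset (hW : SymmClosed W) (h : CoIndep W Z) (K : Set (Finset E))
    (hK : ∀ a ∈ W, ∀ b ∈ W, a ∉ K → b ∉ K → a ∆ b ∈ K) :
    ∃ Z' ⊆ Z, Z.card ≤ Z'.card + 1 ∧ CoIndep {w | w ∈ W ∧ w ∈ K} Z' := by
  choose! f hf hfz using h
  by_cases hall : ∀ z ∈ Z, f z ∈ K
  · exact ⟨Z, subset_rfl, by omega, fun z hz => ⟨f z, ⟨hf z hz, hall z hz⟩, hfz z hz⟩⟩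
  · push Not at hall
    obtain ⟨y, hy, hyK⟩ := hall
    refine ⟨Z.erase y, Finset.erase_subset _ _, by rw [Finset.card_erase_of_mem hy]; omega, ?_⟩
    have hf' : ∀ z ∈ Z, ∀ x ∈ Z, x ∈ f z ↔ x = z := by
      intro z hz x hx
      have := Finset.ext_iff.1 (hfz z hz) x
      simpa [hx] using this
    intro z hz
    obtain ⟨hzy, hz⟩ := Finset.mem_erase.1 hz
    by_cases hzK : f z ∈ K
    · refine ⟨f z, ⟨hf z hz, hzK⟩, ?_⟩
      ext x
      simp only [Finset.mem_inter, Finset.mem_erase, Finset.mem_singleton]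
      grind
    · refine ⟨f z ∆ f y, ⟨hW.symmDiff_mem (hf z hz) (hf y hy), hK _ (hf z hz) _ (hf y hy) hzK hyK⟩,
        ?_⟩
      ext x
      simp only [Finset.mem_inter, Finset.mem_erase, Finset.mem_singleton, Finset.mem_symmDiff]
      grind

/-- Deleting a set costs at most its cardinality in a coindependent set. -/
lemma CoIndep.exists_subset_del (hW : SymmClosed W) (h : CoIndep W Z) (X : Finset E) :
    ∃ Z' ⊆ Z, Z.card ≤ Z'.card + X.card ∧ CoIndep (del W X) Z' := by
  induction X using Finset.induction_on with
  | empty => exact ⟨Z, subset_rfl, by simp, by rwa [del_empty]⟩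
  | insert e X he ih =>
    obtain ⟨Z1, h1, h2, h3⟩ := ih
    obtain ⟨Z2, h4, h5, h6⟩ := h3.exists_subset (hW.del X) {w | e ∉ w} (by
      intro a _ b _ ha hb
      simp only [Set.mem_ofPred_eq, not_not] at ha hb ⊢
      simp [Finset.mem_symmDiff, ha, hb])
    refine ⟨Z2, h4.trans h1, by rw [Finset.card_insert_of_notMem he]; omega, ?_⟩
    convert h6 using 1
    ext w
    simp only [del, Finset.disjoint_insert_right, Set.mem_ofPred_eq]
    tauto

omit [Fintype E] [DecidableEq E] in
lemma exists_isCircuit_subset {w : Finset E} (hw : w ∈ W) (hne : w.Nonempty) :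
    ∃ d ⊆ w, IsCircuit W d := by
  obtain ⟨d, hd, h⟩ := exists_minimal_le_of_wellFoundedLT
    (fun s => s ∈ W ∧ s.Nonempty) w ⟨hw, hne⟩
  exact ⟨d, hd, h⟩

omit [Fintype E] in
/-- Every member of `W` is a sum of circuits. -/
lemma circuit_induction (hW : SymmClosed W) {P : Finset E → Prop} (h0 : P ∅)
    (hc : ∀ d, IsCircuit W d → P d) (hs : ∀ a b, P a → P b → P (a ∆ b)) :
    ∀ w ∈ W, P w := by
  intro w
  induction w using Finset.strongInduction with
  | H w ih =>
    intro hw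
    rcases w.eq_empty_or_nonempty with rfl | hne
    · exact h0
    · obtain ⟨d, hdw, hd⟩ := exists_isCircuit_subset hw hne
      have hlt : w ∆ d ⊂ w := by
        obtain ⟨x, hx⟩ := hd.prop.2
        refine ⟨fun y hy => ?_, fun h => ?_⟩
        · rcases Finset.mem_symmDiff.1 hy with h | h
          · exact h.1
          · exact hdw h.1
        · have := h (hdw hx)
          simp [Finset.mem_symmDiff, hx, hdw hx] at this
      have := hs _ _ (ih _ hlt (hW.symmDiff_mem hw hd.prop.1)) (hc d hd)
      rwa [symmDiff_symmDiff_cancel_right] at this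

omit [Fintype E] in
lemma symmDiff_mem_of_coset (hU : SymmClosed U) {q q' : Finset E} (h : q ∆ a ∈ U)
    (h' : q' ∆ a ∈ U) : q ∆ q' ∈ U := by
  have h1 := hU.symmDiff_mem h h'
  have : (q ∆ a) ∆ (q' ∆ a) = q ∆ q' := by
    ext x; simp only [Finset.mem_symmDiff]; tauto
  rwa [this] at h1

/-- A circuit meeting a minimal coset element is a difference of two minimal coset elements. -/
lemma exists_minCoset_symmDiff (hU : SymmClosed U) (hd : IsCircuit U d) {q : Finset E}
    (hq : q ∈ minCoset U a) (hqd : (q ∩ d).Nonempty) :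
    ∃ q ∈ minCoset U a, ∃ q' ∈ minCoset U a, q ∆ q' = d := by
  classical
  obtain ⟨q, hq, hmin⟩ := Finset.exists_min_image
    ((minCoset U a).filter fun q => (q ∩ d).Nonempty) (fun q => (q \ d).card)
    ⟨q, Finset.mem_filter.2 ⟨hq, hqd⟩⟩
  obtain ⟨hq, hqd⟩ := Finset.mem_filter.1 hq
  have hqm := mem_minCoset.1 hq
  have h1 : (q ∆ d) ∆ a ∈ U := by
    have := hU.symmDiff_mem hqm.prop hd.prop.1
    rwa [symmDiff_right_comm] at this
  obtain ⟨q', hq'le, hq'm⟩ := exists_minimal_le_of_wellFoundedLT (fun s => s ∆ a ∈ U) (q ∆ d) h1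
  have hq' := mem_minCoset.2 hq'm
  have hsub : ∀ x ∈ q', x ∈ q ∧ x ∉ d ∨ x ∈ d ∧ x ∉ q :=
    fun x hx => Finset.mem_symmDiff.1 (hq'le hx)
  have hne : (q' ∩ d).Nonempty := by
    by_contra hcon
    rw [Finset.not_nonempty_iff_eq_empty] at hcon
    have hnd : ∀ x ∈ q', x ∉ d := fun x hx hxd => by
      have : x ∈ q' ∩ d := Finset.mem_inter.2 ⟨hx, hxd⟩
      simp [hcon] at this
    have hle : q' ≤ q := fun x hx => by
      rcases hsub x hx with h | h
      · exact h.1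
      · exact absurd h.1 (hnd x hx)
    have hge : q ≤ q' := hqm.le_of_le hq'm.prop hle
    obtain ⟨x, hx⟩ := hqd
    rw [Finset.mem_inter] at hx
    exact hnd x (hge hx.1) hx.2
  have hsd : q' \ d ⊆ q \ d := by
    intro x hx
    rw [Finset.mem_sdiff] at hx ⊢
    rcases hsub x hx.1 with h | h
    · exact h
    · exact absurd h.1 hx.2
  have heq : q' \ d = q \ d :=
    Finset.eq_of_subset_of_card_le hsd (hmin q' (Finset.mem_filter.2 ⟨hq', hne⟩))
  refine ⟨q, hq, q', hq', ?_⟩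
  have hle : q ∆ q' ≤ d := by
    intro x hx
    by_contra hxd
    have := Finset.ext_iff.1 heq x
    rw [Finset.mem_symmDiff] at hx
    simp only [Finset.mem_sdiff] at this
    tauto
  have hne' : (q ∆ q').Nonempty := by
    obtain ⟨x, hx⟩ := hne
    rw [Finset.mem_inter] at hx
    refine ⟨x, Finset.mem_symmDiff.2 (Or.inr ⟨hx.1, ?_⟩)⟩
    rcases hsub x hx.1 with h | h
    · exact absurd hx.2 h.2
    · exact h.2
  exact le_antisymm hle (hd.le_of_le ⟨symmDiff_mem_of_coset hU hqm.prop hq'm.prop, hne'⟩ hle)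

lemma minCoset_nonempty (hU : SymmClosed U) (a : Finset E) : (minCoset U a).Nonempty := by
  obtain ⟨q, -, hq⟩ := exists_minimal_le_of_wellFoundedLT (fun s => s ∆ a ∈ U) a
    (by rw [symmDiff_self]; exact hU.empty_mem)
  exact ⟨q, mem_minCoset.2 hq⟩

lemma sep_biUnion_minCoset (hU : SymmClosed U) (a : Finset E) :
    Sep U ((minCoset U a).biUnion id) := by
  set S := (minCoset U a).biUnion id with hS
  have key : ∀ w ∈ U, w ∩ S ∈ U := by
    refine circuit_induction hU (P := fun w => w ∩ S ∈ U) ?_ ?_ ?_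
    · simpa using hU.empty_mem
    · intro d hd
      by_cases h : ∃ q ∈ minCoset U a, (q ∩ d).Nonempty
      · obtain ⟨q, hq, hqd⟩ := h
        obtain ⟨q, hq, q', hq', rfl⟩ := exists_minCoset_symmDiff hU hd hq hqd
        have : q ∆ q' ∩ S = q ∆ q' := by
          rw [Finset.inter_eq_left]
          intro x hx
          rw [hS, Finset.mem_biUnion]
          rcases Finset.mem_symmDiff.1 hx with h | h
          · exact ⟨q, hq, h.1⟩
          · exact ⟨q', hq', h.1⟩
        rw [this]
        exact hd.prop.1
      · push Not at h
        have : d ∩ S = ∅ := by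
          rw [← Finset.disjoint_iff_inter_eq_empty, Finset.disjoint_right]
          intro x hx hxd
          obtain ⟨q, hq, hxq⟩ := Finset.mem_biUnion.1 hx
          have h2 : x ∈ q ∩ d := Finset.mem_inter.2 ⟨hxq, hxd⟩
          rw [h q hq] at h2
          simp at h2
        rw [this]
        exact hU.empty_mem
    · intro a b ha hb
      have : (a ∆ b) ∩ S = (a ∩ S) ∆ (b ∩ S) := by
        ext x; simp only [Finset.mem_inter, Finset.mem_symmDiff]; tauto
      rw [this]
      exact hU.symmDiff_mem ha hb
  exact key

/-- The minimal coset elements outnumber a coindependent set all of whose elements matter for the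
coset. -/
lemma card_add_one_le_card_minCoset (hU : SymmClosed U) (hZ : CoIndep U Z)
    (h : ∀ S, Sep U S → a ∩ S ∈ U → Disjoint S Z) : Z.card + 1 ≤ (minCoset U a).card := by
  classical
  set S := (minCoset U a).biUnion id with hS
  have hsep : Sep U S := sep_biUnion_minCoset hU a
  obtain ⟨q0, hq0⟩ := minCoset_nonempty hU a
  have hZS : Z ⊆ S := by
    have h1 : a ∩ Sᶜ ∈ U := by
      have h2 := hsep.compl hU _ (mem_minCoset.1 hq0).prop
      have : q0 ∆ a ∩ Sᶜ = a ∩ Sᶜ := by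
        have hqs : q0 ⊆ S := Finset.subset_biUnion_of_mem id hq0
        ext x
        have := @hqs x
        simp only [Finset.mem_inter, Finset.mem_symmDiff, Finset.mem_compl]
        tauto
      rwa [this] at h2
    have h3 := h _ (hsep.compl hU) h1
    intro z hz
    by_contra hzS
    exact Finset.disjoint_left.1 h3 (Finset.mem_compl.2 hzS) hz
  let f : Option Z → (minCoset U a → ZMod 2) := fun o q =>
    o.elim 1 fun z => if z.1 ∈ q.1 then 1 else 0
  have hlin : LinearIndependent (ZMod 2) f := by
    rw [Fintype.linearIndependent_iff]
    intro g hg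
    let φ : Finset E → ZMod 2 := fun w => ∑ z : Z, if z.1 ∈ w then g (some z) else 0
    have hφadd : ∀ a b, φ (a ∆ b) = φ a + φ b := by
      intro a b
      simp only [φ]
      rw [← Finset.sum_add_distrib]
      refine Finset.sum_congr rfl fun z _ => ?_
      have := CharTwo.add_self_eq_zero (g (some z))
      by_cases h1 : z.1 ∈ a <;> by_cases h2 : z.1 ∈ b <;>
        simp [Finset.mem_symmDiff, h1, h2, this]
    have hφq : ∀ q ∈ minCoset U a, g none + φ q = 0 := by
      intro q hq
      have := congrFun hg ⟨q, hq⟩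
      rw [Fintype.sum_option] at this
      simpa [f, φ, Finset.sum_apply] using this
    have hφU : ∀ w ∈ U, φ w = 0 := by
      refine circuit_induction hU (P := fun w => φ w = 0) (by simp [φ]) ?_ ?_
      · intro d hd
        by_cases h : ∃ q ∈ minCoset U a, (q ∩ d).Nonempty
        · obtain ⟨q, hq, hqd⟩ := h
          obtain ⟨q, hq, q', hq', rfl⟩ := exists_minCoset_symmDiff hU hd hq hqd
          rw [hφadd]
          have h1 := hφq q hq
          have h2 := hφq q' hq'
          have h3 := CharTwo.add_self_eq_zero (g none)
          linear_combination h1 + h2 - h3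
        · push Not at h
          refine Finset.sum_eq_zero fun z _ => if_neg fun hzd => ?_
          obtain ⟨q, hq, hxq⟩ := Finset.mem_biUnion.1 (hZS z.2)
          have h2 : z.1 ∈ q ∩ d := Finset.mem_inter.2 ⟨hxq, hzd⟩
          rw [h q hq] at h2
          simp at h2
      · intro a b ha hb
        rw [hφadd, ha, hb, add_zero]
    have hgz : ∀ z : Z, g (some z) = 0 := by
      intro z
      obtain ⟨w, hw, hwz⟩ := hZ z.1 z.2
      have h1 := hφU w hw
      have h2 : φ w = g (some z) := by
        simp only [φ]
        rw [Finset.sum_eq_single z]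
        · have : z.1 ∈ w ∩ Z := by rw [hwz]; exact Finset.mem_singleton_self _
          rw [if_pos (Finset.mem_inter.1 this).1]
        · intro y _ hyz
          refine if_neg fun hyw => hyz ?_
          have : y.1 ∈ w ∩ Z := Finset.mem_inter.2 ⟨hyw, y.2⟩
          rw [hwz, Finset.mem_singleton] at this
          exact Subtype.ext this
        · simp
      rw [← h2, h1]
    have hnone : g none = 0 := by
      have h1 := hφq q0 hq0
      have h2 : φ q0 = 0 := Finset.sum_eq_zero fun z _ => by rw [hgz]; simp
      rwa [h2, add_zero] at h1
    rintro (_ | z)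
    · exact hnone
    · exact hgz z
  have := hlin.fintype_card_le_finrank
  simpa using this

lemma CoIndep.del_compl_inter (hS : Sep U S) (hZ : CoIndep U Z) :
    CoIndep (del U Sᶜ) (Z ∩ S) := by
  intro z hz
  rw [Finset.mem_inter] at hz
  obtain ⟨w, hw, hwz⟩ := hZ z hz.1
  refine ⟨w ∩ S, ⟨hS w hw, ?_⟩, ?_⟩
  · rw [Finset.disjoint_left]; simp
  · ext x
    have := Finset.ext_iff.1 hwz x
    simp only [Finset.mem_inter, Finset.mem_singleton] at this ⊢
    constructor
    · intro hx; exact this.1 ⟨hx.1.1, hx.2.1⟩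
    · rintro rfl; have := this.2 rfl; tauto

lemma disjoint_of_del_compl (hS : Sep U S) (h : ∀ S, Sep U S → a ∩ S ∈ U → Disjoint S Z)
    (T : Finset E) (hT : Sep (del U Sᶜ) T) (haT : (a ∩ S) ∩ T ∈ del U Sᶜ) :
    Disjoint T (Z ∩ S) := by
  have h1 : Sep U (S ∩ T) := by
    intro w hw
    have := hT (w ∩ S) ⟨hS w hw, by rw [Finset.disjoint_left]; simp⟩
    rw [Finset.inter_assoc] at this
    exact this.1
  have h2 := h (S ∩ T) h1 (by rw [← Finset.inter_assoc]; exact haT.1)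
  rw [Finset.disjoint_left] at h2 ⊢
  intro x hx hx'
  rw [Finset.mem_inter] at hx'
  exact h2 (Finset.mem_inter.2 ⟨hx'.2, hx⟩) hx'.1

lemma card_minCoset_mul_le (hU : SymmClosed U) (hS : Sep U S) (a : Finset E) :
    (minCoset (del U Sᶜ) (a ∩ S)).card * (minCoset (del U S) (a ∩ Sᶜ)).card
      ≤ (minCoset U a).card := by
  rw [← Finset.card_product]
  have hsub1 : ∀ q : Finset E, q ∆ (a ∩ S) ∈ del U Sᶜ → q ⊆ S := by
    intro q hq x hx
    by_contra hxS
    have hxq : x ∈ q ∆ (a ∩ S) := by simp [Finset.mem_symmDiff, hx, hxS]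
    exact Finset.disjoint_left.1 hq.2 hxq (by simpa)
  have hsub2 : ∀ q : Finset E, q ∆ (a ∩ Sᶜ) ∈ del U S → q ⊆ Sᶜ := by
    intro q hq x hx
    by_contra hxS
    rw [Finset.mem_compl, not_not] at hxS
    have hxq : x ∈ q ∆ (a ∩ Sᶜ) := by simp [Finset.mem_symmDiff, hx, hxS]
    exact Finset.disjoint_left.1 hq.2 hxq (by simpa)
  refine Finset.card_le_card_of_injOn (fun q => q.1 ∪ q.2) ?_ ?_
  · rintro ⟨q1, q2⟩ hq
    obtain ⟨hq1, hq2⟩ := Finset.mem_product.1 hq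
    rw [mem_minCoset] at hq1 hq2
    have s1 := hsub1 _ hq1.prop
    have s2 := hsub2 _ hq2.prop
    rw [Finset.mem_coe, mem_minCoset]
    refine ⟨?_, ?_⟩
    · have := hU.symmDiff_mem hq1.prop.1 hq2.prop.1
      have e : (q1 ∆ (a ∩ S)) ∆ (q2 ∆ (a ∩ Sᶜ)) = (q1 ∪ q2) ∆ a := by
        ext x
        have h1 := @s1 x
        have h2 := @s2 x
        simp only [Finset.mem_inter, Finset.mem_symmDiff, Finset.mem_compl, Finset.mem_union]
          at h1 h2 ⊢
        tauto
      rwa [e] at this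
    · intro r hr hle
      simp only at hr hle
      have r1 : (r ∩ S) ∆ (a ∩ S) ∈ del U Sᶜ := by
        refine ⟨?_, ?_⟩
        · have := hS _ hr
          have e : r ∆ a ∩ S = (r ∩ S) ∆ (a ∩ S) := by
            ext x; simp only [Finset.mem_inter, Finset.mem_symmDiff]; tauto
          rwa [e] at this
        · rw [Finset.disjoint_left]
          intro x hx
          simp only [Finset.mem_inter, Finset.mem_symmDiff, Finset.mem_compl] at hx ⊢
          tauto
      have r2 : (r ∩ Sᶜ) ∆ (a ∩ Sᶜ) ∈ del U S := by
        refine ⟨?_, ?_⟩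
        · have := hS.compl hU _ hr
          have e : r ∆ a ∩ Sᶜ = (r ∩ Sᶜ) ∆ (a ∩ Sᶜ) := by
            ext x; simp only [Finset.mem_inter, Finset.mem_symmDiff]; tauto
          rwa [e] at this
        · rw [Finset.disjoint_left]
          intro x hx
          simp only [Finset.mem_inter, Finset.mem_symmDiff, Finset.mem_compl] at hx ⊢
          tauto
      have l1 : r ∩ S ≤ q1 := by
        intro x hx
        rw [Finset.mem_inter] at hx
        rcases Finset.mem_union.1 (hle hx.1) with h | h
        · exact h
        · exact absurd hx.2 (Finset.mem_compl.1 (s2 h))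
      have l2 : r ∩ Sᶜ ≤ q2 := by
        intro x hx
        rw [Finset.mem_inter] at hx
        rcases Finset.mem_union.1 (hle hx.1) with h | h
        · exact absurd (s1 h) (Finset.mem_compl.1 hx.2)
        · exact h
      exact Finset.union_subset ((hq1.le_of_le r1 l1).trans Finset.inter_subset_left)
        ((hq2.le_of_le r2 l2).trans Finset.inter_subset_left)
  · rintro ⟨q1, q2⟩ hq ⟨p1, p2⟩ hp heq
    obtain ⟨hq1, hq2⟩ := Finset.mem_product.1 hq
    obtain ⟨hp1, hp2⟩ := Finset.mem_product.1 hp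
    rw [mem_minCoset] at hq1 hq2 hp1 hp2
    have s1 := hsub1 _ hq1.prop
    have s2 := hsub2 _ hq2.prop
    have t1 := hsub1 _ hp1.prop
    have t2 := hsub2 _ hp2.prop
    simp only at heq s1 s2 t1 t2
    rw [Prod.mk.injEq]
    constructor <;>
    · ext x
      have h0 := Finset.ext_iff.1 heq x
      have h1 := @s1 x
      have h2 := @s2 x
      have h3 := @t1 x
      have h4 := @t2 x
      simp only [Finset.mem_compl, Finset.mem_union] at h0 h1 h2 h3 h4
      grind

lemma card_transversals_le_mul (U : Set (Finset E)) (S Z : Finset E) :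
    (transversals U Z).card ≤
      (transversals (del U Sᶜ) (Z ∩ S)).card * (transversals (del U S) (Z ∩ Sᶜ)).card := by
  rw [← Finset.card_product]
  refine Finset.card_le_card_of_injOn (fun A => (A ∩ S, A ∩ Sᶜ)) ?_ ?_
  · intro A hA
    rw [Finset.mem_coe, mem_transversals] at hA
    rw [Finset.mem_coe, Finset.mem_product, mem_transversals, mem_transversals]
    refine ⟨⟨Finset.inter_subset_inter_right hA.1, ?_⟩,
      ⟨Finset.inter_subset_inter_right hA.1, ?_⟩⟩ <;>
    · intro u hu v hv h
      exact hA.2 u (Finset.mem_inter.1 hu).1 v (Finset.mem_inter.1 hv).1 h.of_del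
  · intro A _ B _ h
    simp only [Prod.mk.injEq] at h
    ext x
    have h1 := Finset.ext_iff.1 h.1 x
    have h2 := Finset.ext_iff.1 h.2 x
    simp only [Finset.mem_inter, Finset.mem_compl] at h1 h2
    tauto

lemma card_transversals_le_card_minCoset (hU : SymmClosed U) (hZ : CoIndep U Z)
    (h : ∀ S, Sep U S → a ∩ S ∈ U → Disjoint S Z) :
    (transversals U Z).card ≤ (minCoset U a).card := by
  induction hk : Z.card using Nat.strong_induction_on generalizing U Z a with
  | _ k ih =>
    by_cases hall : ∀ u ∈ Z, ∀ v ∈ Z, Rel U u v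
    · refine le_trans ?_ (card_add_one_le_card_minCoset hU hZ h)
      have hsub : transversals U Z ⊆ insert ∅ (Z.image fun z => {z}) := by
        intro A hA
        rw [mem_transversals] at hA
        rcases A.eq_empty_or_nonempty with rfl | ⟨u, hu⟩
        · exact Finset.mem_insert_self _ _
        · refine Finset.mem_insert_of_mem (Finset.mem_image.2 ⟨u, hA.1 hu, ?_⟩)
          ext x
          rw [Finset.mem_singleton]
          constructor
          · rintro rfl; exact hu
          · intro hx; exact hA.2 x hx u hu (hall x (hA.1 hx) u (hA.1 hu))
      refine (Finset.card_le_card hsub).trans ((Finset.card_insert_le _ _).trans ?_)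
      exact Nat.succ_le_succ Finset.card_image_le
    · push Not at hall
      obtain ⟨u, hu, v, hv, huv⟩ := hall
      unfold Rel at huv
      push Not at huv
      obtain ⟨S, hS, huv⟩ := huv
      have hSc := hS.compl hU
      have lt1 : (Z ∩ S).card < k := by
        rw [← hk]
        refine Finset.card_lt_card ⟨Finset.inter_subset_left, fun hcon => ?_⟩
        have h1 := Finset.mem_inter.1 (hcon hu)
        have h2 := Finset.mem_inter.1 (hcon hv)
        tauto
      have lt2 : (Z ∩ Sᶜ).card < k := by
        rw [← hk]
        refine Finset.card_lt_card ⟨Finset.inter_subset_left, fun hcon => ?_⟩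
        have h1 := Finset.mem_inter.1 (hcon hu)
        have h2 := Finset.mem_inter.1 (hcon hv)
        rw [Finset.mem_compl] at h1 h2
        tauto
      have i1 := ih _ lt1 (hU.del Sᶜ) (hZ.del_compl_inter hS)
        (fun T hT haT => disjoint_of_del_compl hS h T hT haT) rfl
      have c2 := hZ.del_compl_inter hSc
      have d2 := fun T hT haT => disjoint_of_del_compl hSc h T hT haT
      rw [compl_compl] at c2 d2
      have i2 := ih _ lt2 (hU.del S) c2 d2 rfl
      exact (card_transversals_le_mul U S Z).trans
        ((Nat.mul_le_mul i1 i2).trans (card_minCoset_mul_le hU hS a))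

/-- The number of circuits through `e` is at least the number of transversals of the components
into which the component of `e` falls apart after deleting `e`. -/
lemma card_transversals_le_card_circuits (hW : SymmClosed W) {c : Finset E} (hc : c ∈ W)
    (hec : e ∈ c) (hZe : Z ⊆ cls W e) (hZ : CoIndep (del W {e}) Z) :
    (transversals (del W {e}) Z).card ≤ ((circuits W).filter fun d => e ∈ d).card := by
  have h1 : (transversals (del W {e}) Z).card ≤ (minCoset (del W {e}) c).card := by
    refine card_transversals_le_card_minCoset (hW.del _) hZ fun S hS hcS => ?_
    have hsep := sep_of_witness hW hS hc hec hcS.1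
    have heS : e ∉ S := fun h =>
      Finset.disjoint_left.1 hcS.2 (Finset.mem_inter.2 ⟨hec, h⟩) (Finset.mem_singleton_self e)
    rw [Finset.disjoint_left]
    intro x hx hxZ
    exact heS ((mem_cls.1 (hZe hxZ) S hsep).2 hx)
  refine h1.trans (Finset.card_le_card fun q hq => ?_)
  rw [mem_minCoset] at hq
  have hmem : ∀ s : Finset E, s ∆ c ∈ del W {e} ↔ s ∈ W ∧ e ∈ s := by
    intro s
    constructor
    · rintro ⟨h1, h2⟩
      refine ⟨?_, ?_⟩
      · have := hW.symmDiff_mem h1 hc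
        rwa [symmDiff_symmDiff_cancel_right] at this
      · rw [Finset.disjoint_singleton_right, Finset.mem_symmDiff] at h2
        tauto
    · rintro ⟨h1, h2⟩
      exact ⟨hW.symmDiff_mem h1 hc, by simp [Finset.mem_symmDiff, h2, hec]⟩
  have hq1 := (hmem q).1 hq.prop
  refine Finset.mem_filter.2 ⟨mem_circuits.2 ⟨⟨hq1.1, ⟨e, hq1.2⟩⟩, ?_⟩, hq1.2⟩
  rintro s ⟨hs, y, hy⟩ hle
  by_cases hes : e ∈ s
  · exact hq.le_of_le ((hmem s).2 ⟨hs, hes⟩) hle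
  · have h2 : (q ∆ s) ∆ c ∈ del W {e} :=
      (hmem _).2 ⟨hW.symmDiff_mem hq1.1 hs, by simp [Finset.mem_symmDiff, hq1.2, hes]⟩
    have h3 : q ∆ s ≤ q := by
      intro x hx
      rcases Finset.mem_symmDiff.1 hx with h | h
      · exact h.1
      · exact hle h.1
    have h4 := hq.le_of_le h2 h3 (hle hy)
    simp [Finset.mem_symmDiff, hy, hle hy] at h4

end CycleSpace

namespace CycleSpace

variable {E : Type*} [Fintype E] [DecidableEq E] {W U : Set (Finset E)} {X Z S a d : Finset E}
  {u v e : E}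

open Classical in
/-- The ordered pairs of related elements of `Z`. -/
noncomputable def relPairs (W : Set (Finset E)) (Z : Finset E) : Finset (E × E) :=
  (Z ×ˢ Z).filter fun x => Rel W x.1 x.2

open Classical in
/-- The ordered pairs of unrelated elements of `Z`. -/
noncomputable def unrelPairs (W : Set (Finset E)) (Z : Finset E) : Finset (E × E) :=
  (Z ×ˢ Z).filter fun x => ¬ Rel W x.1 x.2

lemma circuits_del_subset (W : Set (Finset E)) (X : Finset E) :
    circuits (del W X) ⊆ (circuits W).filter fun d => Disjoint d X := by
  intro d hd
  rw [mem_circuits] at hd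
  refine Finset.mem_filter.2 ⟨mem_circuits.2 ⟨⟨hd.prop.1.1, hd.prop.2⟩, ?_⟩, hd.prop.1.2⟩
  rintro s ⟨hs, hne⟩ hle
  exact hd.le_of_le ⟨⟨hs, hd.prop.1.2.mono_left hle⟩, hne⟩ hle

lemma two_add_card_unrelPairs_le (U : Set (Finset E)) (Z : Finset E) :
    2 + 2 * Z.card + (unrelPairs U Z).card ≤ 2 * (transversals U Z).card := by
  classical
  set T2 := (transversals U Z).filter fun A => A.card = 2 with hT2
  have h2 : (unrelPairs U Z).card ≤ 2 * T2.card := by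
    refine Finset.card_le_mul_card_image_of_maps_to (f := fun x => {x.1, x.2}) ?_ 2 ?_
    · rintro ⟨x, y⟩ hxy
      simp only [unrelPairs, Finset.mem_filter, Finset.mem_product] at hxy
      have hne : x ≠ y := fun h => hxy.2 (h ▸ Rel.refl _ _)
      refine Finset.mem_filter.2 ⟨mem_transversals.2 ⟨?_, ?_⟩, Finset.card_pair hne⟩
      · intro z hz
        simp only [Finset.mem_insert, Finset.mem_singleton] at hz
        rcases hz with rfl | rfl
        · exact hxy.1.1
        · exact hxy.1.2
      · intro u hu v hv huv
        simp only [Finset.mem_insert, Finset.mem_singleton] at hu hv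
        rcases hu with rfl | rfl <;> rcases hv with rfl | rfl
        · rfl
        · exact absurd huv hxy.2
        · exact absurd huv.symm hxy.2
        · rfl
    · intro A hA
      obtain ⟨x, y, hxy, rfl⟩ := Finset.card_eq_two.1 (Finset.mem_filter.1 hA).2
      refine (Finset.card_le_card (t := {(x, y), (y, x)}) ?_).trans Finset.card_le_two
      rintro ⟨s, t⟩ hst
      obtain ⟨h1, h2⟩ := Finset.mem_filter.1 hst
      have hne : s ≠ t := by
        rintro rfl
        exact (Finset.mem_filter.1 h1).2 (Rel.refl _ _)
      simp only [Finset.mem_insert, Finset.mem_singleton, Prod.mk.injEq]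
      simp only [Finset.ext_iff, Finset.mem_insert, Finset.mem_singleton] at h2
      have := h2 s
      have := h2 t
      grind
  set T1 : Finset (Finset E) := Z.image fun z => {z} with hT1
  have c1 : T1.card = Z.card :=
    Finset.card_image_of_injective _ Finset.singleton_injective
  have d1 : Disjoint T1 T2 := by
    rw [Finset.disjoint_left]
    intro A hA hA'
    obtain ⟨z, -, rfl⟩ := Finset.mem_image.1 hA
    have := (Finset.mem_filter.1 hA').2
    simp at this
  have d0 : ∅ ∉ T1 ∪ T2 := by
    intro h
    rcases Finset.mem_union.1 h with h | h
    · obtain ⟨z, -, hz⟩ := Finset.mem_image.1 h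
      exact Finset.singleton_ne_empty z hz
    · have := (Finset.mem_filter.1 h).2
      simp at this
  have hsub : insert ∅ (T1 ∪ T2) ⊆ transversals U Z := by
    intro A hA
    rcases Finset.mem_insert.1 hA with rfl | hA
    · rw [mem_transversals]; simp
    rcases Finset.mem_union.1 hA with hA | hA
    · obtain ⟨z, hz, rfl⟩ := Finset.mem_image.1 hA
      rw [mem_transversals]
      simp [hz]
    · exact (Finset.mem_filter.1 hA).1
  have := Finset.card_le_card hsub
  rw [Finset.card_insert_of_notMem d0, Finset.card_union_of_disjoint d1, c1] at this
  omega

/-- The number of circuits is at least half the number of related pairs in a coindependent set. -/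
theorem card_relPairs_le (hW : SymmClosed W) (hZ : CoIndep W Z) :
    (relPairs W Z).card ≤ 2 * (circuits W).card := by
  classical
  induction Z using Finset.induction_on generalizing W with
  | empty => simp [relPairs]
  | insert e Z he ih =>
    obtain ⟨c, hc, hcz⟩ := hZ e (Finset.mem_insert_self _ _)
    have hec : e ∈ c := by
      have : e ∈ c ∩ insert e Z := by rw [hcz]; exact Finset.mem_singleton_self e
      exact (Finset.mem_inter.1 this).1
    have hZ' : CoIndep (del W {e}) Z := by
      intro z hz
      have hze : z ≠ e := fun h => he (h ▸ hz)
      obtain ⟨w, hw, hwz⟩ := hZ z (Finset.mem_insert_of_mem hz)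
      have hwz' : ∀ x, x ∈ w ∩ insert e Z ↔ x = z := by
        intro x; rw [hwz, Finset.mem_singleton]
      simp only [Finset.mem_inter, Finset.mem_insert] at hwz'
      refine ⟨w, ⟨hw, ?_⟩, ?_⟩
      · rw [Finset.disjoint_singleton_right]
        intro hew
        exact hze ((hwz' e).1 ⟨hew, Or.inl rfl⟩).symm
      · ext x
        have := hwz' x
        rw [Finset.mem_inter, Finset.mem_singleton]
        constructor
        · intro h; exact this.1 ⟨h.1, Or.inr h.2⟩
        · rintro rfl; exact ⟨(this.2 rfl).1, hz⟩
    have h1 := ih (hW.del {e}) hZ'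
    set Z0 := Z ∩ cls W e with hZ0
    have h2 := card_transversals_le_card_circuits hW hc hec
      (Finset.inter_subset_right : Z0 ⊆ cls W e) (hZ'.mono Finset.inter_subset_left)
    rw [← hZ0] at h2
    have h3 := two_add_card_unrelPairs_le (del W {e}) Z0
    have h4 : (circuits (del W {e})).card + ((circuits W).filter fun d => e ∈ d).card
        ≤ (circuits W).card := by
      rw [← Finset.card_union_of_disjoint]
      · refine Finset.card_le_card (Finset.union_subset ?_ (Finset.filter_subset _ _))
        exact (circuits_del_subset W {e}).trans (Finset.filter_subset _ _)
      · rw [Finset.disjoint_left]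
        intro d hd hd'
        have h5 := (Finset.mem_filter.1 (circuits_del_subset W {e} hd)).2
        exact (Finset.disjoint_singleton_right.1 h5) (Finset.mem_filter.1 hd').2
    have h5 : relPairs W (insert e Z) ⊆ relPairs (del W {e}) Z ∪ unrelPairs (del W {e}) Z0 ∪
        insert (e, e) ((Z0.image fun z => (e, z)) ∪ Z0.image fun z => (z, e)) := by
      rintro ⟨x, y⟩ hxy
      simp only [relPairs, Finset.mem_filter, Finset.mem_product, Finset.mem_insert] at hxy
      obtain ⟨⟨hx, hy⟩, hR⟩ := hxy
      simp only [Finset.mem_union, Finset.mem_insert, Finset.mem_image, Prod.mk.injEq]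
      rcases hx with rfl | hx <;> rcases hy with rfl | hy
      · right; left; exact ⟨rfl, rfl⟩
      · right; right; left
        exact ⟨y, Finset.mem_inter.2 ⟨hy, mem_cls.2 hR⟩, rfl, rfl⟩
      · right; right; right
        exact ⟨x, Finset.mem_inter.2 ⟨hx, mem_cls.2 hR.symm⟩, rfl, rfl⟩
      · left
        by_cases hd : Rel (del W {e}) x y
        · left; simp [relPairs, hx, hy, hd]
        · right
          have hex : e ∈ cls W x := by
            by_contra hcon
            exact hd (hR.del_of_disjoint hW (Finset.disjoint_singleton_right.2 hcon))
          rw [mem_cls] at hex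
          simp only [unrelPairs, Finset.mem_filter, Finset.mem_product]
          exact ⟨⟨Finset.mem_inter.2 ⟨hx, mem_cls.2 hex.symm⟩,
            Finset.mem_inter.2 ⟨hy, mem_cls.2 (hex.symm.trans hR)⟩⟩, hd⟩
    have h6 := Finset.card_le_card h5
    have h7 := Finset.card_union_le (relPairs (del W {e}) Z ∪ unrelPairs (del W {e}) Z0)
      (insert (e, e) ((Z0.image fun z => (e, z)) ∪ Z0.image fun z => (z, e)))
    have h8 := Finset.card_union_le (relPairs (del W {e}) Z) (unrelPairs (del W {e}) Z0)
    have h9 := Finset.card_insert_le (e, e)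
      ((Z0.image fun z => (e, z)) ∪ Z0.image fun z => (z, e))
    have h10 := Finset.card_union_le (Z0.image fun z => (e, z)) (Z0.image fun z => (z, e))
    have h11 : (Z0.image fun z => (e, z)).card ≤ Z0.card := Finset.card_image_le
    have h12 : (Z0.image fun z => (z, e)).card ≤ Z0.card := Finset.card_image_le
    omega

/-- Removing few elements destroys all pairwise unrelated triples. -/
lemma exists_subset_no_triple (U : Set (Finset E)) (Z : Finset E) :
    ∃ Y ⊆ Z, Y.card ^ 3 ≤ 27 * (transversals U Z).card ∧
      ∀ u ∈ Z \ Y, ∀ v ∈ Z \ Y, ∀ w ∈ Z \ Y, ¬ Rel U u v → ¬ Rel U u w → Rel U v w := by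
  classical
  rcases Z.eq_empty_or_nonempty with rfl | hne
  · exact ⟨∅, subset_rfl, by simp, by simp⟩
  let C : E → Finset E := fun x => Z.filter (Rel U x)
  obtain ⟨a, ha, hamax⟩ := Finset.exists_max_image Z (fun x => (C x).card) hne
  rcases (Z \ C a).eq_empty_or_nonempty with hempty | hne'
  · refine ⟨∅, by simp, by simp, ?_⟩
    intro u hu v hv w hw huv
    have hall : ∀ x ∈ Z, Rel U a x := by
      intro x hx
      by_contra hcon
      have : x ∈ Z \ C a := by simp [C, hx, hcon]
      rw [hempty] at this
      simp at this
    simp only [Finset.sdiff_empty] at hu hv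
    exact absurd ((hall u hu).symm.trans (hall v hv)) huv
  obtain ⟨b, hb, hbmax⟩ := Finset.exists_max_image (Z \ C a) (fun x => (C x).card) hne'
  set Y := (Z \ C a) \ C b with hY
  have hYZ : Y ⊆ Z := Finset.sdiff_subset.trans Finset.sdiff_subset
  have hCZ : ∀ x, C x ⊆ Z := fun x => Finset.filter_subset _ _
  have hcard : Y.card + (C a).card + (C b).card ≤ Z.card := by
    have hd1 : (C b) ⊆ Z \ C a := by
      intro x hx
      refine Finset.mem_sdiff.2 ⟨hCZ b hx, fun hxa => ?_⟩
      have h5 := (Finset.mem_filter.1 hx).2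
      have h6 := (Finset.mem_filter.1 hxa).2
      refine (Finset.mem_sdiff.1 hb).2 (Finset.mem_filter.2 ⟨(Finset.mem_sdiff.1 hb).1, ?_⟩)
      exact h6.trans h5.symm
    have h7 := Finset.card_sdiff_add_card_eq_card hd1
    have h8 := Finset.card_sdiff_add_card_eq_card (hCZ a)
    rw [← hY] at h7
    omega
  refine ⟨Y, hYZ, ?_, ?_⟩
  · let T : Finset ((_ : E) × (_ : E) × E) := Y.sigma fun y => (Z \ C y).sigma fun t =>
      (Z \ C y) \ C t
    have hT : Y.card ^ 3 ≤ T.card := by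
      rw [Finset.card_sigma, pow_succ', ← smul_eq_mul]
      refine Finset.card_nsmul_le_sum _ _ _ fun y hy => ?_
      have hyb : (C y).card ≤ (C b).card := hbmax y (Finset.mem_sdiff.1 hy).1
      have hya : (C y).card ≤ (C a).card := hamax y (hYZ hy)
      have hs := Finset.le_card_sdiff (C y) Z
      rw [Finset.card_sigma]
      have h3 : (Z \ C y).card * Y.card ≤ ∑ t ∈ Z \ C y, ((Z \ C y) \ C t).card := by
        rw [← smul_eq_mul]
        refine Finset.card_nsmul_le_sum _ _ _ fun t ht => ?_
        have hta : (C t).card ≤ (C a).card := hamax t (Finset.mem_sdiff.1 ht).1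
        have hs2 := Finset.le_card_sdiff (C t) (Z \ C y)
        omega
      have hYle : Y.card ≤ (Z \ C y).card := by omega
      calc Y.card ^ 2 = Y.card * Y.card := pow_two _
        _ ≤ (Z \ C y).card * Y.card := Nat.mul_le_mul_right _ hYle
        _ ≤ _ := h3
    let f : ((_ : E) × (_ : E) × E) → Finset E := fun x => {x.1, x.2.1, x.2.2}
    have himg : T.image f ⊆ transversals U Z := by
      intro A hA
      obtain ⟨⟨x, y, z⟩, hx, rfl⟩ := Finset.mem_image.1 hA
      simp only [T, C, Finset.mem_sigma, Finset.mem_sdiff, Finset.mem_filter, not_and] at hx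
      obtain ⟨h1, ⟨h2, h3⟩, ⟨h4, h5⟩, h6⟩ := hx
      rw [mem_transversals]
      have hx1 := hYZ h1
      have r1 := h3 h2
      have r2 := h5 h4
      have r3 := h6 h4
      have r1' : ¬ Rel U y x := fun h => r1 h.symm
      have r2' : ¬ Rel U z x := fun h => r2 h.symm
      have r3' : ¬ Rel U z y := fun h => r3 h.symm
      refine ⟨?_, ?_⟩
      · intro w hw
        simp only [f, Finset.mem_insert, Finset.mem_singleton] at hw
        rcases hw with rfl | rfl | rfl <;> assumption
      · intro u hu v hv huv
        simp only [f, Finset.mem_insert, Finset.mem_singleton] at hu hv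
        rcases hu with rfl | rfl | rfl <;> rcases hv with rfl | rfl | rfl <;>
          first | rfl | contradiction
    have hfib : T.card ≤ 27 * (T.image f).card := by
      refine Finset.card_le_mul_card_image _ _ fun A hA => ?_
      obtain ⟨x, -, rfl⟩ := Finset.mem_image.1 hA
      have h3 : (f x).card ≤ 3 := Finset.card_le_three
      have hsub : T.filter (fun y => f y = f x) ⊆
          (f x).sigma fun _ => (f x).sigma fun _ => f x := by
        intro y hy
        have hy := (Finset.mem_filter.1 hy).2
        rw [← hy]
        simp [f]
      refine (Finset.card_le_card hsub).trans ?_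
      simp only [Finset.card_sigma, Finset.sum_const, smul_eq_mul]
      calc (f x).card * ((f x).card * (f x).card) ≤ 3 * (3 * 3) := by gcongr
        _ = 27 := by norm_num
    exact hT.trans (hfib.trans (Nat.mul_le_mul_left _ (Finset.card_le_card himg)))
  · intro u hu v hv w hw huv huw
    have key : ∀ x ∈ Z \ Y, Rel U a x ∨ Rel U b x := by
      intro x hx
      simp only [hY, C, Finset.mem_sdiff, Finset.mem_filter] at hx
      by_contra hcon
      rw [not_or] at hcon
      exact hx.2 ⟨⟨hx.1, fun h => hcon.1 h.2⟩, fun h => hcon.2 h.2⟩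
    rcases key u hu with h1 | h1 <;> rcases key v hv with h2 | h2 <;>
      rcases key w hw with h3 | h3
    · exact h2.symm.trans h3
    · exact absurd (h1.symm.trans h2) huv
    · exact absurd (h1.symm.trans h3) huw
    · exact h2.symm.trans h3
    · exact h2.symm.trans h3
    · exact absurd (h1.symm.trans h3) huw
    · exact absurd (h1.symm.trans h2) huv
    · exact h2.symm.trans h3

end CycleSpace

namespace CycleSpace

variable {E : Type*} [Fintype E] [DecidableEq E] {W U : Set (Finset E)} {X Z S a d : Finset E}
  {u v e : E}

lemma exists_subset_rel_of_not_rel_del (hW : SymmClosed W) (hZ : CoIndep (del W {e}) Z) {y : ℕ}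
    (hy : 27 * (circuits W).card < (y + 1) ^ 3) :
    ∃ Y ⊆ Z, Y.card ≤ y ∧ ∀ u ∈ Z \ Y, ∀ v ∈ Z \ Y, ∀ w ∈ Z \ Y, Rel W u v → Rel W u w →
      ¬ Rel (del W {e}) u v → ¬ Rel (del W {e}) u w → Rel (del W {e}) v w := by
  classical
  by_cases hex : ∃ c ∈ W, e ∈ c
  · obtain ⟨c, hc, hec⟩ := hex
    obtain ⟨Y, hYZ, hYc, hY⟩ := exists_subset_no_triple (del W {e}) (Z ∩ cls W e)
    have h1 := card_transversals_le_card_circuits hW hc hec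
      (Finset.inter_subset_right : Z ∩ cls W e ⊆ cls W e) (hZ.mono Finset.inter_subset_left)
    have h2 := Finset.card_filter_le (circuits W) fun d => e ∈ d
    refine ⟨Y, hYZ.trans Finset.inter_subset_left, ?_, ?_⟩
    · have h3 : Y.card ^ 3 < (y + 1) ^ 3 := by omega
      have := lt_of_pow_lt_pow_left₀ 3 (by omega) h3
      omega
    · intro u hu v hv w hw huv huw hduv hduw
      have heu : Rel W e u := by
        by_contra hcon
        refine hduv (huv.del_of_disjoint hW (Finset.disjoint_singleton_right.2 fun h => ?_))
        exact hcon (mem_cls.1 h).symm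
      have key : ∀ x ∈ Z \ Y, Rel W u x → x ∈ (Z ∩ cls W e) \ Y := by
        intro x hx hux
        rw [Finset.mem_sdiff] at hx ⊢
        exact ⟨Finset.mem_inter.2 ⟨hx.1, mem_cls.2 (heu.trans hux)⟩, hx.2⟩
      exact hY u (key u hu (Rel.refl _ _)) v (key v hv huv) w (key w hw huw) hduv hduw
  · push Not at hex
    refine ⟨∅, by simp, by simp, fun u _ v _ w _ huv _ hduv => absurd ?_ hduv⟩
    have : del W {e} = W := by
      ext w
      simp only [del, Finset.disjoint_singleton_right, Set.mem_ofPred_eq]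
      exact ⟨fun h => h.1, fun h => ⟨h, hex w h⟩⟩
    rwa [this]

lemma card_circuits_del_le (W : Set (Finset E)) (X : Finset E) :
    (circuits (del W X)).card ≤ (circuits W).card :=
  Finset.card_le_card ((circuits_del_subset W X).trans (Finset.filter_subset _ _))

/-- A coindependent set can be thinned out so that no deletion from a given sequence splits a
component into three parts that meet the set. -/
lemma exists_subset_noTriple {ι : Type*} [DecidableEq ι] (hW : SymmClosed W) (hZ : CoIndep W Z)
    (D : ι → E) (J : Finset ι) {y : ℕ} (hy : 27 * (circuits W).card < (y + 1) ^ 3) :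
    ∃ Z' ⊆ Z, Z.card ≤ Z'.card + (2 ^ J.card * J.card * (J.card + y) + J.card) ∧
      (∀ i ∈ J, D i ∉ Z') ∧ NoTriple W D J Z' := by
  classical
  have hbad : ∀ I i, I ⊆ J → i ∈ J → ∃ B : Finset E, B.card ≤ J.card + y ∧
      ∀ u ∈ Z \ B, ∀ v ∈ Z \ B, ∀ w ∈ Z \ B,
        Rel (del W (I.image D)) u v → Rel (del W (I.image D)) u w →
        ¬ Rel (del W ((insert i I).image D)) u v → ¬ Rel (del W ((insert i I).image D)) u w →
        Rel (del W ((insert i I).image D)) v w := by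
    intro I i hI hi
    have e1 : del W ((insert i I).image D) = del (del W (I.image D)) {D i} := by
      rw [del_del, Finset.image_insert, Finset.insert_eq, Finset.union_comm]
    obtain ⟨Z1, hZ1, hc1, hco⟩ := hZ.exists_subset_del hW ((insert i I).image D)
    rw [e1] at hco
    obtain ⟨Y, hYZ, hYc, hY⟩ := exists_subset_rel_of_not_rel_del (hW.del (I.image D)) hco
      (lt_of_le_of_lt (Nat.mul_le_mul_left 27 (card_circuits_del_le W _)) hy)
    have h2 : ((insert i I).image D).card ≤ J.card :=
      Finset.card_image_le.trans (Finset.card_le_card (Finset.insert_subset hi hI))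
    refine ⟨(Z \ Z1) ∪ Y, ?_, ?_⟩
    · have h3 := Finset.card_union_le (Z \ Z1) Y
      have h4 := Finset.card_sdiff_add_card_eq_card hZ1
      omega
    · have key : ∀ x ∈ Z \ ((Z \ Z1) ∪ Y), x ∈ Z1 \ Y := by
        intro x hx
        simp only [Finset.mem_sdiff, Finset.mem_union] at hx ⊢
        tauto
      rw [e1]
      intro u hu v hv w hw
      exact hY u (key u hu) v (key v hv) w (key w hw)
  choose! B hBc hB using hbad
  set T := (J.powerset ×ˢ J).biUnion fun x => B x.1 x.2 with hT
  have hTc : T.card ≤ 2 ^ J.card * J.card * (J.card + y) := by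
    have h1 : T.card ≤ (J.powerset ×ˢ J).card * (J.card + y) := by
      refine Finset.card_biUnion_le_card_mul _ _ _ fun x hx => ?_
      rw [Finset.mem_product, Finset.mem_powerset] at hx
      exact hBc _ _ hx.1 hx.2
    rwa [Finset.card_product, Finset.card_powerset] at h1
  refine ⟨(Z \ T) \ J.image D, Finset.sdiff_subset.trans Finset.sdiff_subset, ?_, ?_, ?_⟩
  · have h1 := Finset.le_card_sdiff (J.image D) (Z \ T)
    have h2 := Finset.le_card_sdiff T Z
    have h3 : (J.image D).card ≤ J.card := Finset.card_image_le
    omega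
  · intro i hi h
    exact (Finset.mem_sdiff.1 h).2 (Finset.mem_image_of_mem D hi)
  · intro I hI i hi
    have key : ∀ x ∈ (Z \ T) \ J.image D, x ∈ Z \ B I i := by
      intro x hx
      have hx' := Finset.mem_sdiff.1 (Finset.mem_sdiff.1 hx).1
      refine Finset.mem_sdiff.2 ⟨hx'.1, fun h => hx'.2 ?_⟩
      exact Finset.mem_biUnion.2 ⟨(I, i), Finset.mem_product.2 ⟨Finset.mem_powerset.2 hI, hi⟩, h⟩
    intro u hu v hv w hw
    exact hB I i hI hi u (key u hu) v (key v hv) w (key w hw)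

omit [Fintype E] in
lemma pairSum_one (W : Set (Finset E)) (Z : Finset E) :
    pairSum W Z (fun _ => 1) = (relPairs W Z).card := by
  classical
  rw [pairSum, relPairs, Finset.card_filter, Finset.sum_product]
  push_cast
  simp

lemma card_relPairs_del_le (hW : SymmClosed W) (hZ : CoIndep W Z) {Z' : Finset E} (hZ' : Z' ⊆ Z)
    (X : Finset E) :
    (relPairs (del W X) Z').card ≤ 2 * (circuits (del W X)).card + 2 * X.card * Z.card := by
  classical
  obtain ⟨Z1, hZ1, hc1, hco⟩ := hZ.exists_subset_del hW X
  have h1 := card_relPairs_le (hW.del X) (hco.mono (Finset.inter_subset_right : Z' ∩ Z1 ⊆ Z1))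
  have hsub : relPairs (del W X) Z' ⊆ relPairs (del W X) (Z' ∩ Z1) ∪
      ((Z \ Z1) ×ˢ Z ∪ Z ×ˢ (Z \ Z1)) := by
    rintro ⟨x, y⟩ hxy
    simp only [relPairs, Finset.mem_filter, Finset.mem_product] at hxy
    have hx := hZ' hxy.1.1
    have hy := hZ' hxy.1.2
    simp only [relPairs, Finset.mem_union, Finset.mem_filter, Finset.mem_product, Finset.mem_inter,
      Finset.mem_sdiff]
    by_cases hx1 : x ∈ Z1
    · by_cases hy1 : y ∈ Z1
      · left; exact ⟨⟨⟨hxy.1.1, hx1⟩, ⟨hxy.1.2, hy1⟩⟩, hxy.2⟩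
      · right; right; exact ⟨hx, hy, hy1⟩
    · right; left; exact ⟨⟨hx, hx1⟩, hy⟩
  have h2 := Finset.card_le_card hsub
  have h3 := Finset.card_union_le (relPairs (del W X) (Z' ∩ Z1))
    ((Z \ Z1) ×ˢ Z ∪ Z ×ˢ (Z \ Z1))
  have h4 := Finset.card_union_le ((Z \ Z1) ×ˢ Z) (Z ×ˢ (Z \ Z1))
  rw [Finset.card_product, Finset.card_product] at h4
  have h5 := Finset.card_sdiff_add_card_eq_card hZ1
  have h6 : (Z \ Z1).card * Z.card ≤ X.card * Z.card := Nat.mul_le_mul_right _ (by omega)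
  have h7 : Z.card * (Z \ Z1).card = (Z \ Z1).card * Z.card := mul_comm _ _
  have h8 : 2 * X.card * Z.card = X.card * Z.card + X.card * Z.card := by ring
  omega

/-- A lower bound for the expected number of circuits avoiding random elements of a fixed
sequence. -/
lemma sq_le_sum_circuits {N : ℕ} (hW : SymmClosed W) (hrel : ∀ u v, Rel W u v) (hZ : CoIndep W Z)
    {y : ℕ} (hy : 27 * (circuits W).card < (y + 1) ^ 3) {p : ℝ} (hp0 : 0 < p) (hp1 : p < 1)
    (hL : 2 ^ N * N * (N + y) + N ≤ Z.card) (D : Fin N → E) :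
    ((Z.card : ℝ) - (2 ^ N * N * (N + y) + N : ℕ)) ^ 2 ≤ (1 + N * (p / (2 - p))) *
      (2 * ∑ I ∈ (Finset.univ : Finset (Fin N)).powerset, p ^ I.card * (1 - p) ^ (N - I.card) *
        ((circuits (del W (I.image D))).card : ℝ) + 2 * N * Z.card) := by
  classical
  obtain ⟨Z', hZ', hc, hDZ, hT⟩ := exists_subset_noTriple hW hZ D Finset.univ hy
  have h1 := sq_sum_le_energy hp0 hp1 Finset.univ hW (fun u _ v _ => hrel u v) hDZ hT
    (x := fun _ => 1) (fun _ => zero_le_one)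
  simp only [Finset.card_univ, Fintype.card_fin] at hc h1
  simp only [Finset.sum_const, nsmul_eq_mul, mul_one] at h1
  have h2 : (Z.card : ℝ) - (2 ^ N * N * (N + y) + N : ℕ) ≤ Z'.card := by
    have : (Z.card : ℝ) ≤ ((Z'.card + (2 ^ N * N * (N + y) + N) : ℕ) : ℝ) := by exact_mod_cast hc
    push_cast at this ⊢
    linarith
  have h3 : (0 : ℝ) ≤ (Z.card : ℝ) - (2 ^ N * N * (N + y) + N : ℕ) := by
    rw [sub_nonneg]; exact_mod_cast hL
  have hc0 : 0 < p / (2 - p) := div_pos hp0 (by linarith)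
  refine (pow_le_pow_left₀ h3 h2 2).trans (h1.trans (mul_le_mul_of_nonneg_left ?_ (by positivity)))
  have hw : ∑ I ∈ (Finset.univ : Finset (Fin N)).powerset, p ^ I.card * (1 - p) ^ (N - I.card)
      = 1 := by
    have := Finset.sum_pow_mul_eq_add_pow p (1 - p) (Finset.univ : Finset (Fin N))
    simp only [Finset.card_univ, Fintype.card_fin] at this
    rw [this]; simp
  have h4 : (2 * N * Z.card : ℝ) = ∑ I ∈ (Finset.univ : Finset (Fin N)).powerset,
      p ^ I.card * (1 - p) ^ (N - I.card) * (2 * N * Z.card) := by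
    rw [← Finset.sum_mul, hw, one_mul]
  rw [h4, Finset.mul_sum, ← Finset.sum_add_distrib, energy]
  refine Finset.sum_le_sum fun I _ => ?_
  simp only [Finset.card_univ, Fintype.card_fin]
  have h5 : pairSum (del W (I.image D)) Z' (fun _ => 1)
      ≤ 2 * ((circuits (del W (I.image D))).card : ℝ) + 2 * N * Z.card := by
    rw [pairSum_one]
    have h6 := card_relPairs_del_le hW hZ hZ' (I.image D)
    have h7 : (I.image D).card ≤ N := by
      refine Finset.card_image_le.trans ((Finset.card_le_univ I).trans ?_)
      simp
    have h8 : (relPairs (del W (I.image D)) Z').card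
        ≤ 2 * (circuits (del W (I.image D))).card + 2 * N * Z.card :=
      h6.trans (by gcongr)
    exact_mod_cast h8
  have h9 : 0 ≤ p ^ I.card * (1 - p) ^ (N - I.card) :=
    mul_nonneg (pow_nonneg hp0.le _) (pow_nonneg (by linarith) _)
  calc _ ≤ p ^ I.card * (1 - p) ^ (N - I.card) *
        (2 * ((circuits (del W (I.image D))).card : ℝ) + 2 * N * Z.card) :=
        mul_le_mul_of_nonneg_left h5 h9
    _ = _ := by ring

/-- The expected number of circuits avoiding random elements. -/
lemma sum_card_circuits_le (W : Set (Finset E)) {p : ℝ} (hp0 : 0 < p) (hp1 : p < 1) (N : ℕ) :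
    ∑ D : Fin N → E, ∑ I ∈ (Finset.univ : Finset (Fin N)).powerset,
      p ^ I.card * (1 - p) ^ (N - I.card) * ((circuits (del W (I.image D))).card : ℝ)
      ≤ ∑ d ∈ circuits W, ((Fintype.card E : ℝ) - p * d.card) ^ N := by
  classical
  have h1 : ∀ D : Fin N → E, ∑ I ∈ (Finset.univ : Finset (Fin N)).powerset,
      p ^ I.card * (1 - p) ^ (N - I.card) * ((circuits (del W (I.image D))).card : ℝ)
      ≤ ∑ d ∈ circuits W, ∏ i, ((if D i ∈ d then 0 else p) + (1 - p)) := by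
    intro D
    simp only [Finset.prod_add]
    rw [Finset.sum_comm]
    refine Finset.sum_le_sum fun I _ => ?_
    have h2 : ((circuits (del W (I.image D))).card : ℝ)
        ≤ ∑ d ∈ circuits W, if Disjoint d (I.image D) then 1 else 0 := by
      rw [Finset.sum_boole]
      exact_mod_cast Finset.card_le_card (circuits_del_subset W _)
    have h9 : 0 ≤ p ^ I.card * (1 - p) ^ (N - I.card) :=
      mul_nonneg (pow_nonneg hp0.le _) (pow_nonneg (by linarith) _)
    refine (mul_le_mul_of_nonneg_left h2 h9).trans (le_of_eq ?_)
    rw [Finset.mul_sum]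
    refine Finset.sum_congr rfl fun d _ => ?_
    have h3 : ∏ i ∈ Finset.univ \ I, (1 - p) = (1 - p) ^ (N - I.card) := by
      rw [Finset.prod_const, Finset.card_sdiff_of_subset (Finset.subset_univ I)]
      simp
    rw [h3]
    by_cases hd : Disjoint d (I.image D)
    · have h4 : ∏ i ∈ I, (if D i ∈ d then 0 else p) = p ^ I.card := by
        rw [← Finset.prod_const]
        refine Finset.prod_congr rfl fun i hi => if_neg ?_
        exact Finset.disjoint_right.1 hd (Finset.mem_image_of_mem D hi)
      rw [h4, if_pos hd, mul_one]
    · have h4 : ∏ i ∈ I, (if D i ∈ d then 0 else p) = 0 := by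
        rw [Finset.not_disjoint_iff] at hd
        obtain ⟨x, hx, hx'⟩ := hd
        obtain ⟨i, hi, rfl⟩ := Finset.mem_image.1 hx'
        exact Finset.prod_eq_zero hi (if_pos hx)
      rw [h4, if_neg hd, mul_zero, zero_mul]
  refine (Finset.sum_le_sum fun D _ => h1 D).trans (le_of_eq ?_)
  rw [Finset.sum_comm]
  refine Finset.sum_congr rfl fun d _ => ?_
  rw [← Fintype.sum_pow (fun x => (if x ∈ d then 0 else p) + (1 - p))]
  congr 1
  rw [Finset.sum_add_distrib]
  have h5 : ∀ x : E, (if x ∈ d then 0 else p) = p - if x ∈ d then p else 0 := by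
    intro x; split_ifs <;> simp
  simp only [h5, Finset.sum_sub_distrib, Finset.sum_const, Finset.card_univ, nsmul_eq_mul]
  rw [Finset.sum_ite_mem, Finset.univ_inter, Finset.sum_const, nsmul_eq_mul]
  ring

lemma sum_pow_le (m N : ℕ) {p : ℝ} (hp0 : 0 < p) (hp1 : p < 1) (k : ℕ) (hk : k ≤ m) :
    ∑ l ∈ Finset.range k, ((m : ℝ) - p * (l + 1 : ℕ)) ^ N * ((N + 1) * p)
      ≤ (m : ℝ) ^ (N + 1) - ((m : ℝ) - p * k) ^ (N + 1) := by
  induction k with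
  | zero => simp
  | succ k ih =>
    rw [Finset.sum_range_succ]
    have h1 := ih (by omega)
    have hk' : ((k + 1 : ℕ) : ℝ) ≤ m := by exact_mod_cast hk
    set b := (m : ℝ) - p * k with hb
    set a := (m : ℝ) - p * (k + 1 : ℕ) with ha
    have ha0 : 0 ≤ a := by
      have : p * (k + 1 : ℕ) ≤ 1 * (k + 1 : ℕ) := by gcongr
      rw [ha]; linarith
    have hab : b = a + p := by rw [ha, hb]; push_cast; ring
    have h2 : a ^ (N + 1) + (N + 1) * p * a ^ N ≤ b ^ (N + 1) := by
      rw [hab]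
      clear_value a
      clear h1 ih hab hb ha
      induction N with
      | zero => simp
      | succ N ihN =>
        have h3 : (a + p) ^ (N + 1 + 1) = (a + p) ^ (N + 1) * (a + p) := pow_succ _ _
        have h4 : 0 ≤ a ^ N := pow_nonneg ha0 _
        have h5 := mul_le_mul_of_nonneg_right ihN (by linarith : 0 ≤ a + p)
        have h6 : 0 ≤ ((N : ℝ) + 1) * p * p * a ^ N := by positivity
        rw [h3]
        push_cast
        refine le_trans ?_ h5
        have : (a ^ (N + 1) + (N + 1) * p * a ^ N) * (a + p)
            = a ^ (N + 1 + 1) + (N + 1 + 1) * p * a ^ (N + 1) + (N + 1) * p * p * a ^ N := by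
          ring
        linarith
    have h3 : a ^ N * ((N + 1) * p) = (N + 1) * p * a ^ N := by ring
    linarith

omit [DecidableEq E] in
lemma sum_circuits_pow_le (W : Set (Finset E))
    (hinj : ∀ s ∈ circuits W, ∀ t ∈ circuits W, s.card = t.card → s = t)
    {p : ℝ} (hp0 : 0 < p) (hp1 : p < 1) (N : ℕ) :
    ∑ d ∈ circuits W, ((Fintype.card E : ℝ) - p * d.card) ^ N
      ≤ (Fintype.card E : ℝ) ^ (N + 1) / ((N + 1) * p) := by
  classical
  set m := Fintype.card E with hm
  have hpos : ∀ l ∈ Finset.range m, 0 ≤ ((m : ℝ) - p * (l + 1 : ℕ)) ^ N := by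
    intro l hl
    rw [Finset.mem_range] at hl
    refine pow_nonneg ?_ _
    have h1 : ((l + 1 : ℕ) : ℝ) ≤ m := by exact_mod_cast hl
    have : p * (l + 1 : ℕ) ≤ 1 * (l + 1 : ℕ) := by gcongr
    linarith
  have hcard : ∀ d ∈ circuits W, 1 ≤ d.card ∧ d.card ≤ m := fun d hd =>
    ⟨Finset.card_pos.2 (mem_circuits.1 hd).prop.2, Finset.card_le_univ d⟩
  have h1 : ∑ d ∈ circuits W, ((m : ℝ) - p * d.card) ^ N
      = ∑ l ∈ (circuits W).image (fun d => d.card - 1), ((m : ℝ) - p * (l + 1 : ℕ)) ^ N := by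
    rw [Finset.sum_image]
    · refine Finset.sum_congr rfl fun d hd => ?_
      rw [Nat.sub_add_cancel (hcard d hd).1]
    · intro s hs t ht hst
      have h2 := hcard s hs
      have h3 := hcard t ht
      simp only at hst
      exact hinj s hs t ht (by omega)
  have h2 : (circuits W).image (fun d => d.card - 1) ⊆ Finset.range m := by
    intro l hl
    obtain ⟨d, hd, rfl⟩ := Finset.mem_image.1 hl
    have := hcard d hd
    rw [Finset.mem_range]
    omega
  have h3 := Finset.sum_le_sum_of_subset_of_nonneg h2 (fun l hl _ => hpos l hl)
  have h4 := sum_pow_le m N hp0 hp1 m le_rfl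
  rw [← Finset.sum_mul] at h4
  have h5 : 0 ≤ ((m : ℝ) - p * m) ^ (N + 1) := by
    refine pow_nonneg ?_ _
    have : (0 : ℝ) ≤ m := Nat.cast_nonneg m
    nlinarith
  rw [h1, le_div_iff₀ (by positivity)]
  have h6 : 0 < ((N : ℝ) + 1) * p := by positivity
  nlinarith

omit [DecidableEq E] in
lemma card_circuits_le (W : Set (Finset E))
    (hinj : ∀ s ∈ circuits W, ∀ t ∈ circuits W, s.card = t.card → s = t) :
    (circuits W).card ≤ Fintype.card E := by
  have h := Finset.card_le_card_of_injOn (s := circuits W) (t := Finset.range (Fintype.card E))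
    (fun d => d.card - 1) ?_ ?_
  · simpa using h
  · intro d hd
    have h1 : 1 ≤ d.card := Finset.card_pos.2 (mem_circuits.1 hd).prop.2
    have h2 := Finset.card_le_univ d
    simp only [Finset.coe_range, Set.mem_Iio]
    omega
  · intro s hs t ht hst
    have h1 : 1 ≤ s.card := Finset.card_pos.2 (mem_circuits.1 hs).prop.2
    have h2 : 1 ≤ t.card := Finset.card_pos.2 (mem_circuits.1 ht).prop.2
    simp only at hst
    exact hinj s hs t ht (by omega)

/-- A connected binary space whose circuits have distinct sizes has small dimension. -/
theorem sq_card_le (hW : SymmClosed W) (hrel : ∀ u v, Rel W u v) (hZ : CoIndep W Z)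
    (hinj : ∀ s ∈ circuits W, ∀ t ∈ circuits W, s.card = t.card → s = t)
    (hE : 0 < Fintype.card E) {N y : ℕ} (hy : 27 * Fintype.card E < (y + 1) ^ 3)
    {p : ℝ} (hp0 : 0 < p) (hp1 : p < 1) (hL : 2 ^ N * N * (N + y) + N ≤ Z.card) :
    ((Z.card : ℝ) - (2 ^ N * N * (N + y) + N : ℕ)) ^ 2 ≤ (1 + N * (p / (2 - p))) *
      (2 * (Fintype.card E / ((N + 1) * p)) + 2 * N * Z.card) := by
  classical
  have hy' : 27 * (circuits W).card < (y + 1) ^ 3 :=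
    lt_of_le_of_lt (Nat.mul_le_mul_left 27 (card_circuits_le W hinj)) hy
  have h1 := Finset.sum_le_sum fun (D : Fin N → E) (_ : D ∈ Finset.univ) =>
    sq_le_sum_circuits hW hrel hZ hy' hp0 hp1 hL D
  rw [← Finset.mul_sum, Finset.sum_add_distrib, ← Finset.mul_sum] at h1
  simp only [Finset.sum_const, Finset.card_univ, Fintype.card_pi, Finset.prod_const,
    Fintype.card_fin, nsmul_eq_mul] at h1
  have h2 := (sum_card_circuits_le W hp0 hp1 N).trans (sum_circuits_pow_le W hinj hp0 hp1 N)
  have hm : (0 : ℝ) < Fintype.card E := by exact_mod_cast hE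
  have hc0 : 0 < p / (2 - p) := div_pos hp0 (by linarith)
  push_cast at h1 ⊢
  set m : ℝ := (Fintype.card E : ℝ) with hmdef
  have hmN : 0 < m ^ N := pow_pos hm N
  have hK : 0 < 1 + (N : ℝ) * (p / (2 - p)) := by positivity
  refine le_of_mul_le_mul_left (h1.trans ?_) hmN
  calc _ ≤ (1 + (N : ℝ) * (p / (2 - p))) *
        (2 * (m ^ (N + 1) / ((N + 1) * p)) + m ^ N * (2 * N * Z.card)) := by gcongr
    _ = _ := by rw [pow_succ]; ring

end CycleSpace

namespace CycleSpace

/-- The asymptotic consequence of the family of inequalities in `sq_card_le`. -/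
lemma exists_forall_sq_le {δ : ℝ} (hδ0 : 0 < δ) (hδ1 : δ ≤ 1) :
    ∃ R : ℕ, ∀ m r : ℕ, R ≤ r →
      (∀ (N y : ℕ) (p : ℝ), 27 * m < (y + 1) ^ 3 → 0 < p → p < 1 →
        2 ^ N * N * (N + y) + N ≤ r →
        ((r : ℝ) - (2 ^ N * N * (N + y) + N : ℕ)) ^ 2 ≤ (1 + N * (p / (2 - p))) *
          (2 * (m / ((N + 1) * p)) + 2 * N * r)) →
      (r : ℝ) ^ 2 ≤ (1 + δ) * m := by
  set p : ℝ := δ / 8 with hp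
  have hp0 : 0 < p := by positivity
  have hp1 : p < 1 := by rw [hp]; linarith
  obtain ⟨N, hN⟩ := exists_nat_ge (2 / p ^ 2)
  set K : ℝ := 1 + N * (p / (2 - p)) with hK
  have h2p : 0 < 2 - p := by linarith
  set c : ℝ := 2 ^ N * N with hc
  have hc0 : 0 ≤ c := by positivity
  set η : ℝ := p / (2 * (c + 1)) with hη
  have hη0 : 0 < η := by positivity
  have hcη : c * η ≤ p / 2 := by
    rw [hη, mul_div_assoc', div_le_div_iff₀ (by positivity) two_pos]
    nlinarith
  have hA : K * (2 / ((N + 1) * p)) ≤ 1 + 2 * p := by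
    have h1 : 2 / ((N + 1) * p) ≤ p := by
      rw [div_le_iff₀ (by positivity)]
      rw [div_le_iff₀ (by positivity)] at hN
      nlinarith
    have h2 : (N : ℝ) * (p / (2 - p)) * (2 / ((N + 1) * p)) ≤ 1 + p := by
      rw [show (N : ℝ) * (p / (2 - p)) * (2 / ((N + 1) * p)) = (2 * N) / ((2 - p) * (N + 1)) by
        field_simp, div_le_iff₀ (by positivity)]
      have : 0 ≤ (N : ℝ) := by positivity
      nlinarith [mul_pos hp0 (sub_pos.2 hp1), mul_nonneg this (mul_pos hp0 (sub_pos.2 hp1)).le]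
    rw [hK]
    linarith
  obtain ⟨R, hR⟩ := exists_nat_ge (max (27 / η ^ 3) (max (2 * (c * N + N) / p) (2 * N * K / p)))
  refine ⟨R, fun m r hr H => ?_⟩
  have hrR : (R : ℝ) ≤ r := by exact_mod_cast hr
  have hr1 : 27 ≤ r * η ^ 3 := by
    rw [← div_le_iff₀ (by positivity)]
    exact ((le_max_left _ _).trans hR).trans hrR
  have hr2 : 2 * (c * N + N) ≤ r * p := by
    rw [← div_le_iff₀ hp0]
    exact (((le_max_left _ _).trans (le_max_right _ _)).trans hR).trans hrR
  have hr3 : 2 * N * K ≤ r * p := by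
    rw [← div_le_iff₀ hp0]
    exact (((le_max_right _ _).trans (le_max_right _ _)).trans hR).trans hrR
  have hr0 : (0 : ℝ) ≤ r := by positivity
  by_cases hm : (r : ℝ) ^ 2 < m
  · nlinarith
  push Not at hm
  have hrpos : (0 : ℝ) < r := by
    rcases hr0.eq_or_lt with h | h
    · rw [← h] at hr1; linarith
    · exact h
  set y : ℕ := ⌊η * r⌋₊ with hy
  have hy1 : (y : ℝ) ≤ η * r := Nat.floor_le (by positivity)
  have hy2 : η * r < y + 1 := Nat.lt_floor_add_one _
  have hy3 : 27 * m < (y + 1) ^ 3 := by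
    have h1 : (η * r) ^ 3 < ((y : ℝ) + 1) ^ 3 := pow_lt_pow_left₀ hy2 (by positivity) (by norm_num)
    have h2 : (27 : ℝ) * m ≤ (η * r) ^ 3 := by
      calc (27 : ℝ) * m ≤ (r * η ^ 3) * r ^ 2 := by gcongr
        _ = _ := by ring
    exact_mod_cast h2.trans_lt h1
  have hL : ((2 ^ N * N * (N + y) + N : ℕ) : ℝ) ≤ p * r := by
    push_cast
    rw [← hc]
    have : c * y ≤ p / 2 * r := by
      calc c * y ≤ c * (η * r) := by gcongr
        _ = c * η * r := by ring
        _ ≤ _ := by gcongr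
    linarith
  have hLr : 2 ^ N * N * (N + y) + N ≤ r := by
    have : ((2 ^ N * N * (N + y) + N : ℕ) : ℝ) ≤ r := hL.trans (by nlinarith)
    exact_mod_cast this
  have h := H N y p hy3 hp0 hp1 hLr
  rw [← hK] at h
  have h1 : ((1 - p) * r) ^ 2 ≤ ((r : ℝ) - (2 ^ N * N * (N + y) + N : ℕ)) ^ 2 :=
    pow_le_pow_left₀ (mul_nonneg (by linarith) hr0) (by linarith) 2
  have h2 : K * (2 * (m / ((N + 1) * p)) + 2 * N * r) ≤ (1 + 2 * p) * m + p * r ^ 2 := by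
    calc K * (2 * (m / ((N + 1) * p)) + 2 * N * r)
        = K * (2 / ((N + 1) * p)) * m + 2 * N * K * r := by ring
      _ ≤ (1 + 2 * p) * m + r * p * r := by gcongr
      _ = _ := by ring
  have h3 : (1 - 3 * p) * (r : ℝ) ^ 2 ≤ (1 + 2 * p) * m := by nlinarith [sq_nonneg (p * r)]
  have h4 : (1 + 2 * p) ≤ (1 - 3 * p) * (1 + δ) := by rw [hp]; nlinarith
  have h5 : (0 : ℝ) < 1 - 3 * p := by rw [hp]; linarith
  have h6 : (1 - 3 * p) * (r : ℝ) ^ 2 ≤ (1 - 3 * p) * ((1 + δ) * m) := by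
    rw [← mul_assoc]
    exact h3.trans (by gcongr)
  exact le_of_mul_le_mul_left h6 h5

lemma le_mul_of_sq_le {ε s k : ℝ} (hε : 0 < ε) (hs : 2 ≤ ε * s)
    (h : k ^ 2 ≤ (1 + min ε 1) * (s ^ 2 + k)) : k ≤ (1 + ε) * s := by
  by_contra! hk
  have h1 := min_le_left ε 1
  have h2 := min_le_right ε 1
  have hs0 : 0 < s := by
    by_contra! hs'
    nlinarith
  have hk0 : 0 < k := lt_trans (by positivity) hk
  have h3 : k ^ 2 ≤ (1 + ε) * s ^ 2 + 2 * k := by nlinarith [sq_nonneg s]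
  nlinarith [mul_pos hε hs0, mul_pos hε (mul_pos hε hs0)]

end CycleSpace

namespace SimpleGraph

open CycleSpace

variable {V : Type*} [DecidableEq V] (G : SimpleGraph V)

/-- The edge sets of `G` meeting every star evenly. -/
def evenSets : Set (Finset G.edgeSet) := {s | ∀ v : V, Even {e ∈ s | v ∈ e.1}.card}

variable {G}

lemma even_card_filter_symmDiff {E : Type*} [DecidableEq E] (P : E → Prop) [DecidablePred P]
    (s t : Finset E) :
    Even {e ∈ s ∆ t | P e}.card ↔ (Even {e ∈ s | P e}.card ↔ Even {e ∈ t | P e}.card) := by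
  have h1 : {e ∈ s ∆ t | P e} = {e ∈ s | P e} ∆ {e ∈ t | P e} := by
    ext x; simp only [Finset.mem_filter, Finset.mem_symmDiff]; tauto
  have h2 : ({e ∈ s | P e} ∆ {e ∈ t | P e}).card + 2 * ({e ∈ s | P e} ∩ {e ∈ t | P e}).card =
      {e ∈ s | P e}.card + {e ∈ t | P e}.card := by
    rw [symmDiff_def, Finset.sup_eq_union, Finset.card_union_of_disjoint disjoint_sdiff_sdiff,
      ← Finset.card_sdiff_add_card_inter {e ∈ s | P e} {e ∈ t | P e},
      ← Finset.card_sdiff_add_card_inter {e ∈ t | P e} {e ∈ s | P e},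
      Finset.inter_comm {e ∈ t | P e}]
    ring
  rw [h1, ← Nat.even_add, ← h2, Nat.even_add]
  simp

omit [DecidableEq V] in
lemma symmClosed_even {E : Type*} [DecidableEq E] (A : Set V) (P : V → E → Prop)
    [∀ v, DecidablePred (P v)] :
    SymmClosed {s : Finset E | ∀ v ∈ A, Even {e ∈ s | P v e}.card} where
  empty_mem := by simp
  symmDiff_mem := fun hs ht v hv =>
    (even_card_filter_symmDiff _ _ _).2 (iff_of_true (hs v hv) (ht v hv))

lemma symmClosed_evenSets : SymmClosed G.evenSets := by
  simpa [evenSets] using symmClosed_even (Set.univ : Set V) (fun v (e : G.edgeSet) => v ∈ e.1)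

lemma exists_coIndep_even {E : Type*} [Fintype E] [DecidableEq E] (A : Finset V)
    (P : V → E → Prop) [∀ v, DecidablePred (P v)] :
    ∃ Z : Finset E, Fintype.card E ≤ Z.card + A.card ∧
      CoIndep {s : Finset E | ∀ v ∈ A, Even {e ∈ s | P v e}.card} Z := by
  induction A using Finset.induction_on with
  | empty => exact ⟨Finset.univ, by simp, fun z _ => ⟨{z}, by simp, by simp⟩⟩
  | insert a A ha ih =>
    obtain ⟨Z, hc, hZ⟩ := ih
    obtain ⟨Z', -, hc', hZ'⟩ := hZ.exists_subset
      (by simpa using symmClosed_even (A : Set V) P) {s | Even {e ∈ s | P a e}.card}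
      (fun s _ t _ hs ht => (even_card_filter_symmDiff _ _ _).2 (iff_of_false hs ht))
    refine ⟨Z', by rw [Finset.card_insert_of_notMem ha]; omega, ?_⟩
    convert! hZ' using 1
    ext s
    simp [and_comm]

/-- The cycle space has dimension at least the number of edges minus the number of vertices. -/
lemma exists_coIndep_evenSets [Fintype V] [Fintype G.edgeSet] :
    ∃ Z : Finset G.edgeSet, Fintype.card G.edgeSet ≤ Z.card + Fintype.card V ∧
      CoIndep G.evenSets Z := by
  simpa [evenSets] using exists_coIndep_even Finset.univ fun (v : V) (e : G.edgeSet) => v ∈ e.1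

open Classical in
/-- The edges of a walk, as edges of the graph. -/
noncomputable def Walk.edgeSubtype {u v : V} (p : G.Walk u v) : Finset G.edgeSet :=
  p.edges.toFinset.subtype (· ∈ G.edgeSet)

lemma Walk.mem_edgeSubtype {u v : V} {p : G.Walk u v} {e : G.edgeSet} :
    e ∈ p.edgeSubtype ↔ e.1 ∈ p.edges := by simp [edgeSubtype]

lemma Walk.image_edgeSubtype {u v : V} (p : G.Walk u v) :
    p.edgeSubtype.image Subtype.val = p.edges.toFinset := by
  ext e
  simp only [Finset.mem_image, mem_edgeSubtype, List.mem_toFinset]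
  exact ⟨by rintro ⟨e, he, rfl⟩; exact he, fun h => ⟨⟨e, p.edges_subset_edgeSet h⟩, h, rfl⟩⟩

lemma Walk.IsTrail.edgeSubtype_mem_evenSets {u : V} {p : G.Walk u u} (hp : p.IsTrail) :
    p.edgeSubtype ∈ G.evenSets := by
  intro x
  have h1 : {e ∈ p.edgeSubtype | x ∈ e.1}.card = p.edges.countP fun e => x ∈ e := by
    rw [List.countP_eq_length_filter,
      ← List.toFinset_card_of_nodup (hp.edges_nodup.filter _), List.toFinset_filter,
      ← image_edgeSubtype, Finset.filter_image, Finset.card_image_of_injective _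
      Subtype.val_injective]
    simp
  rw [h1, hp.even_countP_edges_iff]
  simp

lemma exists_isCycle_edgeSubtype_subset [Finite V] {s : Finset G.edgeSet} (hs : s ∈ G.evenSets)
    (hne : s.Nonempty) : ∃ (u : V) (c : G.Walk u u), c.IsCycle ∧ c.edgeSubtype ⊆ s := by
  classical
  set H : SimpleGraph V := fromEdgeSet (s.image Subtype.val : Finset (Sym2 V)) with hH
  have hadj : ∀ a b, H.Adj a b ↔ ∃ h : G.Adj a b, (⟨s(a, b), h⟩ : G.edgeSet) ∈ s := by
    intro a b
    simp only [hH, fromEdgeSet_adj, Finset.coe_image, Set.mem_image, Finset.mem_coe,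
      Subtype.exists, exists_and_right, exists_eq_right]
    exact ⟨fun h => h.1, fun h => ⟨h, h.1.ne⟩⟩
  have hle : H ≤ G := fun a b h => ((hadj a b).1 h).1
  have hcyc : ¬ H.IsAcyclic := by
    intro hac
    obtain ⟨⟨e0, he0⟩, hes⟩ := hne
    induction e0 with | _ a b
    have hab : H.Adj a b := (hadj a b).2 ⟨he0, hes⟩
    have : Nonempty V := ⟨a⟩
    obtain ⟨u, v, p, hp, hmax⟩ := Walk.exists_isPath_forall_isPath_length_le_length H
    have hnil : ¬ p.Nil := by
      intro h
      have := hmax _ _ (Path.singleton hab).1 (Path.singleton hab).2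
      rw [Walk.length_eq_zero_iff.2 h] at this
      simp [Path.singleton] at this
    have hsnd := p.adj_snd hnil
    obtain ⟨hG, hmem⟩ := (hadj _ _).1 hsnd
    have hev := hs u
    have hin : (⟨s(u, p.snd), hG⟩ : G.edgeSet) ∈ ({e ∈ s | u ∈ e.1} : Finset _) := by
      simp [hmem]
    have hone : 1 < ({e ∈ s | u ∈ e.1} : Finset _).card := by
      have := Finset.card_pos.2 ⟨_, hin⟩
      obtain ⟨k, hk⟩ := hev
      omega
    obtain ⟨⟨f, hfG⟩, hf, hfne⟩ := Finset.exists_mem_ne hone ⟨s(u, p.snd), hG⟩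
    obtain ⟨hf1, hf2⟩ := Finset.mem_filter.1 hf
    obtain ⟨w, rfl⟩ := Sym2.mem_iff_exists.1 hf2
    have huw : H.Adj u w := (hadj _ _).2 ⟨hfG, hf1⟩
    apply hfne
    have : w = p.snd := by
      apply hac.eq_snd_of_adj_start hp huw
      have : ¬ (p.cons huw.symm).IsPath := by
        intro h
        have := hmax _ _ _ h
        simp at this
      by_contra h
      exact this (hp.cons h)
    simp [this]
  obtain ⟨u, c, hc⟩ : ∃ (u : V) (c : H.Walk u u), c.IsCycle := by
    simpa [IsAcyclic] using hcyc
  refine ⟨u, c.mapLe hle, hc.mapLe hle, fun e he => ?_⟩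
  rw [Walk.mem_edgeSubtype] at he
  have : e.1 ∈ c.edges := by simpa using he
  have := c.edges_subset_edgeSet this
  obtain ⟨e, heG⟩ := e
  induction e with | _ a b
  exact ((hadj a b).1 this).2

/-- The circuits of the cycle space are edge sets of cycles. -/
lemma exists_isCycle_of_mem_circuits [Finite V] [Fintype G.edgeSet] {s : Finset G.edgeSet}
    (hs : s ∈ circuits G.evenSets) :
    ∃ (u : V) (c : G.Walk u u), c.IsCycle ∧ c.edges.toFinset = s.image Subtype.val := by
  rw [mem_circuits] at hs
  obtain ⟨u, c, hc, hcs⟩ := exists_isCycle_edgeSubtype_subset hs.prop.1 hs.prop.2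
  refine ⟨u, c, hc, ?_⟩
  have hne : c.edgeSubtype.Nonempty := by
    rw [← Finset.image_nonempty (f := Subtype.val), c.image_edgeSubtype, List.toFinset_nonempty_iff]
    exact fun h => hc.ne_nil (Walk.edges_eq_nil.1 h).eq_nil
  rw [← c.image_edgeSubtype,
    subset_antisymm hcs (hs.le_of_le ⟨hc.isTrail.edgeSubtype_mem_evenSets, hne⟩ hcs)]

lemma rel_evenSets_of_mem {v : V} (hv : ((⊤ : G.Subgraph).deleteVerts {v}).coe.Connected)
    {e f : G.edgeSet} (he : v ∈ e.1) (hf : v ∈ f.1) : Rel G.evenSets e f := by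
  classical
  obtain ⟨e, heG⟩ := e
  obtain ⟨f, hfG⟩ := f
  obtain ⟨a, rfl⟩ := Sym2.mem_iff_exists.1 he
  obtain ⟨b, rfl⟩ := Sym2.mem_iff_exists.1 hf
  have hva : G.Adj v a := heG
  have hvb : G.Adj v b := hfG
  by_cases hab : a = b
  · subst hab; exact Rel.refl _ _
  obtain ⟨q, hq⟩ := hv.exists_isPath ⟨a, by simpa using hva.ne'⟩ ⟨b, by simpa using hvb.ne'⟩
  have hp : (q.map (Subgraph.hom _)).IsPath := hq.map Subgraph.hom_injective
  have hvp : v ∉ (q.map (Subgraph.hom _)).support := by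
    rw [Walk.support_map, List.mem_map]
    rintro ⟨x, -, hx⟩
    have := x.2
    rw [Subgraph.hom_apply] at hx
    simp [hx] at this
  revert hp hvp
  generalize q.map (Subgraph.hom _) = p
  intro hp hvp
  change G.Walk a b at p
  have hmem : ∀ x, s(v, x) ∉ p.edges := fun x hx => hvp (p.fst_mem_support_of_mem_edges hx)
  have hc : (Walk.cons hva (p.concat hvb.symm)).IsTrail := by
    rw [Walk.isTrail_cons, Walk.isTrail_def, Walk.edges_concat, List.concat_eq_append,
      List.nodup_append', Sym2.eq_swap (a := b)]
    refine ⟨⟨hp.isTrail.edges_nodup, List.nodup_singleton _, ?_⟩, ?_⟩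
    · simpa using hmem b
    · simp [hmem, hab, hvb.ne]
  intro S hS
  have h2 := hS _ hc.edgeSubtype_mem_evenSets v
  have h3 : ∀ x : G.edgeSet, (x ∈ (Walk.cons hva (p.concat hvb.symm)).edgeSubtype ∧ v ∈ x.1) ↔
      x = ⟨s(v, a), heG⟩ ∨ x = ⟨s(v, b), hfG⟩ := by
    rintro ⟨x, hx⟩
    simp only [Walk.mem_edgeSubtype, Walk.edges_cons, Walk.edges_concat, Subtype.mk.injEq]
    constructor
    · rintro ⟨h, hvx⟩
      obtain ⟨y, rfl⟩ := Sym2.mem_iff_exists.1 hvx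
      have := hmem y
      simp only [List.concat_eq_append, List.mem_cons, List.mem_append, List.not_mem_nil,
        or_false, this, false_or, Sym2.eq_swap (a := b)] at h
      exact h
    · rintro (rfl | rfl) <;> simp [Sym2.eq_swap (a := b)]
  have h4 : ({e ∈ (Walk.cons hva (p.concat hvb.symm)).edgeSubtype ∩ S | v ∈ e.1} : Finset _) =
      ({⟨s(v, a), heG⟩, ⟨s(v, b), hfG⟩} : Finset G.edgeSet) ∩ S := by
    ext x
    simp only [Finset.mem_filter, Finset.mem_inter, Finset.mem_insert, Finset.mem_singleton,
      ← h3]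
    tauto
  rw [h4] at h2
  have hne : (⟨s(v, a), heG⟩ : G.edgeSet) ≠ ⟨s(v, b), hfG⟩ := by
    simp [hab, hvb.ne]
  by_cases h5 : (⟨s(v, a), heG⟩ : G.edgeSet) ∈ S <;>
    by_cases h6 : (⟨s(v, b), hfG⟩ : G.edgeSet) ∈ S <;>
    simp_all [Finset.insert_inter_of_mem, Finset.insert_inter_of_notMem]

/-- The cycle space of a 2-connected graph is connected. -/
lemma rel_evenSets [Fintype V] (hV : 3 ≤ Fintype.card V)
    (hG : ∀ v : V, ((⊤ : G.Subgraph).deleteVerts {v}).coe.Connected) (e f : G.edgeSet) :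
    Rel G.evenSets e f := by
  have hconn : ∀ u v : V, Nonempty (G.Walk u v) := by
    intro u v
    obtain ⟨x, hx⟩ : ∃ x, x ∉ ({u, v} : Finset V) := by
      by_contra! h
      have h1 := Finset.card_le_two (a := u) (b := v)
      rw [Finset.eq_univ_of_forall h, Finset.card_univ] at h1
      omega
    simp only [Finset.mem_insert, Finset.mem_singleton, not_or] at hx
    obtain ⟨q⟩ := (hG x).preconnected ⟨u, by simpa using Ne.symm hx.1⟩
      ⟨v, by simpa using Ne.symm hx.2⟩
    exact ⟨q.map (Subgraph.hom _)⟩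
  have key : ∀ {u v : V} (_ : G.Walk u v) (e f : G.edgeSet), u ∈ e.1 → v ∈ f.1 →
      Rel G.evenSets e f := by
    intro u v p
    induction p with
    | nil => exact fun e f he hf => rel_evenSets_of_mem (hG _) he hf
    | @cons u x v h p ih =>
      intro e f he hf
      exact (rel_evenSets_of_mem (hG u) he (f := ⟨s(u, x), h⟩) (by simp)).trans
        (ih _ _ (by simp) hf)
  exact key (hconn e.1.out.1 f.1.out.1).some e f e.1.out_fst_mem f.1.out_fst_mem

end SimpleGraph

/-- Main theorem: for every `ε > 0` and all sufficiently large `n`, every `n`-vertex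
2-connected graph with no two cycles of the same length has at most
`n + (1 + ε)√n` edges. -/
theorem stmt10 (ε : ℝ) (hε : 0 < ε) :
    ∃ n0 : ℕ, ∀ n : ℕ, n0 ≤ n →
      ∀ (V : Type) [Fintype V] [DecidableEq V],
        Fintype.card V = n →
        ∀ G : SimpleGraph V,
          (3 ≤ Fintype.card V ∧
            ∀ v : V, ((⊤ : G.Subgraph).deleteVerts {v}).coe.Connected) →
          (∀ s t : Finset (Sym2 V), IsCycleSet G s → IsCycleSet G t →
            s.card = t.card → s = t) →
          (G.edgeSet.ncard : ℝ) ≤ n + (1 + ε) * Real.sqrt n := by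
  classical
  have hδ0 : 0 < min ε 1 := lt_min hε one_pos
  obtain ⟨R, hR⟩ := CycleSpace.exists_forall_sq_le hδ0 (min_le_right ε 1)
  obtain ⟨n0, hn0⟩ := exists_nat_ge (max (2 / ε) R ^ 2)
  refine ⟨n0, fun n hn V _ _ hV G ⟨hV3, hG⟩ hcyc => ?_⟩
  have hs : max (2 / ε) R ≤ √n :=
    Real.le_sqrt_of_sq_le (hn0.trans (by exact_mod_cast hn))
  rw [← Nat.card_coe_set_eq, Nat.card_eq_fintype_card]
  obtain ⟨Z, hcard, hZ⟩ := G.exists_coIndep_evenSets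
  rw [hV] at hcard
  have hinj : ∀ s ∈ CycleSpace.circuits G.evenSets, ∀ t ∈ CycleSpace.circuits G.evenSets,
      s.card = t.card → s = t := by
    intro s hs t ht hst
    apply Finset.image_injective Subtype.val_injective
    apply hcyc _ _ (SimpleGraph.exists_isCycle_of_mem_circuits hs)
      (SimpleGraph.exists_isCycle_of_mem_circuits ht)
    rwa [Finset.card_image_of_injective _ Subtype.val_injective,
      Finset.card_image_of_injective _ Subtype.val_injective]
  have hcard' : (Fintype.card G.edgeSet : ℝ) ≤ Z.card + n := by exact_mod_cast hcard
  have hsqrt := Real.sqrt_nonneg n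
  rcases lt_or_ge Z.card R with hZR | hZR
  · have h1 : (Z.card : ℝ) ≤ R := by exact_mod_cast hZR.le
    have h2 : (R : ℝ) ≤ √n := (le_max_right _ _).trans hs
    nlinarith
  rcases Nat.eq_zero_or_pos (Fintype.card G.edgeSet) with hE | hE
  · rw [hE, Nat.cast_zero]
    positivity
  have hsq := hR (Fintype.card G.edgeSet) Z.card hZR fun N y p hy hp0 hp1 hL =>
    CycleSpace.sq_card_le SimpleGraph.symmClosed_evenSets
      (SimpleGraph.rel_evenSets hV3 hG) hZ hinj hE hy hp0 hp1 hL
  have hk : (Z.card : ℝ) ≤ (1 + ε) * √n := by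
    apply CycleSpace.le_mul_of_sq_le hε
    · rw [mul_comm, ← div_le_iff₀ hε]
      exact (le_max_left _ _).trans hs
    · rw [Real.sq_sqrt (Nat.cast_nonneg n), add_comm (n : ℝ)]
      exact hsq.trans (by gcongr)
  linarith
end

section
/- For every ε > 0 and all sufficiently large n, there exists an n-vertex 2-connected graph with at least n + (1 - ε) sqrt(n) edges in which no two cycles have the same length. -/
open MeasureTheory

/-- The Fejér kernel of bandwidth `L`: the Fourier transform of `t ↦ max 0 (1 - |t| / L)`. -/
noncomputable def fejerKernel (L x : ℝ) : ℝ :=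
  ∫ t in (0 : ℝ)..L, 2 * (1 - t / L) * Real.cos (t * x)

lemma fejerKernel_mul_sq {L : ℝ} (hL : 0 < L) (x : ℝ) :
    fejerKernel L x * x ^ 2 = 2 * (1 - Real.cos (L * x)) / L := by
  rcases eq_or_ne x 0 with rfl | hx
  · simp
  have h : ∀ t ∈ Set.uIcc 0 L, HasDerivAt
      (fun t => 2 * ((1 - t / L) * Real.sin (t * x) / x - Real.cos (t * x) / (L * x ^ 2)))
      (2 * (1 - t / L) * Real.cos (t * x)) t := by
    intro t _
    have h₁ : HasDerivAt (fun t : ℝ => t * x) x t := by simpa using (hasDerivAt_id t).mul_const x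
    have h₂ : HasDerivAt (fun t : ℝ => 1 - t / L) (-(1 / L)) t := by
      simpa using ((hasDerivAt_id t).div_const L).const_sub 1
    refine ((((h₂.mul h₁.sin).div_const x).sub
      (h₁.cos.div_const (L * x ^ 2))).const_mul 2).congr_deriv ?_
    field_simp
    ring
  rw [fejerKernel, intervalIntegral.integral_eq_sub_of_hasDerivAt h
    (Continuous.intervalIntegrable (by fun_prop) _ _)]
  simp only [zero_mul, Real.sin_zero, Real.cos_zero, div_self hL.ne']
  field_simp
  ring

lemma integral_two_mul_one_sub_div {L : ℝ} (hL : 0 < L) :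
    ∫ t in (0 : ℝ)..L, 2 * (1 - t / L) = L := by
  simp [intervalIntegral.integral_div]
  field_simp
  ring

lemma fejerKernel_zero {L : ℝ} (hL : 0 < L) : fejerKernel L 0 = L := by
  simpa [fejerKernel] using integral_two_mul_one_sub_div hL

lemma fejerKernel_nonneg {L : ℝ} (hL : 0 < L) (x : ℝ) : 0 ≤ fejerKernel L x := by
  rcases eq_or_ne x 0 with rfl | hx
  · rw [fejerKernel_zero hL]; exact hL.le
  · have h := fejerKernel_mul_sq hL x
    have h₂ : 0 < x ^ 2 := by positivity
    have h₃ : 0 ≤ 2 * (1 - Real.cos (L * x)) / L := by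
      have := Real.cos_le_one (L * x)
      apply div_nonneg _ hL.le
      linarith
    rw [← h] at h₃
    exact nonneg_of_mul_nonneg_left h₃ h₂

lemma fejerKernel_mul_sq_le {L : ℝ} (hL : 0 < L) (x : ℝ) :
    fejerKernel L x * x ^ 2 ≤ 4 / L := by
  rw [fejerKernel_mul_sq hL]
  have := Real.neg_one_le_cos (L * x)
  gcongr
  linarith

lemma fejerKernel_le {L : ℝ} (hL : 0 < L) (x : ℝ) : fejerKernel L x ≤ L := by
  conv_rhs => rw [← integral_two_mul_one_sub_div hL]
  refine intervalIntegral.integral_mono_on hL.le (Continuous.intervalIntegrable (by fun_prop) _ _)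
    (Continuous.intervalIntegrable (by fun_prop) _ _) fun t ht => ?_
  have : 0 ≤ 1 - t / L := by rw [sub_nonneg, div_le_one hL]; exact ht.2
  have := Real.cos_le_one (t * x)
  nlinarith

lemma fejerKernel_le_div {L : ℝ} (hL : 0 < L) (x : ℝ) :
    fejerKernel L x ≤ (L + 4 / L) * (1 + x ^ 2)⁻¹ := by
  rw [← div_eq_mul_inv, le_div_iff₀ (by positivity)]
  linarith [fejerKernel_le hL x, fejerKernel_mul_sq_le hL x]

lemma half_le_fejerKernel {L : ℝ} (hL : 0 < L) {x : ℝ} (hx : |x| ≤ 1 / L) :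
    L / 2 ≤ fejerKernel L x := by
  have : L / 2 = ∫ t in (0 : ℝ)..L, 2 * (1 - t / L) * (1 / 2) := by
    rw [intervalIntegral.integral_mul_const, integral_two_mul_one_sub_div hL]
    ring
  rw [this]
  refine intervalIntegral.integral_mono_on hL.le (Continuous.intervalIntegrable (by fun_prop) _ _)
    (Continuous.intervalIntegrable (by fun_prop) _ _) fun t ht => ?_
  have h₁ : 0 ≤ 1 - t / L := by rw [sub_nonneg, div_le_one hL]; exact ht.2
  have h₂ : |t * x| ≤ 1 := by
    rw [abs_mul, abs_of_nonneg ht.1]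
    calc t * |x| ≤ L * (1 / L) := by gcongr; exact ht.2
      _ = 1 := by field_simp
  have h₃ : (t * x) ^ 2 ≤ 1 := (sq_le_one_iff_abs_le_one _).2 h₂
  have := Real.one_sub_sq_div_two_le_cos (x := t * x)
  gcongr
  linarith

lemma continuous_fejerKernel (L : ℝ) : Continuous (fejerKernel L) := by
  unfold fejerKernel
  apply intervalIntegral.continuous_parametric_intervalIntegral_of_continuous'
  fun_prop

lemma le_fejerKernel_one_add (x : ℝ) :
    (1 - Real.cos (1 / 2)) * (1 + x ^ 2)⁻¹ ≤ fejerKernel 1 x + fejerKernel 1 (x + 1) := by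
  rw [← div_eq_mul_inv, div_le_iff₀ (by positivity)]
  have h₁ := fejerKernel_mul_sq one_pos x
  have h₂ := fejerKernel_mul_sq one_pos (x + 1)
  have h₃ := fejerKernel_nonneg one_pos x
  have h₄ := fejerKernel_nonneg one_pos (x + 1)
  have h₅ : Real.cos x + Real.cos (x + 1) = 2 * Real.cos (x + 1 / 2) * Real.cos (1 / 2) := by
    rw [Real.cos_add_cos, show (x + (x + 1)) / 2 = x + 1 / 2 by ring,
      show (x - (x + 1)) / 2 = -(1 / 2) by ring, Real.cos_neg]
  have h₆ := Real.cos_le_one (x + 1 / 2)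
  have h₇ : 0 ≤ Real.cos (1 / 2) :=
    Real.cos_nonneg_of_neg_pi_div_two_le_of_le (by linarith [Real.pi_gt_three])
      (by linarith [Real.pi_gt_three])
  simp only [one_mul, div_one] at h₁ h₂
  nlinarith [mul_nonneg h₃ (show 0 ≤ 2 + x ^ 2 by positivity),
    mul_nonneg h₄ (sq_nonneg (x - 1)), mul_nonneg (sub_nonneg.2 h₆) h₇]

lemma integral_one_sub_abs_mul_exp {L : ℝ} (hL : 0 < L) (x : ℝ) :
    ∫ t in (-L)..L, ((1 - |t| / L : ℝ) : ℂ) * Complex.exp (t * x * Complex.I) =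
      (fejerKernel L x : ℂ) := by
  have hc : Continuous fun t : ℝ =>
      ((1 - |t| / L : ℝ) : ℂ) * Complex.exp (t * x * Complex.I) := by fun_prop
  rw [← intervalIntegral.integral_add_adjacent_intervals (b := 0)
    (hc.intervalIntegrable _ _) (hc.intervalIntegrable _ _)]
  have h := intervalIntegral.integral_comp_neg (a := 0) (b := L) (fun t : ℝ =>
      ((1 - |t| / L : ℝ) : ℂ) * Complex.exp (t * x * Complex.I))
  rw [neg_zero] at h
  rw [← h, ← intervalIntegral.integral_add (Continuous.intervalIntegrable (by fun_prop) _ _)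
    (Continuous.intervalIntegrable (by fun_prop) _ _), fejerKernel,
    ← intervalIntegral.integral_ofReal]
  refine intervalIntegral.integral_congr fun t ht => ?_
  rw [Set.uIcc_of_le hL.le] at ht
  simp only [abs_neg, abs_of_nonneg ht.1]
  push_cast
  rw [Complex.cos]
  ring_nf

open ArithmeticFunction in
lemma exists_continuousOn_eq_LSeries_vonMangoldt_sub :
    ∃ G : ℂ → ℂ, ContinuousOn G {s | 1 ≤ s.re} ∧
      ∀ s : ℂ, 1 < s.re → G s = LSeries (fun n => (vonMangoldt n : ℂ)) s - 1 / (s - 1) := by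
  refine ⟨_, vonMangoldt.continuousOn_LFunctionResidueClassAux (1 : ZMod 1), fun s hs => ?_⟩
  rw [vonMangoldt.eqOn_LFunctionResidueClassAux isUnit_one hs]
  have h : vonMangoldt.residueClass (1 : ZMod 1) = fun n => vonMangoldt n := by
    funext n
    exact Set.indicator_of_mem (s := {n : ℕ | (n : ZMod 1) = 1}) (Subsingleton.elim _ _)
      (fun n => vonMangoldt n)
  simp [h]

lemma LSeries_term_vonMangoldt (σ t : ℝ) (n : ℕ) :
    LSeries.term (fun n => (ArithmeticFunction.vonMangoldt n : ℂ)) (σ + t * Complex.I) n =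
      (ArithmeticFunction.vonMangoldt n * (n : ℝ) ^ (-σ) : ℝ) *
        Complex.exp (-(t * Real.log n * Complex.I)) := by
  rcases eq_or_ne n 0 with rfl | hn
  · simp
  have hn' : (n : ℂ) ≠ 0 := mod_cast hn
  rw [LSeries.term_of_ne_zero hn, div_eq_mul_inv, ← Complex.cpow_neg, neg_add,
    Complex.cpow_add _ _ hn', Complex.ofReal_mul, Complex.ofReal_cpow n.cast_nonneg, mul_assoc,
    Complex.cpow_def_of_ne_zero hn' (-(t * Complex.I))]
  push_cast
  ring_nf

lemma summable_vonMangoldt_mul_rpow {σ : ℝ} (hσ : 1 < σ) :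
    Summable fun n : ℕ => ArithmeticFunction.vonMangoldt n * (n : ℝ) ^ (-σ) := by
  have h := ArithmeticFunction.LSeriesSummable_vonMangoldt (s := σ) (by simpa using hσ)
  rw [LSeriesSummable, ← summable_norm_iff] at h
  refine h.congr fun n => ?_
  have := LSeries_term_vonMangoldt σ 0 n
  simp only [Complex.ofReal_zero, zero_mul, add_zero, neg_zero, Complex.exp_zero, mul_one] at this
  rw [this, Complex.norm_real, Real.norm_of_nonneg]
  have := ArithmeticFunction.vonMangoldt_nonneg (n := n)
  positivity

lemma norm_one_sub_abs_div_le {L t : ℝ} (hL : 0 < L) (ht : t ∈ Set.uIoc (-L) L) :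
    ‖((1 - |t| / L : ℝ) : ℂ)‖ ≤ 1 := by
  rw [Set.uIoc_of_le (by linarith)] at ht
  have h : |t| ≤ L := abs_le.2 ⟨ht.1.le, ht.2⟩
  rw [Complex.norm_real, Real.norm_eq_abs, abs_le]
  have h₁ : |t| / L ≤ 1 := (div_le_one hL).2 h
  have h₂ : 0 ≤ |t| / L := by positivity
  constructor <;> linarith

lemma hasSum_vonMangoldt_mul_fejerKernel {L σ : ℝ} (hL : 0 < L) (hσ : 1 < σ) (u : ℝ) :
    HasSum (fun n : ℕ => ((ArithmeticFunction.vonMangoldt n * (n : ℝ) ^ (-σ) *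
        fejerKernel L (u - Real.log n) : ℝ) : ℂ))
      (∫ t in (-L)..L, ((1 - |t| / L : ℝ) : ℂ) * Complex.exp (t * u * Complex.I) *
        LSeries (fun n => (ArithmeticFunction.vonMangoldt n : ℂ)) (σ + t * Complex.I)) := by
  have key : ∀ (n : ℕ) (t : ℝ), ((1 - |t| / L : ℝ) : ℂ) * Complex.exp (t * u * Complex.I) *
      LSeries.term (fun n => (ArithmeticFunction.vonMangoldt n : ℂ)) (σ + t * Complex.I) n =
      (ArithmeticFunction.vonMangoldt n * (n : ℝ) ^ (-σ) : ℝ) * (((1 - |t| / L : ℝ) : ℂ) *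
        Complex.exp (t * (u - Real.log n : ℝ) * Complex.I)) := by
    intro n t
    have : (t * (u - Real.log n : ℝ) * Complex.I : ℂ) =
        t * u * Complex.I + -(t * Real.log n * Complex.I) := by push_cast; ring
    rw [LSeries_term_vonMangoldt, this, Complex.exp_add]
    ring
  have h := intervalIntegral.hasSum_integral_of_dominated_convergence (μ := volume)
    (a := -L) (b := L)
    (F := fun (n : ℕ) (t : ℝ) => ((1 - |t| / L : ℝ) : ℂ) * Complex.exp (t * u * Complex.I) *
      LSeries.term (fun n => (ArithmeticFunction.vonMangoldt n : ℂ)) (σ + t * Complex.I) n)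
    (f := fun t : ℝ => ((1 - |t| / L : ℝ) : ℂ) * Complex.exp (t * u * Complex.I) *
      LSeries (fun n => (ArithmeticFunction.vonMangoldt n : ℂ)) (σ + t * Complex.I))
    (fun n _ => ArithmeticFunction.vonMangoldt n * (n : ℝ) ^ (-σ)) ?_ ?_ ?_ ?_ ?_
  · refine h.congr_fun ?_
    intro n
    simp only [key]
    rw [intervalIntegral.integral_const_mul, integral_one_sub_abs_mul_exp hL]
    push_cast
    ring
  · intro n
    simp only [key]
    exact Continuous.aestronglyMeasurable (by fun_prop)
  · intro n
    refine Filter.Eventually.of_forall fun t ht => ?_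
    have hn : 0 ≤ ArithmeticFunction.vonMangoldt n * (n : ℝ) ^ (-σ) :=
      mul_nonneg ArithmeticFunction.vonMangoldt_nonneg (by positivity)
    rw [key, norm_mul, norm_mul, Complex.norm_real, Real.norm_of_nonneg hn,
      ← Complex.ofReal_mul, Complex.norm_exp_ofReal_mul_I, mul_one]
    exact mul_le_of_le_one_right hn (norm_one_sub_abs_div_le hL ht)
  · exact Filter.Eventually.of_forall fun t _ => summable_vonMangoldt_mul_rpow hσ
  · exact intervalIntegrable_const
  · refine Filter.Eventually.of_forall fun t _ => ?_
    refine HasSum.mul_left _ ?_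
    exact (ArithmeticFunction.LSeriesSummable_vonMangoldt (by simpa using hσ)).hasSum

lemma integral_one_sub_abs_mul_exp_div {L σ : ℝ} (hL : 0 < L) (hσ : 1 < σ) (u : ℝ) :
    ∫ t in (-L)..L, ((1 - |t| / L : ℝ) : ℂ) * Complex.exp (t * u * Complex.I) *
        (1 / (σ + t * Complex.I - 1)) =
      ((∫ v in Set.Ioi (0 : ℝ), Real.exp (-(σ - 1) * v) * fejerKernel L (u - v) : ℝ) : ℂ) := by
  have h₁ : ∀ t : ℝ, ((1 - |t| / L : ℝ) : ℂ) * Complex.exp (t * u * Complex.I) *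
        (1 / (σ + t * Complex.I - 1)) = ∫ v in Set.Ioi (0 : ℝ), ((1 - |t| / L : ℝ) : ℂ) *
          Complex.exp (t * u * Complex.I) * Complex.exp (-(σ + t * Complex.I - 1) * v) := by
    intro t
    rw [integral_const_mul, integral_exp_mul_complex_Ioi (by simpa using hσ)]
    rw [Complex.ofReal_zero, mul_zero, Complex.exp_zero, neg_div_neg_eq]
  simp only [h₁]
  rw [intervalIntegral_integral_swap, ← integral_complex_ofReal]
  · refine integral_congr_ae (Filter.Eventually.of_forall fun v => ?_)
    simp only [Complex.ofReal_mul]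
    rw [← integral_one_sub_abs_mul_exp hL, ← intervalIntegral.integral_const_mul]
    refine intervalIntegral.integral_congr fun t _ => ?_
    rw [mul_assoc, ← Complex.exp_add, mul_left_comm]
    congr 1
    push_cast
    rw [← Complex.exp_add]
    ring_nf
  · have hb : Integrable (fun z : ℝ × ℝ => (1 : ℝ) * Real.exp (-(σ - 1) * z.2))
        ((volume.restrict (Set.uIoc (-L) L)).prod (volume.restrict (Set.Ioi 0))) := by
      refine Integrable.mul_prod (f := fun _ => (1 : ℝ)) ?_
        (integrableOn_exp_mul_Ioi (by linarith) 0)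
      rw [Set.uIoc]
      exact integrable_const _
    refine hb.mono' (Continuous.aestronglyMeasurable (by fun_prop)) ?_
    rw [Measure.prod_restrict]
    refine ae_restrict_of_forall_mem (measurableSet_uIoc.prod measurableSet_Ioi) ?_
    rintro ⟨t, v⟩ ⟨ht, -⟩
    simp only [Function.uncurry, norm_mul]
    rw [← Complex.ofReal_mul, Complex.norm_exp_ofReal_mul_I, mul_one, Complex.norm_exp]
    gcongr
    · exact norm_one_sub_abs_div_le hL ht
    · simp

/-- The sum of `Λ(n) n ^ (-σ)` weighted by the Fejér kernel centred at `u` on the logarithmic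
scale. -/
noncomputable def fejerSum (L σ u : ℝ) : ℝ :=
  ∑' n : ℕ, ArithmeticFunction.vonMangoldt n * (n : ℝ) ^ (-σ) * fejerKernel L (u - Real.log n)

lemma vonMangoldt_mul_rpow_nonneg (σ : ℝ) (n : ℕ) :
    0 ≤ ArithmeticFunction.vonMangoldt n * (n : ℝ) ^ (-σ) :=
  mul_nonneg ArithmeticFunction.vonMangoldt_nonneg (by positivity)

lemma summable_vonMangoldt_mul_fejerKernel {L σ : ℝ} (hL : 0 < L) (hσ : 1 < σ) (u : ℝ) :
    Summable fun n : ℕ => ArithmeticFunction.vonMangoldt n * (n : ℝ) ^ (-σ) *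
      fejerKernel L (u - Real.log n) :=
  Complex.summable_ofReal.1 (hasSum_vonMangoldt_mul_fejerKernel hL hσ u).summable

lemma integrable_fejerKernel_sub {L : ℝ} (hL : 0 < L) (u : ℝ) :
    Integrable fun v => fejerKernel L (u - v) := by
  have h : Integrable (fejerKernel L) := by
    refine (integrable_inv_one_add_sq.const_mul (L + 4 / L)).mono'
      (continuous_fejerKernel L).aestronglyMeasurable (Filter.Eventually.of_forall fun x => ?_)
    rw [Real.norm_of_nonneg (fejerKernel_nonneg hL x)]
    exact fejerKernel_le_div hL x
  exact h.comp_sub_left u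

lemma integral_fejerKernel_sub_le {L : ℝ} (hL : 0 < L) (u : ℝ) :
    ∫ v, fejerKernel L (u - v) ≤ (L + 4 / L) * Real.pi := by
  rw [integral_sub_left_eq_self (fejerKernel L) volume u, ← integral_univ_inv_one_add_sq,
    ← integral_const_mul]
  refine integral_mono ?_ (integrable_inv_one_add_sq.const_mul _) (fejerKernel_le_div hL)
  simpa using (integrable_fejerKernel_sub hL 0).comp_neg

lemma exp_mul_fejerKernel_le {L σ : ℝ} (hL : 0 < L) (hσ : 1 < σ) (u : ℝ) {v : ℝ} (hv : 0 < v) :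
    Real.exp (-(σ - 1) * v) * fejerKernel L (u - v) ≤ fejerKernel L (u - v) := by
  refine mul_le_of_le_one_left (fejerKernel_nonneg hL _) (Real.exp_le_one_iff.2 ?_)
  nlinarith

lemma integrableOn_exp_mul_fejerKernel {L σ : ℝ} (hL : 0 < L) (hσ : 1 < σ) (u : ℝ) :
    IntegrableOn (fun v => Real.exp (-(σ - 1) * v) * fejerKernel L (u - v)) (Set.Ioi 0) := by
  refine (integrable_fejerKernel_sub hL u).integrableOn.mono' ?_ ?_
  · have := continuous_fejerKernel L
    exact Continuous.aestronglyMeasurable (by fun_prop)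
  · refine ae_restrict_of_forall_mem measurableSet_Ioi fun v hv => ?_
    rw [Real.norm_of_nonneg (mul_nonneg (Real.exp_nonneg _) (fejerKernel_nonneg hL _))]
    exact exp_mul_fejerKernel_le hL hσ u hv

lemma integral_exp_mul_fejerKernel_le {L σ : ℝ} (hL : 0 < L) (hσ : 1 < σ) (u : ℝ) :
    ∫ v in Set.Ioi (0 : ℝ), Real.exp (-(σ - 1) * v) * fejerKernel L (u - v) ≤
      (L + 4 / L) * Real.pi := by
  refine le_trans ?_ (integral_fejerKernel_sub_le hL u)
  refine le_trans ?_ (setIntegral_le_integral (s := Set.Ioi 0) (integrable_fejerKernel_sub hL u)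
    (Filter.Eventually.of_forall fun v => fejerKernel_nonneg hL _))
  exact setIntegral_mono_on (integrableOn_exp_mul_fejerKernel hL hσ u)
    (integrable_fejerKernel_sub hL u).integrableOn measurableSet_Ioi
    fun v hv => exp_mul_fejerKernel_le hL hσ u hv

lemma exp_le_integral_exp_mul_fejerKernel {L σ u : ℝ} (hL : 0 < L) (hσ : 1 < σ)
    (hu : 1 / L < u) :
    Real.exp (-(σ - 1) * (u + 1 / L)) ≤
      ∫ v in Set.Ioi (0 : ℝ), Real.exp (-(σ - 1) * v) * fejerKernel L (u - v) := by
  have hL' : 0 < 1 / L := by positivity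
  have hsub : Set.Ioc (u - 1 / L) (u + 1 / L) ⊆ Set.Ioi 0 := fun v hv => by
    have := hv.1
    simp only [Set.mem_Ioi]
    linarith
  refine le_trans ?_ (setIntegral_mono_set (integrableOn_exp_mul_fejerKernel hL hσ u)
    (Filter.Eventually.of_forall fun v => mul_nonneg (Real.exp_nonneg _) (fejerKernel_nonneg hL _))
    hsub.eventuallyLE)
  have hc : Real.exp (-(σ - 1) * (u + 1 / L)) =
      ∫ v in Set.Ioc (u - 1 / L) (u + 1 / L), Real.exp (-(σ - 1) * (u + 1 / L)) * (L / 2) := by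
    rw [setIntegral_const, Measure.real, Real.volume_Ioc, ENNReal.toReal_ofReal (by linarith)]
    simp only [smul_eq_mul]
    field_simp
    ring
  rw [hc]
  refine setIntegral_mono_on continuous_const.integrableOn_Ioc
    ((integrableOn_exp_mul_fejerKernel hL hσ u).mono_set hsub)
    measurableSet_Ioc fun v hv => ?_
  have h₁ := hv.1
  have h₂ := hv.2
  refine mul_le_mul (Real.exp_le_exp.2 ?_) (half_le_fejerKernel hL ?_) (by positivity)
    (Real.exp_nonneg _)
  · nlinarith
  · rw [abs_le]
    constructor <;> linarith

lemma fejerSum_sub_integral {G : ℂ → ℂ} (hG : ContinuousOn G {s | 1 ≤ s.re})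
    (hGs : ∀ s : ℂ, 1 < s.re →
      G s = LSeries (fun n => (ArithmeticFunction.vonMangoldt n : ℂ)) s - 1 / (s - 1))
    {L σ : ℝ} (hL : 0 < L) (hσ : 1 < σ) (u : ℝ) :
    ((fejerSum L σ u - ∫ v in Set.Ioi (0 : ℝ),
      Real.exp (-(σ - 1) * v) * fejerKernel L (u - v) : ℝ) : ℂ) =
    ∫ t in (-L)..L, ((1 - |t| / L : ℝ) : ℂ) * Complex.exp (t * u * Complex.I) *
      G (σ + t * Complex.I) := by
  have h₁ := (hasSum_vonMangoldt_mul_fejerKernel hL hσ u).tsum_eq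
  have h₂ := integral_one_sub_abs_mul_exp_div hL hσ u
  rw [Complex.ofReal_sub, fejerSum, Complex.ofReal_tsum, h₁, ← h₂, sub_eq_iff_eq_add,
    ← intervalIntegral.integral_add]
  · refine intervalIntegral.integral_congr fun t _ => ?_
    rw [hGs _ (by simpa using hσ)]
    ring
  · refine ContinuousOn.intervalIntegrable (ContinuousOn.mul (by fun_prop) ?_)
    exact hG.comp (by fun_prop) fun t _ => by simpa using hσ.le
  · refine Continuous.intervalIntegrable (Continuous.mul (by fun_prop) ?_) _ _
    refine Continuous.div (by fun_prop) (by fun_prop) fun t h => ?_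
    have := congrArg Complex.re h
    simp at this
    linarith

lemma exists_norm_le_of_continuousOn {G : ℂ → ℂ} (hG : ContinuousOn G {s | 1 ≤ s.re}) (L : ℝ) :
    ∃ C : ℝ, ∀ σ ∈ Set.Icc (1 : ℝ) 2, ∀ t ∈ Set.Icc (-L) L, ‖G (σ + t * Complex.I)‖ ≤ C := by
  have hc : ContinuousOn (fun z : ℝ × ℝ => G (z.1 + z.2 * Complex.I))
      (Set.Icc (1 : ℝ) 2 ×ˢ Set.Icc (-L) L) :=
    hG.comp (by fun_prop) fun z hz => by simpa using hz.1.1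
  obtain ⟨C, hC⟩ := (isCompact_Icc.prod isCompact_Icc).exists_bound_of_continuousOn hc
  exact ⟨C, fun σ hσ t ht => hC (σ, t) ⟨hσ, ht⟩⟩

lemma exists_fejerSum_le : ∃ C : ℝ, ∀ σ ∈ Set.Ioc (1 : ℝ) 2, ∀ u : ℝ, fejerSum 1 σ u ≤ C := by
  obtain ⟨G, hG, hGs⟩ := exists_continuousOn_eq_LSeries_vonMangoldt_sub
  obtain ⟨C, hC⟩ := exists_norm_le_of_continuousOn hG 1
  refine ⟨C * |1 - -1| + (1 + 4 / 1) * Real.pi, fun σ hσ u => ?_⟩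
  have h₁ := fejerSum_sub_integral hG hGs one_pos hσ.1 u
  have h₂ := integral_exp_mul_fejerKernel_le one_pos hσ.1 u
  have h₃ := intervalIntegral.norm_integral_le_of_norm_le_const (a := -1) (b := 1) (C := C)
    (f := fun t : ℝ => ((1 - |t| / 1 : ℝ) : ℂ) * Complex.exp (t * u * Complex.I) *
      G (σ + t * Complex.I)) fun t ht => by
    rw [norm_mul, norm_mul, ← Complex.ofReal_mul, Complex.norm_exp_ofReal_mul_I, mul_one]
    have h := norm_one_sub_abs_div_le one_pos ht
    rw [Set.uIoc_of_le (by norm_num)] at ht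
    exact (mul_le_of_le_one_left (norm_nonneg _) h).trans
      (hC σ (Set.Ioc_subset_Icc_self hσ) t (Set.Ioc_subset_Icc_self ht))
  rw [← h₁, Complex.norm_real, Real.norm_eq_abs] at h₃
  exact (sub_le_iff_le_add.1 ((le_abs_self _).trans h₃)).trans (by gcongr)

lemma summable_vonMangoldt_mul_inv {σ : ℝ} (hσ : 1 < σ) (u : ℝ) :
    Summable fun n : ℕ => ArithmeticFunction.vonMangoldt n * (n : ℝ) ^ (-σ) *
      (1 + (u - Real.log n) ^ 2)⁻¹ := by
  refine (summable_vonMangoldt_mul_rpow hσ).of_nonneg_of_le (fun n => ?_) fun n => ?_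
  · have := vonMangoldt_mul_rpow_nonneg σ n
    positivity
  · refine mul_le_of_le_one_right (vonMangoldt_mul_rpow_nonneg σ n) (inv_le_one_of_one_le₀ ?_)
    linarith [sq_nonneg (u - Real.log n)]

lemma exists_tsum_vonMangoldt_mul_inv_le : ∃ C : ℝ, ∀ σ ∈ Set.Ioc (1 : ℝ) 2, ∀ u : ℝ,
    ∑' n : ℕ, ArithmeticFunction.vonMangoldt n * (n : ℝ) ^ (-σ) *
      (1 + (u - Real.log n) ^ 2)⁻¹ ≤ C := by
  obtain ⟨C, hC⟩ := exists_fejerSum_le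
  have hpos : 0 < 1 - Real.cos (1 / 2) := by
    have h := Real.cos_lt_cos_of_nonneg_of_le_pi_div_two (x := 0) (y := 1 / 2) le_rfl
      (by linarith [Real.pi_gt_three]) (by norm_num)
    rw [Real.cos_zero] at h
    linarith
  refine ⟨2 * C / (1 - Real.cos (1 / 2)), fun σ hσ u => ?_⟩
  rw [le_div_iff₀ hpos, mul_comm, ← tsum_mul_left]
  have h₁ := summable_vonMangoldt_mul_fejerKernel one_pos hσ.1 u
  have h₂ := summable_vonMangoldt_mul_fejerKernel one_pos hσ.1 (u + 1)
  calc _ ≤ ∑' n : ℕ, (ArithmeticFunction.vonMangoldt n * (n : ℝ) ^ (-σ) *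
        fejerKernel 1 (u - Real.log n) + ArithmeticFunction.vonMangoldt n * (n : ℝ) ^ (-σ) *
        fejerKernel 1 (u + 1 - Real.log n)) := by
        refine Summable.tsum_le_tsum (fun n => ?_)
          ((summable_vonMangoldt_mul_inv hσ.1 u).mul_left _) (h₁.add h₂)
        rw [← mul_add, mul_left_comm, show u + 1 - Real.log n = u - Real.log n + 1 by ring]
        exact mul_le_mul_of_nonneg_left (le_fejerKernel_one_add _)
          (vonMangoldt_mul_rpow_nonneg σ n)
    _ = fejerSum 1 σ u + fejerSum 1 σ (u + 1) := h₁.tsum_add h₂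
    _ ≤ 2 * C := by linarith [hC σ hσ u, hC σ hσ (u + 1)]

lemma tendsto_integral_boundary {G : ℂ → ℂ} {L : ℝ} (hL : 0 < L) :
    Filter.Tendsto (fun u : ℝ => ∫ t in (-L)..L, ((1 - |t| / L : ℝ) : ℂ) *
      Complex.exp (t * u * Complex.I) * G (1 + t * Complex.I)) Filter.atTop (nhds 0) := by
  have h := Real.tendsto_integral_exp_smul_cocompact ((Set.Ioc (-L) L).indicator
    fun t : ℝ => ((1 - |t| / L : ℝ) : ℂ) * G (1 + t * Complex.I))
  have hu : Filter.Tendsto (fun u : ℝ => -(u / (2 * Real.pi))) Filter.atTop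
      (Filter.cocompact ℝ) :=
    (Filter.tendsto_neg_atTop_atBot.comp
      (Filter.tendsto_id.atTop_div_const (by positivity))).mono_right atBot_le_cocompact
  refine (h.comp hu).congr fun u => ?_
  rw [intervalIntegral.integral_of_le (by linarith), ← integral_indicator measurableSet_Ioc]
  refine integral_congr_ae (Filter.Eventually.of_forall fun t => ?_)
  simp only [Set.indicator_apply]
  split_ifs with ht
  · rw [Circle.smul_def, Real.fourierChar_apply, smul_eq_mul]
    have : ((2 * Real.pi * -(t * -(u / (2 * Real.pi))) : ℝ) : ℂ) = t * u := by
      rw [← Complex.ofReal_mul]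
      congr 1
      field_simp
    rw [this]
    ring
  · simp

lemma tendsto_integral_boundary_left {G : ℂ → ℂ} (hG : ContinuousOn G {s | 1 ≤ s.re}) {L : ℝ}
    (hL : 0 < L) (u : ℝ) :
    Filter.Tendsto (fun σ : ℝ => ∫ t in (-L)..L, ((1 - |t| / L : ℝ) : ℂ) *
      Complex.exp (t * u * Complex.I) * G (σ + t * Complex.I)) (nhdsWithin 1 (Set.Ioc 1 2))
      (nhds (∫ t in (-L)..L, ((1 - |t| / L : ℝ) : ℂ) *
      Complex.exp (t * u * Complex.I) * G (1 + t * Complex.I))) := by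
  obtain ⟨C, hC⟩ := exists_norm_le_of_continuousOn hG L
  refine intervalIntegral.tendsto_integral_filter_of_dominated_convergence (fun _ => C) ?_ ?_
    intervalIntegrable_const ?_
  · filter_upwards [self_mem_nhdsWithin] with σ hσ
    have : Continuous fun t : ℝ => G (σ + t * Complex.I) :=
      hG.comp_continuous (by fun_prop) fun t => by simpa using hσ.1.le
    exact (Continuous.mul (by fun_prop) this).aestronglyMeasurable
  · filter_upwards [self_mem_nhdsWithin] with σ hσ
    refine Filter.Eventually.of_forall fun t ht => ?_
    rw [norm_mul, norm_mul, ← Complex.ofReal_mul, Complex.norm_exp_ofReal_mul_I, mul_one]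
    have h := norm_one_sub_abs_div_le hL ht
    rw [Set.uIoc_of_le (by linarith)] at ht
    exact (mul_le_of_le_one_left (norm_nonneg _) h).trans
      (hC σ (Set.Ioc_subset_Icc_self hσ) t (Set.Ioc_subset_Icc_self ht))
  · refine Filter.Eventually.of_forall fun t _ => Filter.Tendsto.const_mul _ ?_
    have h₁ : ContinuousWithinAt G {s | 1 ≤ s.re} (1 + t * Complex.I) := hG _ (by simp)
    refine h₁.tendsto.comp (tendsto_nhdsWithin_iff.2 ⟨?_, ?_⟩)
    · have : Continuous fun σ : ℝ => (σ + t * Complex.I : ℂ) := by fun_prop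
      simpa using (this.tendsto 1).mono_left nhdsWithin_le_nhds
    · filter_upwards [self_mem_nhdsWithin] with σ hσ
      simpa using hσ.1.le

/-- Every multiplicative window of fixed relative length contains a prime power, once it is far
enough out. -/
theorem exists_isPrimePow_abs_log_sub_le {δ : ℝ} (hδ : 0 < δ) :
    ∀ᶠ u : ℝ in Filter.atTop, ∃ q : ℕ, IsPrimePow q ∧ |u - Real.log q| ≤ δ := by
  obtain ⟨G, hG, hGs⟩ := exists_continuousOn_eq_LSeries_vonMangoldt_sub
  obtain ⟨C, hC⟩ := exists_tsum_vonMangoldt_mul_inv_le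
  obtain ⟨L, hL, hLC⟩ : ∃ L : ℝ, 0 < L ∧ 4 / L * (1 + 1 / δ ^ 2) * C ≤ 1 / 2 := by
    refine ⟨8 * (1 + 1 / δ ^ 2) * (|C| + 1), by positivity, ?_⟩
    rw [div_mul_eq_mul_div, div_mul_eq_mul_div, div_le_iff₀ (by positivity)]
    have : 0 < 1 + 1 / δ ^ 2 := by positivity
    nlinarith [le_abs_self C]
  filter_upwards [(tendsto_integral_boundary (G := G) hL).norm.eventually
    (gt_mem_nhds (show ‖(0 : ℂ)‖ < 1 / 4 by norm_num)), Filter.eventually_gt_atTop (1 / L)]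
    with u hu₁ hu₂
  by_contra! hq
  have hsum : ∀ σ ∈ Set.Ioc (1 : ℝ) 2, fejerSum L σ u ≤ 1 / 2 := by
    intro σ hσ
    refine le_trans ?_ hLC
    refine le_trans ?_ (mul_le_mul_of_nonneg_left (hC σ hσ u) (by positivity))
    rw [← tsum_mul_left]
    refine Summable.tsum_le_tsum (fun n => ?_) (summable_vonMangoldt_mul_fejerKernel hL hσ.1 u)
      ((summable_vonMangoldt_mul_inv hσ.1 u).mul_left _)
    by_cases hn : IsPrimePow n
    · rw [mul_left_comm]
      refine mul_le_mul_of_nonneg_left ?_ (vonMangoldt_mul_rpow_nonneg σ n)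
      have h₁ : δ ^ 2 ≤ (u - Real.log n) ^ 2 := by
        rw [← sq_abs (u - Real.log n)]
        have := (hq n hn).le
        gcongr
      have h₂ := fejerKernel_mul_sq_le hL (u - Real.log n)
      set x := u - Real.log n
      have hx : 0 < x ^ 2 := lt_of_lt_of_le (by positivity) h₁
      rw [← le_div_iff₀ hx] at h₂
      refine h₂.trans ?_
      rw [div_eq_mul_inv, mul_assoc]
      refine mul_le_mul_of_nonneg_left ?_ (by positivity)
      rw [← div_eq_mul_inv, le_div_iff₀ (by positivity), inv_mul_eq_div, div_le_iff₀ hx]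
      have : x ^ 2 / δ ^ 2 ≥ 1 := (one_le_div (by positivity)).2 h₁
      have h₃ : (1 + 1 / δ ^ 2) * x ^ 2 = x ^ 2 + x ^ 2 / δ ^ 2 := by ring
      linarith
    · simp [ArithmeticFunction.vonMangoldt_eq_zero_iff.2 hn]
  have hlim := (tendsto_integral_boundary_left hG hL u).norm.eventually (gt_mem_nhds hu₁)
  have hexp : ∀ᶠ σ : ℝ in nhdsWithin 1 (Set.Ioc 1 2),
      3 / 4 < Real.exp (-(σ - 1) * (u + 1 / L)) := by
    have h : Continuous fun σ : ℝ => Real.exp (-(σ - 1) * (u + 1 / L)) := by fun_prop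
    refine ((h.tendsto 1).mono_left nhdsWithin_le_nhds).eventually (lt_mem_nhds ?_)
    norm_num
  have : (nhdsWithin (1 : ℝ) (Set.Ioc 1 2)).NeBot := by
    rw [nhdsWithin_Ioc_eq_nhdsGT one_lt_two]
    infer_instance
  obtain ⟨σ, h₁, h₂, hσ⟩ := (hlim.and (hexp.and self_mem_nhdsWithin)).exists
  rw [← fejerSum_sub_integral hG hGs hL hσ.1 u, Complex.norm_real, Real.norm_eq_abs, abs_lt] at h₁
  linarith [hsum σ hσ, exp_le_integral_exp_mul_fejerKernel hL hσ.1 hu₂, h₁.1]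

/-- A finite set of elements of an additive monoid is a *Sidon set* if the sums of two of its
elements are distinct up to the order of the summands. -/
def IsSidonFinset {M : Type*} [Add M] (A : Finset M) : Prop :=
  ∀ a ∈ A, ∀ b ∈ A, ∀ c ∈ A, ∀ d ∈ A, a + b = c + d → (a = c ∧ b = d) ∨ (a = d ∧ b = c)

lemma exists_forall_algebraMap_add_eq_zero {F K : Type*} [Field F] [Field K] [Algebra F K]
    [Finite K] (h3 : Module.finrank F K = 3) :
    ∃ θ : K, ∀ x y z : F, algebraMap F K x + algebraMap F K y * θ + algebraMap F K z * θ ^ 2 = 0 →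
      x = 0 ∧ y = 0 ∧ z = 0 := by
  have : Finite F := Finite.of_injective _ (algebraMap F K).injective
  have : FiniteDimensional F K := Module.finite_of_finrank_pos (by omega)
  let pb := Field.powerBasisOfFiniteOfSeparable F K
  have hd : pb.dim = 3 := by rw [← pb.finrank, h3]
  have hli := pb.basis.linearIndependent
  rw [pb.coe_basis] at hli
  have hli' : LinearIndependent F (fun i : Fin 3 => pb.gen ^ (i : ℕ)) :=
    hli.comp (Fin.cast hd.symm) (Fin.cast_injective _)
  refine ⟨pb.gen, fun x y z h => ?_⟩
  have h' := Fintype.linearIndependent_iff.1 hli' ![x, y, z] (by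
    simpa [Fin.sum_univ_three, Algebra.smul_def] using h)
  exact ⟨h' 0, h' 1, h' 2⟩

/-- The affine forms `1` and `θ + x` enumerating the points of the projective line spanned by
`1` and `θ`. -/
def lineForm {F K : Type*} [Field F] [Field K] [Algebra F K] (θ : K) : Option F → K
  | none => 1
  | some x => θ + algebraMap F K x

lemma lineForm_mul_eq {F K : Type*} [Field F] [Field K] [Algebra F K] {θ : K}
    (hθ : ∀ x y z : F, algebraMap F K x + algebraMap F K y * θ + algebraMap F K z * θ ^ 2 = 0 →
      x = 0 ∧ y = 0 ∧ z = 0) {a b c d : Option F} {r : F} (hr : r ≠ 0)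
    (h : lineForm θ a * lineForm θ b = algebraMap F K r * (lineForm θ c * lineForm θ d)) :
    (a = c ∧ b = d) ∨ (a = d ∧ b = c) := by
  let α : Option F → F := fun a => a.elim 0 fun _ => 1
  let β : Option F → F := fun a => a.elim 1 fun x => x
  have hl : ∀ a, lineForm θ a = algebraMap F K (α a) * θ + algebraMap F K (β a) := by
    rintro (_ | x) <;> simp [lineForm, α, β]
  obtain ⟨h₀, h₁, h₂⟩ := hθ (β a * β b - r * (β c * β d))
    (α a * β b + α b * β a - r * (α c * β d + α d * β c)) (α a * α b - r * (α c * α d)) (by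
      simp only [hl] at h
      simp only [map_sub, map_mul, map_add]
      linear_combination h)
  rcases a with _ | a <;> rcases b with _ | b <;> rcases c with _ | c <;> rcases d with _ | d <;>
    simp only [α, β, Option.elim] at h₀ h₁ h₂ <;> clear h hl hθ α β <;>
    simp only [Option.some.injEq, reduceCtorEq, and_true, true_and, and_false, false_and, or_false,
      false_or, or_self] <;> grind

lemma exists_isSidon_quotient {F K : Type*} [Field F] [Field K] [Algebra F K] [Finite K]
    (h3 : Module.finrank F K = 3) :
    ∃ f : Option F → Kˣ ⧸ (Units.map (algebraMap F K).toMonoidHom).range,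
      ∀ a b c d, f a * f b = f c * f d → (a = c ∧ b = d) ∨ (a = d ∧ b = c) := by
  obtain ⟨θ, hθ⟩ := exists_forall_algebraMap_add_eq_zero h3
  have hne : ∀ a : Option F, lineForm θ a ≠ 0 := by
    rintro (_ | x) h
    · simp [lineForm] at h
    · have := hθ x 1 0 (by simpa [lineForm, add_comm] using h)
      simp at this
  refine ⟨fun a => QuotientGroup.mk (Units.mk0 (lineForm θ a) (hne a)), fun a b c d h => ?_⟩
  simp only [← QuotientGroup.mk_mul] at h
  rw [eq_comm, QuotientGroup.eq] at h
  obtain ⟨r, hr⟩ := h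
  refine lineForm_mul_eq hθ r.ne_zero ?_
  have := congrArg Units.val (eq_inv_mul_iff_mul_eq.1 hr)
  simpa [mul_comm] using this.symm

lemma card_quotient_units {F K : Type*} [Field F] [Field K] [Algebra F K] [Finite K]
    (h3 : Module.finrank F K = 3) :
    Nat.card (Kˣ ⧸ (Units.map (algebraMap F K).toMonoidHom).range) =
      Nat.card F ^ 2 + Nat.card F + 1 := by
  have : Finite F := Finite.of_injective _ (algebraMap F K).injective
  have : FiniteDimensional F K := Module.finite_of_finrank_pos (by omega)
  have hK : Nat.card K = Nat.card F ^ 3 := by rw [← h3]; exact Module.natCard_eq_pow_finrank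
  have h := Subgroup.card_eq_card_quotient_mul_card_subgroup
    (Units.map (algebraMap F K).toMonoidHom).range
  have hr : Nat.card (Units.map (algebraMap F K).toMonoidHom).range = Nat.card Fˣ :=
    (Nat.card_congr (MonoidHom.ofInjective
      (Units.map_injective (algebraMap F K).injective)).toEquiv).symm
  rw [hr, Nat.card_units, Nat.card_units, hK] at h
  have h1 : 1 < Nat.card F := Finite.one_lt_card
  obtain ⟨m, hm⟩ : ∃ m, Nat.card F = m + 2 := ⟨Nat.card F - 2, by omega⟩
  rw [hm] at h ⊢
  refine Nat.eq_of_mul_eq_mul_right (show 0 < m + 1 by omega) ?_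
  rw [show m + 2 - 1 = m + 1 by omega] at h
  rw [← h, Nat.sub_eq_iff_eq_add (Nat.one_le_pow _ _ (by omega))]
  ring

/-- **Singer's theorem**: for every prime power `q` there is a Sidon set with `q + 1` elements in
the cyclic group of order `q ^ 2 + q + 1`. -/
theorem exists_sidon_zmod {q : ℕ} (hq : IsPrimePow q) :
    ∃ A : Finset (ZMod (q ^ 2 + q + 1)), A.card = q + 1 ∧ IsSidonFinset A := by
  obtain ⟨p, k, hp, hk, rfl⟩ := (isPrimePow_nat_iff _).1 hq
  have : Fact p.Prime := ⟨hp⟩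
  let F := GaloisField p k
  let K := FiniteField.Extension F p 3
  have hF : Nat.card F = p ^ k := GaloisField.card p k hk.ne'
  have h3 : Module.finrank F K = 3 := FiniteField.finrank_extension F p 3
  have : Finite K := Module.finite_of_finite F
  obtain ⟨f, hf⟩ := exists_isSidon_quotient h3
  have hN := card_quotient_units h3
  rw [hF] at hN
  have : Fintype F := Fintype.ofFinite F
  let e := zmodCyclicMulEquiv
    (G := Kˣ ⧸ (Units.map (algebraMap F K).toMonoidHom).range) inferInstance
  rw [hN] at e
  let g : Option F → ZMod ((p ^ k) ^ 2 + p ^ k + 1) := fun a => (e.symm (f a)).toAdd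
  have hg : ∀ a b c d, g a + g b = g c + g d → (a = c ∧ b = d) ∨ (a = d ∧ b = c) := by
    intro a b c d h
    refine hf a b c d (e.symm.injective ?_)
    rw [map_mul, map_mul]
    exact Multiplicative.toAdd.injective h
  have hinj : Function.Injective g := fun a b h => by
    rcases hg a a b b (by rw [h]) with h | h <;> exact h.1
  refine ⟨Finset.univ.map ⟨g, hinj⟩, ?_, ?_⟩
  · rw [Finset.card_map, Finset.card_univ, Fintype.card_option, ← Nat.card_eq_fintype_card, hF]
  · simp only [IsSidonFinset, Finset.mem_map, Finset.mem_univ, true_and, Function.Embedding.coeFn_mk]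
    rintro _ ⟨a, rfl⟩ _ ⟨b, rfl⟩ _ ⟨c, rfl⟩ _ ⟨d, rfl⟩ h
    rcases hg a b c d h with ⟨rfl, rfl⟩ | ⟨rfl, rfl⟩ <;> simp

lemma IsSidonFinset.injOn_sub {M : Type*} [AddCommGroup M] [DecidableEq M] {A : Finset M}
    (hA : IsSidonFinset A) : Set.InjOn (fun x : M × M => x.2 - x.1) (A.offDiag : Set (M × M)) := by
  rintro ⟨a, b⟩ hab ⟨c, d⟩ hcd h
  simp only [Finset.mem_coe, Finset.mem_offDiag] at hab hcd
  rcases hA b hab.2.1 c hcd.1 d hcd.2.1 a hab.1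
    (by have := sub_eq_sub_iff_add_eq_add.1 h; simpa using this) with h | h
  · simp [h.1, h.2]
  · exact absurd h.1.symm hab.2.2

lemma IsSidonFinset.exists_sub_eq {M : Type*} [AddCommGroup M] [Fintype M] [DecidableEq M]
    {A : Finset M} (hA : IsSidonFinset A) (hcard : Fintype.card M ≤ A.card * A.card - A.card + 1)
    {x : M} (hx : x ≠ 0) : ∃ a ∈ A, ∃ b ∈ A, b - a = x := by
  have hsub : A.offDiag.image (fun x : M × M => x.2 - x.1) ⊆ Finset.univ.erase 0 := by
    intro y hy
    obtain ⟨⟨a, b⟩, hab, rfl⟩ := Finset.mem_image.1 hy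
    rw [Finset.mem_offDiag] at hab
    simpa [sub_eq_zero] using hab.2.2.symm
  have heq := Finset.eq_of_subset_of_card_le hsub (by
    rw [Finset.card_image_of_injOn hA.injOn_sub, Finset.offDiag_card,
      Finset.card_erase_of_mem (Finset.mem_univ _), Finset.card_univ]
    omega)
  have hmem : x ∈ A.offDiag.image (fun x : M × M => x.2 - x.1) := by
    rw [heq]; simp [hx]
  obtain ⟨⟨a, b⟩, hab, h⟩ := Finset.mem_image.1 hmem
  rw [Finset.mem_offDiag] at hab
  exact ⟨a, hab.1, b, hab.2.1, h⟩

lemma IsSidonFinset.card_mul_card_sub_le {C : Finset ℤ} (hC : IsSidonFinset C) {m n : ℤ}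
    (hmn : m ≤ n) (h : ∀ x ∈ C, m ≤ x ∧ x ≤ n) :
    ((C.card * C.card - C.card : ℕ) : ℤ) ≤ 2 * (n - m) + 1 := by
  have hle : (C.offDiag.image fun x : ℤ × ℤ => x.2 - x.1).card ≤
      (Finset.Icc (-(n - m)) (n - m)).card := by
    refine Finset.card_le_card fun y hy => ?_
    obtain ⟨⟨a, b⟩, hab, rfl⟩ := Finset.mem_image.1 hy
    rw [Finset.mem_offDiag] at hab
    have ha := h _ hab.1
    have hb := h _ hab.2.1
    simp only [Finset.mem_Icc] at *
    omega
  rw [Finset.card_image_of_injOn hC.injOn_sub, Finset.offDiag_card, Int.card_Icc] at hle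
  omega

/-- For `0 < d ≤ q ^ 2 + q`, some translate of a Singer difference set contains both `0` and `d`;
its elements up to `d` form a Sidon set, from which few elements are missing. -/
lemma exists_sidon_endpoints {q : ℕ} (hq : IsPrimePow q) {d : ℕ} (hd : 0 < d)
    (hdq : d ≤ q ^ 2 + q) :
    ∃ B : Finset ℕ, IsSidonFinset B ∧ 0 ∈ B ∧ d ∈ B ∧ (∀ x ∈ B, x ≤ d) ∧
      ∃ k : ℕ, B.card + k = q + 1 ∧ k * k ≤ k + 2 * (q ^ 2 + q + 1 - d) := by
  obtain ⟨A, hcard, hA⟩ := exists_sidon_zmod hq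
  have hd0 : (d : ZMod (q ^ 2 + q + 1)) ≠ 0 := by
    rw [Ne, ZMod.natCast_eq_zero_iff]
    exact Nat.not_dvd_of_pos_of_lt hd (by omega)
  obtain ⟨a, ha, b, hb, hab⟩ := hA.exists_sub_eq (by
    rw [ZMod.card, hcard]
    have : (q + 1) * (q + 1) = q ^ 2 + q + (q + 1) := by ring
    omega) hd0
  let f : ZMod (q ^ 2 + q + 1) → ℕ := fun x => (x - a).val
  have hf : Function.Injective f := fun x y h => sub_left_injective (ZMod.val_injective _ h)
  have hS : ∀ x ∈ A, ∀ y ∈ A, ∀ z ∈ A, ∀ w ∈ A, f x + f y = f z + f w →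
      (f x = f z ∧ f y = f w) ∨ (f x = f w ∧ f y = f z) := by
    intro x hx y hy z hz w hw h
    have h' := congrArg (Nat.cast : ℕ → ZMod (q ^ 2 + q + 1)) h
    simp only [f, Nat.cast_add, ZMod.natCast_zmod_val] at h'
    rcases hA x hx y hy z hz w hw (by linear_combination h') with ⟨rfl, rfl⟩ | ⟨rfl, rfl⟩ <;> simp
  refine ⟨(A.image f).filter (· ≤ d), ?_, ?_, ?_, ?_,
    ((A.image f).filter (¬ · ≤ d)).card, ?_, ?_⟩
  · intro x hx y hy z hz w hw h
    simp only [Finset.mem_filter, Finset.mem_image] at hx hy hz hw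
    obtain ⟨⟨x, hx, rfl⟩, -⟩ := hx
    obtain ⟨⟨y, hy, rfl⟩, -⟩ := hy
    obtain ⟨⟨z, hz, rfl⟩, -⟩ := hz
    obtain ⟨⟨w, hw, rfl⟩, -⟩ := hw
    exact hS x hx y hy z hz w hw h
  · exact Finset.mem_filter.2 ⟨Finset.mem_image.2 ⟨a, ha, by simp [f]⟩, Nat.zero_le _⟩
  · refine Finset.mem_filter.2 ⟨Finset.mem_image.2 ⟨b, hb, ?_⟩, le_rfl⟩
    simp only [f, hab]
    exact ZMod.val_cast_of_lt (by omega)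
  · exact fun x hx => (Finset.mem_filter.1 hx).2
  · rw [Finset.card_filter_add_card_filter_not, Finset.card_image_of_injective _ hf, hcard]
  · have hC : IsSidonFinset (((A.image f).filter (¬ · ≤ d)).map Nat.castEmbedding : Finset ℤ) := by
      intro x hx y hy z hz w hw h
      simp only [Finset.mem_map, Finset.mem_filter, Finset.mem_image] at hx hy hz hw
      obtain ⟨_, ⟨⟨x, hx, rfl⟩, -⟩, rfl⟩ := hx
      obtain ⟨_, ⟨⟨y, hy, rfl⟩, -⟩, rfl⟩ := hy
      obtain ⟨_, ⟨⟨z, hz, rfl⟩, -⟩, rfl⟩ := hz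
      obtain ⟨_, ⟨⟨w, hw, rfl⟩, -⟩, rfl⟩ := hw
      simp only [Nat.castEmbedding_apply] at h ⊢
      exact_mod_cast hS x hx y hy z hz w hw (by exact_mod_cast h)
    have := hC.card_mul_card_sub_le (m := d) (n := (q ^ 2 + q : ℕ)) (by exact_mod_cast hdq) (by
      intro x hx
      simp only [Finset.mem_map, Finset.mem_filter, Finset.mem_image] at hx
      obtain ⟨_, ⟨⟨x, hx, rfl⟩, hxd⟩, rfl⟩ := hx
      have := ZMod.val_lt (x - a)
      simp only [Nat.castEmbedding_apply, f] at hxd ⊢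
      omega)
    rw [Finset.card_map] at this
    omega

/-- The graph on `Fin n` consisting of the path `1, 2, …, n - 1` together with the hub `0`, which is
joined to the elements of `A`. -/
def hubPath (n : ℕ) (A : Finset ℕ) : SimpleGraph (Fin n) :=
  SimpleGraph.fromRel fun i j => (0 < i.val ∧ j.val = i.val + 1) ∨ (i.val = 0 ∧ j.val ∈ A)

lemma hubPath_adj_of_lt {n : ℕ} {A : Finset ℕ} {i j : Fin n} (h : i < j) :
    (hubPath n A).Adj i j ↔ (0 < i.val ∧ j.val = i.val + 1) ∨ (i.val = 0 ∧ j.val ∈ A) := by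
  have hne : i ≠ j := h.ne
  have hlt : i.val < j.val := h
  simp only [hubPath, SimpleGraph.fromRel_adj]
  constructor
  · rintro ⟨-, h | h⟩
    · exact h
    · omega
  · exact fun h => ⟨hne, Or.inl h⟩

/-- The edges of the cycle of a hub graph that uses the hub edges to `a` and `b`. -/
def hubCycle (a b : ℕ) : Finset (Sym2 ℕ) :=
  {s(0, a), s(0, b)} ∪ (Finset.Ico a b).image fun i => s(i, i + 1)

lemma injective_sym2_succ : Function.Injective fun i : ℕ => s(i, i + 1) := by
  intro i j h
  simp only [Sym2.eq_iff] at h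
  omega

lemma card_hubCycle {a b : ℕ} (ha : 0 < a) (hab : a < b) : (hubCycle a b).card = b - a + 2 := by
  have hdisj : Disjoint {s(0, a), s(0, b)} ((Finset.Ico a b).image fun i => s(i, i + 1)) := by
    rw [Finset.disjoint_left]
    intro e he he'
    obtain ⟨i, hi, rfl⟩ := Finset.mem_image.1 he'
    rw [Finset.mem_Ico] at hi
    simp only [Finset.mem_insert, Finset.mem_singleton, Sym2.eq_iff] at he
    omega
  rw [hubCycle, Finset.card_union_of_disjoint hdisj,
    Finset.card_image_of_injective _ injective_sym2_succ, Nat.card_Ico, Finset.card_pair, add_comm]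
  simp only [Ne, Sym2.eq_iff]
  omega

/-- A symmetric relation supported on the edges of a hub graph, in which every vertex has no or
exactly two neighbours, is a cycle through the hub. -/
lemma exists_forall_iff_of_degree {A : Finset ℕ} {P : ℕ → ℕ → Prop}
    (hsymm : ∀ i j, P i j → P j i) (hirr : ∀ i, ¬ P i i)
    (hP : ∀ i j, i < j → P i j → (0 < i ∧ j = i + 1) ∨ (i = 0 ∧ j ∈ A))
    (hdeg : ∀ i, (∀ k, ¬ P i k) ∨ ∃ x y, x ≠ y ∧ ∀ k, P i k ↔ k = x ∨ k = y)
    (hne : ∃ i j, P i j) :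
    ∃ a ∈ A, ∃ b ∈ A, a < b ∧ ∀ i j, i < j →
      (P i j ↔ (i = 0 ∧ (j = a ∨ j = b)) ∨ (a ≤ i ∧ i < b ∧ j = i + 1)) := by
  let f : ℕ → Prop := fun j => 0 < j ∧ P j (j + 1)
  have hnb : ∀ j, 0 < j → ∀ k, P j k → k = 0 ∨ (k + 1 = j ∧ 0 < k) ∨ k = j + 1 := by
    intro j hj k hk
    rcases lt_trichotomy j k with h | h | h
    · have := hP j k h hk
      omega
    · exact absurd (h ▸ hk) (hirr j)
    · have := hP k j h (hsymm _ _ hk)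
      omega
  have hrec : ∀ j, f (j + 1) ↔ ¬ (f j ↔ P 0 (j + 1)) := by
    intro j
    have h0 : P 0 (j + 1) ↔ P (j + 1) 0 := ⟨hsymm _ _, hsymm _ _⟩
    have hj : f j ↔ 0 < j ∧ P (j + 1) j := and_congr_right fun _ => ⟨hsymm _ _, hsymm _ _⟩
    have hj' : f (j + 1) ↔ P (j + 1) (j + 2) := by simp [f]
    rw [h0, hj, hj']
    rcases hdeg (j + 1) with h | ⟨x, y, hxy, h⟩
    · simp [h]
    · have hx := hnb (j + 1) (by omega) x ((h x).2 (Or.inl rfl))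
      have hy := hnb (j + 1) (by omega) y ((h y).2 (Or.inr rfl))
      simp only [h]
      omega
  have hf0 : ¬ f 0 := fun h => absurd h.1 (lt_irrefl _)
  rcases hdeg 0 with h | ⟨x, y, hxy, h⟩
  · exfalso
    have hf : ∀ j, ¬ f j := by
      intro j
      induction j with
      | zero => exact hf0
      | succ j ih => rw [hrec]; simp [ih, h]
    have hlt : ∀ i j, i < j → ¬ P i j := by
      intro i j hij hPij
      rcases hP i j hij hPij with ⟨hi, rfl⟩ | ⟨rfl, -⟩
      · exact hf i ⟨hi, hPij⟩
      · exact h j hPij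
    obtain ⟨i, j, hij⟩ := hne
    rcases lt_trichotomy i j with h' | rfl | h'
    · exact hlt i j h' hij
    · exact hirr i hij
    · exact hlt j i h' (hsymm _ _ hij)
  · wlog hlt : x < y generalizing x y
    · exact this y x hxy.symm (fun k => (h k).trans or_comm) (by omega)
    have hmem : ∀ k, P 0 k → 0 < k ∧ k ∈ A := by
      intro k hk
      have hk0 : 0 < k := Nat.pos_of_ne_zero fun h => hirr 0 (h ▸ hk)
      rcases hP 0 k hk0 hk with h | h
      · omega
      · exact ⟨hk0, h.2⟩
    have hx := hmem x ((h x).2 (Or.inl rfl))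
    have hy := hmem y ((h y).2 (Or.inr rfl))
    have hf : ∀ j, f j ↔ x ≤ j ∧ j < y := by
      intro j
      induction j with
      | zero => simp only [hf0, false_iff]; omega
      | succ j ih => rw [hrec, ih, h]; omega
    refine ⟨x, hx.2, y, hy.2, hlt, fun i j hij => ⟨fun hPij => ?_, ?_⟩⟩
    · rcases hP i j hij hPij with ⟨hi, rfl⟩ | ⟨rfl, -⟩
      · exact Or.inr ⟨((hf i).1 ⟨hi, hPij⟩).1, ((hf i).1 ⟨hi, hPij⟩).2, rfl⟩
      · exact Or.inl ⟨rfl, (h j).1 hPij⟩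
    · rintro (⟨rfl, hj⟩ | ⟨h1, h2, rfl⟩)
      · exact (h j).2 hj
      · exact ((hf i).2 ⟨h1, h2⟩).2

lemma IsCycleSet.exists_image_eq_hubCycle {n : ℕ} {A : Finset ℕ} (hA : 0 ∉ A)
    {s : Finset (Sym2 (Fin n))} (hs : IsCycleSet (hubPath n A) s) :
    ∃ a ∈ A, ∃ b ∈ A, a < b ∧ s.image (Sym2.map Fin.val) = hubCycle a b := by
  obtain ⟨u, w, hw, rfl⟩ := hs
  let P : ℕ → ℕ → Prop := fun i j => ∃ x y : Fin n, x.val = i ∧ y.val = j ∧ w.toSubgraph.Adj x y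
  have hPval : ∀ x y : Fin n, P x y ↔ w.toSubgraph.Adj x y := by
    refine fun x y => ⟨?_, fun h => ⟨x, y, rfl, rfl, h⟩⟩
    rintro ⟨x', y', hx, hy, h⟩
    rwa [Fin.ext hx, Fin.ext hy] at h
  have hsymm : ∀ i j, P i j → P j i := fun i j ⟨x, y, hx, hy, h⟩ => ⟨y, x, hy, hx, h.symm⟩
  have hirr : ∀ i, ¬ P i i := by
    rintro i ⟨x, y, rfl, hy, h⟩
    exact h.ne (Fin.ext hy.symm)
  obtain ⟨a, ha, b, hb, hab, hiff⟩ := exists_forall_iff_of_degree hsymm hirr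
    (by
      rintro i j hij ⟨x, y, rfl, rfl, h⟩
      exact (hubPath_adj_of_lt hij).1 h.adj_sub)
    (by
      intro i
      by_cases hi : ∃ x ∈ w.support, x.val = i
      · obtain ⟨x, hx, rfl⟩ := hi
        obtain ⟨y, z, hyz, hN⟩ := Set.ncard_eq_two.1 (hw.ncard_neighborSet_toSubgraph_eq_two hx)
        refine Or.inr ⟨y, z, fun h => hyz (Fin.ext h), fun k => ⟨?_, ?_⟩⟩
        · rintro ⟨x', k, hx', rfl, h⟩
          obtain rfl := Fin.ext hx'
          have : k ∈ w.toSubgraph.neighborSet x' := h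
          rw [hN] at this
          rcases this with rfl | rfl <;> simp
        · have hy : y ∈ w.toSubgraph.neighborSet x := by rw [hN]; simp
          have hz : z ∈ w.toSubgraph.neighborSet x := by rw [hN]; simp
          rintro (rfl | rfl)
          · exact (hPval x y).2 hy
          · exact (hPval x z).2 hz
      · refine Or.inl fun k ⟨x, y, hx, _, h⟩ => hi ⟨x, ?_, hx⟩
        exact w.mem_verts_toSubgraph.1 h.fst_mem)
    (by
      have hu := hw.ncard_neighborSet_toSubgraph_eq_two w.start_mem_support
      obtain ⟨y, hy⟩ := Set.nonempty_of_ncard_ne_zero (hu.trans_ne two_ne_zero)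
      exact ⟨u, y, (hPval _ _).2 hy⟩)
  have ha0 : a ≠ 0 := fun h => hA (h ▸ ha)
  have hedge : ∀ x y : Fin n, s(x, y) ∈ w.edges ↔ P x y := by
    intro x y
    rw [hPval, ← SimpleGraph.Walk.mem_edges_toSubgraph, SimpleGraph.Subgraph.mem_edgeSet]
  refine ⟨a, ha, b, hb, hab, ?_⟩
  have hmem : ∀ i j, P i j → s(i, j) ∈ w.edges.toFinset.image (Sym2.map Fin.val) := by
    rintro i j ⟨x, y, rfl, rfl, h⟩
    exact Finset.mem_image.2 ⟨s(x, y), by simpa using (hedge x y).2 ((hPval x y).2 h), rfl⟩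
  have hlt : ∀ i j, i < j → P i j → s(i, j) ∈ hubCycle a b := by
    intro i j hij hPij
    rw [hiff i j hij] at hPij
    simp only [hubCycle, Finset.mem_union, Finset.mem_insert, Finset.mem_singleton,
      Finset.mem_image, Finset.mem_Ico]
    rcases hPij with ⟨rfl, rfl | rfl⟩ | ⟨h1, h2, rfl⟩
    · simp
    · simp
    · exact Or.inr ⟨i, ⟨h1, h2⟩, rfl⟩
  refine Finset.Subset.antisymm (fun e he => ?_) (fun e he => ?_)
  · obtain ⟨⟨x, y⟩, hxy, rfl⟩ := Finset.mem_image.1 he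
    have he : P x y := (hedge x y).1 (List.mem_toFinset.1 hxy)
    change s(x.val, y.val) ∈ hubCycle a b
    rcases lt_trichotomy x.val y.val with h | h | h
    · exact hlt _ _ h he
    · exact absurd (h ▸ he) (hirr _)
    · rw [Sym2.eq_swap]
      exact hlt _ _ h (hsymm _ _ he)
  · simp only [hubCycle, Finset.mem_union, Finset.mem_insert, Finset.mem_singleton,
      Finset.mem_image, Finset.mem_Ico] at he
    rcases he with (rfl | rfl) | ⟨i, hi, rfl⟩
    · exact hmem _ _ ((hiff 0 a (by omega)).2 (by simp))
    · exact hmem _ _ ((hiff 0 b (by omega)).2 (by simp))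
    · exact hmem _ _ ((hiff i (i + 1) (by omega)).2 (by simp [hi]))

lemma isCycleSet_hubPath_eq_of_card_eq {n : ℕ} {A : Finset ℕ} (hA : 0 ∉ A) (hS : IsSidonFinset A)
    {s t : Finset (Sym2 (Fin n))} (hs : IsCycleSet (hubPath n A) s)
    (ht : IsCycleSet (hubPath n A) t) (hst : s.card = t.card) : s = t := by
  have hinj : Function.Injective (Sym2.map (Fin.val : Fin n → ℕ)) :=
    Sym2.map.injective Fin.val_injective
  obtain ⟨a, ha, b, hb, hab, hs⟩ := hs.exists_image_eq_hubCycle hA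
  obtain ⟨c, hc, d, hd, hcd, ht⟩ := ht.exists_image_eq_hubCycle hA
  have ha0 : a ≠ 0 := fun h => hA (h ▸ ha)
  have hc0 : c ≠ 0 := fun h => hA (h ▸ hc)
  have hs' := card_hubCycle (Nat.pos_of_ne_zero ha0) hab
  have ht' := card_hubCycle (Nat.pos_of_ne_zero hc0) hcd
  rw [← hs, Finset.card_image_of_injective _ hinj] at hs'
  rw [← ht, Finset.card_image_of_injective _ hinj] at ht'
  rcases hS b hb c hc d hd a ha (by omega) with ⟨rfl, rfl⟩ | ⟨rfl, rfl⟩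
  · exact Finset.image_injective hinj (hs.trans ht.symm)
  · omega

lemma card_le_ncard_edgeSet_hubPath {n : ℕ} (hn : 2 ≤ n) {A : Finset ℕ}
    (hA : ∀ a ∈ A, 0 < a ∧ a < n) : n - 2 + A.card ≤ (hubPath n A).edgeSet.ncard := by
  have hinj : Function.Injective (Sym2.map (Fin.val : Fin n → ℕ)) :=
    Sym2.map.injective Fin.val_injective
  have hdisj : Disjoint ((Finset.Ico 1 (n - 1)).image fun i => s(i, i + 1))
      (A.image fun a => s(0, a)) := by
    rw [Finset.disjoint_left]
    intro e he he'
    obtain ⟨i, hi, rfl⟩ := Finset.mem_image.1 he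
    obtain ⟨a, -, h⟩ := Finset.mem_image.1 he'
    rw [Finset.mem_Ico] at hi
    rw [Sym2.eq_iff] at h
    omega
  have hinj' : Function.Injective fun a : ℕ => s(0, a) := by
    intro a b h
    simp only [Sym2.eq_iff] at h
    omega
  have hcard := Finset.card_union_of_disjoint hdisj
  rw [Finset.card_image_of_injective _ injective_sym2_succ,
    Finset.card_image_of_injective _ hinj', Nat.card_Ico] at hcard
  rw [← Set.ncard_image_of_injective _ hinj,
    show n - 2 + A.card = n - 1 - 1 + A.card by omega, ← hcard, ← Set.ncard_coe_finset]
  refine Set.ncard_le_ncard (fun e he => ?_) (Set.toFinite _)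
  rw [Finset.coe_union, Finset.coe_image, Finset.coe_image] at he
  rcases he with ⟨i, hi, rfl⟩ | ⟨a, ha, rfl⟩
  · rw [Finset.mem_coe, Finset.mem_Ico] at hi
    refine ⟨s(⟨i, by omega⟩, ⟨i + 1, by omega⟩), ?_, rfl⟩
    rw [SimpleGraph.mem_edgeSet, hubPath_adj_of_lt (by simp)]
    exact Or.inl ⟨hi.1, rfl⟩
  · have ha' := hA a ha
    refine ⟨s(⟨0, by omega⟩, ⟨a, ha'.2⟩), ?_, rfl⟩
    rw [SimpleGraph.mem_edgeSet, hubPath_adj_of_lt (Fin.mk_lt_mk.2 ha'.1)]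
    exact Or.inr ⟨rfl, ha⟩

lemma connected_deleteVerts_hubPath {n : ℕ} (hn : 3 ≤ n) {A : Finset ℕ} (h1 : 1 ∈ A)
    (hlast : n - 1 ∈ A) (v : Fin n) :
    ((⊤ : (hubPath n A).Subgraph).deleteVerts {v}).coe.Connected := by
  set C := ((⊤ : (hubPath n A).Subgraph).deleteVerts {v}).coe with hC
  have hv : ∀ x : Fin n, x ≠ v → x ∈ ((⊤ : (hubPath n A).Subgraph).deleteVerts {v}).verts := by
    intro x hx
    simpa using hx
  have hv' : ∀ x : ((⊤ : (hubPath n A).Subgraph).deleteVerts {v}).verts, x.1 ≠ v := by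
    intro x
    simpa using x.2
  have hadj : ∀ x y : ((⊤ : (hubPath n A).Subgraph).deleteVerts {v}).verts, x.1.val < y.1.val →
      ((0 < x.1.val ∧ y.1.val = x.1.val + 1) ∨ (x.1.val = 0 ∧ y.1.val ∈ A)) → C.Adj x y := by
    intro x y hxy h
    rw [hC, SimpleGraph.Subgraph.coe_adj, SimpleGraph.Subgraph.deleteVerts_adj]
    refine ⟨trivial, by simpa using hv' x, trivial, by simpa using hv' y, ?_⟩
    exact (hubPath_adj_of_lt hxy).2 h
  rw [SimpleGraph.connected_iff_exists_forall_reachable]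
  by_cases hv0 : v.val = 0
  · have hb : (⟨1, by omega⟩ : Fin n) ≠ v := fun h => by simp [← h] at hv0
    refine ⟨⟨⟨1, by omega⟩, hv _ hb⟩, ?_⟩
    suffices h : ∀ m, ∀ hm : m + 1 < n, ∀ hm' : (⟨m + 1, hm⟩ : Fin n) ≠ v,
        C.Reachable ⟨⟨1, by omega⟩, hv _ hb⟩ ⟨⟨m + 1, hm⟩, hv _ hm'⟩ by
      rintro ⟨⟨x, hx⟩, hxv⟩
      have hxv' := hv' ⟨⟨x, hx⟩, hxv⟩
      have hx0 : x ≠ 0 := fun h => hxv' (Fin.ext (by simp [h, hv0]))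
      obtain ⟨m, rfl⟩ := Nat.exists_eq_succ_of_ne_zero hx0
      exact h m hx hxv'
    intro m
    induction m with
    | zero => exact fun _ _ => SimpleGraph.Reachable.refl _
    | succ m ih =>
      intro hm hm'
      have hne : (⟨m + 1, by omega⟩ : Fin n) ≠ v := fun h => by simp [← h] at hv0
      exact (ih (by omega) hne).trans (hadj _ _ (by simp) (by simp)).reachable
  · have hb : (⟨0, by omega⟩ : Fin n) ≠ v := fun h => hv0 (by simp [← h])
    refine ⟨⟨⟨0, by omega⟩, hv _ hb⟩, ?_⟩
    have hdown : ∀ m, ∀ hm : m < v.val,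
        C.Reachable ⟨⟨0, by omega⟩, hv _ hb⟩ ⟨⟨m, by omega⟩, hv _ (Fin.ne_of_lt hm)⟩ := by
      intro m
      induction m with
      | zero => exact fun _ => SimpleGraph.Reachable.refl _
      | succ m ih =>
        intro hm
        rcases m with _ | m
        · exact (hadj _ _ (by simp) (by simp [h1])).reachable
        · exact (ih (by omega)).trans (hadj _ _ (by simp) (by simp)).reachable
    have hup : ∀ m, ∀ hm : v.val < n - 1 - m,
        C.Reachable ⟨⟨0, by omega⟩, hv _ hb⟩ ⟨⟨n - 1 - m, by omega⟩, hv _ (Fin.ne_of_gt hm)⟩ := by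
      intro m
      induction m with
      | zero => exact fun _ => (hadj _ _ (by simp; omega) (by simp [hlast])).reachable
      | succ m ih =>
        intro hm
        refine (ih (by omega)).trans (hadj _ _ ?_ ?_).symm.reachable
        · simp only; omega
        · simp only; omega
    rintro ⟨⟨x, hx⟩, hxv⟩
    have hxv' := hv' ⟨⟨x, hx⟩, hxv⟩
    rcases lt_trichotomy x v.val with h | h | h
    · exact hdown x h
    · exact absurd (Fin.ext h) hxv'
    · have := hup (n - 1 - x) (by omega)
      have hx' : n - 1 - (n - 1 - x) = x := by omega
      simpa only [hx'] using this

lemma exists_isPrimePow_sqrt_le {η : ℝ} (hη : 0 < η) :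
    ∀ᶠ n : ℕ in Filter.atTop, ∃ q : ℕ, IsPrimePow q ∧ √n ≤ q ∧ (q : ℝ) ≤ (1 + η) * √n := by
  have hlog : 0 < Real.log (1 + η) := Real.log_pos (by linarith)
  have hev := exists_isPrimePow_abs_log_sub_le (half_pos hlog)
  have hlim : Filter.Tendsto (fun n : ℕ => Real.log √n + Real.log (1 + η) / 2)
      Filter.atTop Filter.atTop :=
    Filter.tendsto_atTop_add_const_right _ _ (Real.tendsto_log_atTop.comp
      (Real.tendsto_sqrt_atTop.comp tendsto_natCast_atTop_atTop))
  filter_upwards [hlim.eventually hev, Filter.eventually_gt_atTop 0] with n ⟨q, hq, hle⟩ hn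
  have hs : 0 < √(n : ℝ) := Real.sqrt_pos.2 (by exact_mod_cast hn)
  have hq0 : (0 : ℝ) < q := by exact_mod_cast hq.pos
  rw [abs_le] at hle
  refine ⟨q, hq, (Real.log_le_log_iff hs hq0).1 (by linarith), ?_⟩
  rw [← Real.log_le_log_iff hq0 (by positivity), Real.log_mul (by positivity) hs.ne']
  linarith

/-- For large `n` there is a Sidon set in `{1, …, n - 1}` containing `1` and `n - 1`, with at least
`(1 - ε)√n + 2` elements. -/
lemma exists_sidon_card_ge {ε : ℝ} (hε : 0 < ε) (hε1 : ε ≤ 1) :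
    ∀ᶠ n : ℕ in Filter.atTop, ∃ A : Finset ℕ, IsSidonFinset A ∧ 1 ∈ A ∧ n - 1 ∈ A ∧
      (∀ a ∈ A, 0 < a ∧ a < n) ∧ (1 - ε) * √n + 2 ≤ A.card := by
  have hη : 0 < ε ^ 2 / 12 := by positivity
  have hlim : Filter.Tendsto (fun n : ℕ => ε ^ 2 * √(n : ℝ)) Filter.atTop Filter.atTop :=
    (Real.tendsto_sqrt_atTop.comp tendsto_natCast_atTop_atTop).const_mul_atTop (by positivity)
  filter_upwards [exists_isPrimePow_sqrt_le hη, hlim.eventually_ge_atTop 22,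
    Filter.eventually_ge_atTop 3] with n ⟨q, hq, hnq, hqn⟩ hlarge hn
  have hs0 : 0 ≤ √(n : ℝ) := Real.sqrt_nonneg _
  have hs2 : √(n : ℝ) ^ 2 = n := Real.sq_sqrt (Nat.cast_nonneg n)
  have hnq2 : n ≤ q ^ 2 := by
    have : (n : ℝ) ≤ (q : ℝ) ^ 2 := by rw [← hs2]; gcongr
    exact_mod_cast this
  obtain ⟨B, hB, h0, hd, hle, k, hk, hkk⟩ :=
    exists_sidon_endpoints hq (d := n - 2) (by omega) (by omega)
  refine ⟨B.map (addRightEmbedding 1), ?_, ?_, ?_, ?_, ?_⟩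
  · simp only [IsSidonFinset, Finset.mem_map, addRightEmbedding_apply]
    rintro _ ⟨a, ha, rfl⟩ _ ⟨b, hb, rfl⟩ _ ⟨c, hc, rfl⟩ _ ⟨d, hd, rfl⟩ h
    have := hB a ha b hb c hc d hd (by omega)
    omega
  · exact Finset.mem_map.2 ⟨0, h0, rfl⟩
  · exact Finset.mem_map.2 ⟨n - 2, hd, by simp only [addRightEmbedding_apply]; omega⟩
  · simp only [Finset.mem_map, addRightEmbedding_apply]
    rintro _ ⟨a, ha, rfl⟩
    have := hle a ha
    omega
  · rw [Finset.card_map]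
    have hk' : (B.card : ℝ) + k = q + 1 := by exact_mod_cast hk
    have hkk' : (k : ℝ) * k ≤ k + 2 * (q ^ 2 + q + 3 - n) := by
      have : k * k + 2 * n ≤ k + 2 * (q ^ 2 + q + 3) := by omega
      have : (k : ℝ) * k + 2 * n ≤ k + 2 * (q ^ 2 + q + 3) := by exact_mod_cast this
      linarith
    generalize √(n : ℝ) = s at *
    have hε2 : ε ^ 2 ≤ 1 := pow_le_one₀ hε.le hε1
    have hs1 : 22 ≤ s := by nlinarith
    have hεs : 22 ≤ ε * s := by nlinarith
    have hq2 : (q : ℝ) ^ 2 ≤ (1 + ε ^ 2 / 4) * s ^ 2 := by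
      have h1 : (q : ℝ) ^ 2 ≤ ((1 + ε ^ 2 / 12) * s) ^ 2 := by gcongr
      have h2 : (1 + ε ^ 2 / 12) ^ 2 ≤ 1 + ε ^ 2 / 4 := by nlinarith
      rw [mul_pow] at h1
      exact h1.trans (by gcongr)
    have hq1 : (q : ℝ) ≤ 2 * s := by nlinarith
    have hklt : (k : ℝ) + 1 ≤ ε * s := by
      by_contra! hcon
      have h1 : (k : ℝ) * k - k ≤ ε ^ 2 * s ^ 2 / 2 + 4 * s + 6 := by nlinarith
      have h2 : (ε * s - 1) * (ε * s - 2) ≤ (k : ℝ) * (k - 1) := by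
        apply mul_le_mul <;> linarith
      have h3 : 22 * s ≤ ε ^ 2 * s * s := by gcongr
      nlinarith
    linarith

/-- For every `ε > 0` and all sufficiently large `n`, there exists an `n`-vertex
2-connected graph with at least `n + (1 - ε)√n` edges in which no two cycles have the
same length. -/
theorem stmt11 (ε : ℝ) (hε : 0 < ε) :
    ∃ n0 : ℕ, ∀ n : ℕ, n0 ≤ n →
      ∃ G : SimpleGraph (Fin n),
        (3 ≤ Fintype.card (Fin n) ∧
          ∀ v : Fin n, ((⊤ : G.Subgraph).deleteVerts {v}).coe.Connected) ∧
        (∀ s t : Finset (Sym2 (Fin n)), IsCycleSet G s → IsCycleSet G t →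
          s.card = t.card → s = t) ∧
        (n : ℝ) + (1 - ε) * Real.sqrt n ≤ (G.edgeSet.ncard : ℝ) := by
  obtain ⟨n0, hn0⟩ := Filter.eventually_atTop.1 ((exists_sidon_card_ge (lt_min hε one_pos)
    (min_le_right _ _)).and (Filter.eventually_ge_atTop 3))
  refine ⟨n0, fun n hn => ?_⟩
  obtain ⟨⟨A, hA, h1, hlast, hmem, hcard⟩, h3⟩ := hn0 n hn
  refine ⟨hubPath n A, ⟨by simpa using h3, connected_deleteVerts_hubPath h3 h1 hlast⟩,
    fun s t => isCycleSet_hubPath_eq_of_card_eq (fun h => lt_irrefl _ (hmem 0 h).1) hA, ?_⟩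
  have hedge : (n : ℝ) + A.card ≤ (hubPath n A).edgeSet.ncard + 2 := by
    have := card_le_ncard_edgeSet_hubPath (by omega) hmem
    exact_mod_cast (by omega : n + A.card ≤ (hubPath n A).edgeSet.ncard + 2)
  have hmin : (1 - ε) * √n ≤ (1 - min ε 1) * √n := by
    gcongr
    exact min_le_left _ _
  linarith
end
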